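/- There is an absolute constant C such that, uniformly for all real x ≥ 1 and y ≥ 2, with u = log x / log y, one has | S(x,y) − 1 − x (log x) ∏_{p ≤ y, p prime} (1 − 1/p)² − (x/log y)·( ξ(u) − u e^{−2γ} − (2y/x)·𝟙[x ≥ y] ) | ≤ C x / (log y)². -/

import Mathlib

open Real MeasureTheory

/-- `S x y = ∑_{n ≤ x, P⁻(n) > y} τ(n)`, where `n = 1` is included since `P⁻(1) = ∞`. -/
noncomputable def S (x y : ℝ) : ℝ :=
  ∑ n ∈ (Finset.Icc 1 ⌊x⌋₊).filter (fun n => n = 1 ∨ y < (n.minFac : ℝ)),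
    (n.divisors.card : ℝ)

/-- `∏_{p ≤ y, p prime} (1 - 1/p)`. -/
noncomputable def primeProd (y : ℝ) : ℝ :=
  ∏ p ∈ (Finset.range (⌊y⌋₊ + 1)).filter Nat.Prime, (1 - 1 / (p : ℝ))

open Real MeasureTheory

namespace RD

noncomputable def zterm (n : ℕ) (s : ℂ) : ℂ :=
  (((n:ℂ)+1) ^ (1 - s) - (n:ℂ) ^ (1 - s)) / (1 - s) - ((n:ℂ)+1) ^ (-s)

lemma zterm_bound (n : ℕ) (hn : 1 ≤ n) (s : ℂ) (hs : 0 < s.re) (hs1 : s ≠ 1) :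
    ‖zterm n s‖ ≤ ‖s‖ * (n:ℝ) ^ (-s.re - 1) := by
  have hn0 : (0:ℝ) < n := by exact_mod_cast hn
  have h1s : (1 - s) ≠ 0 := sub_ne_zero.mpr (Ne.symm hs1)
  have hder : ∀ x ∈ Set.Icc (n:ℝ) (n+1), ‖((x:ℂ)^(-s) - ((n:ℂ)+1)^(-s))‖ ≤
      ‖s‖ * (n:ℝ) ^ (-s.re - 1) := by
    intro x hx
    have := Convex.norm_image_sub_le_of_norm_hasDerivWithin_le
      (f := fun x : ℝ => (x:ℂ)^(-s)) (f' := fun x : ℝ => (-s) * (x:ℂ)^(-s-1))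
      (s := Set.Icc (n:ℝ) (n+1)) (C := ‖s‖ * (n:ℝ) ^ (-s.re - 1)) (x := (n:ℝ)+1) (y := x)
      ?_ ?_ (convex_Icc _ _) ⟨by linarith, le_refl _⟩ hx
    · have h2 : ‖x - ((n:ℝ)+1)‖ ≤ 1 := by
        rw [Real.norm_eq_abs, abs_le]; constructor <;> linarith [hx.1, hx.2]
      have h3 : (0:ℝ) ≤ ‖s‖ * (n:ℝ) ^ (-s.re - 1) := by positivity
      push_cast at this
      calc _ ≤ _ := this
        _ ≤ _ := mul_le_of_le_one_right h3 h2
    · intro z hz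
      have hz0 : 0 < z := lt_of_lt_of_le hn0 hz.1
      exact (hasDerivAt_ofReal_cpow_const hz0.ne' (r := -s) (by
        intro h; apply_fun Complex.re at h; simp at h; linarith)).hasDerivWithinAt
    · intro z hz
      have hz0 : 0 < z := lt_of_lt_of_le hn0 hz.1
      rw [norm_mul, norm_neg, Complex.norm_cpow_eq_rpow_re_of_pos hz0]
      simp only [Complex.sub_re, Complex.neg_re, Complex.one_re]
      gcongr ‖s‖ * ?_
      exact Real.rpow_le_rpow_of_nonpos hn0 hz.1 (by linarith)
  have := Convex.norm_image_sub_le_of_norm_hasDerivWithin_le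
      (f := fun x : ℝ => (x:ℂ)^(1-s)/(1-s) - x * ((n:ℂ)+1)^(-s))
      (f' := fun x : ℝ => ((x:ℂ)^(-s) - ((n:ℂ)+1)^(-s)))
      (s := Set.Icc (n:ℝ) (n+1)) (C := ‖s‖ * (n:ℝ) ^ (-s.re - 1)) (x := (n:ℝ)) (y := (n:ℝ)+1)
      ?_ hder (convex_Icc _ _) ⟨le_refl _, by linarith⟩ ⟨by linarith, le_refl _⟩
  · simp only [add_sub_cancel_left, norm_one, mul_one] at this
    refine le_trans (le_of_eq ?_) this
    unfold zterm; push_cast; congr 1; ring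
  · intro z hz
    have hz0 : 0 < z := lt_of_lt_of_le hn0 hz.1
    have h5 := (hasDerivAt_ofReal_cpow_const' hz0.ne' (r := -s) (by
        intro h; apply h1s; linear_combination h)).hasDerivWithinAt
          (s := Set.Icc (n:ℝ) (n+1))
    have h7 : -s + 1 = 1 - s := by ring
    rw [h7] at h5
    have h6 : HasDerivWithinAt (fun x : ℝ => (x:ℂ) * ((n:ℂ)+1)^(-s)) (((n:ℂ)+1)^(-s))
        (Set.Icc (n:ℝ) (n+1)) z := by
      simpa using ((hasDerivAt_id z).ofReal_comp.mul_const (((n:ℂ)+1)^(-s))).hasDerivWithinAt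
    exact h5.sub h6

lemma zterm_summable (s : ℂ) (hs : 0 < s.re) (hs1 : s ≠ 1) :
    Summable (fun n : ℕ => zterm (n+1) s) := by
  have : Summable (fun n : ℕ => ‖s‖ * ((n+1 : ℕ):ℝ) ^ (-s.re - 1)) := by
    apply Summable.mul_left
    exact (summable_nat_add_iff 1).mpr (Real.summable_nat_rpow.mpr (by linarith))
  exact Summable.of_norm_bounded this (fun n => zterm_bound (n+1) (by omega) s hs hs1)

lemma zterm_partial (s : ℂ) (hs1 : s ≠ 1) (N : ℕ) :
    ∑ n ∈ Finset.range N, zterm (n+1) s =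
      (((N:ℂ)+1) ^ (1 - s) - 1) / (1 - s) - ∑ n ∈ Finset.range N, ((n:ℂ)+2) ^ (-s) := by
  have h1s : (1 - s) ≠ 0 := sub_ne_zero.mpr (Ne.symm hs1)
  induction N with
  | zero => simp
  | succ N ih =>
    rw [Finset.sum_range_succ, ih, Finset.sum_range_succ]
    unfold zterm
    push_cast
    have : (N:ℂ) + 1 + 1 = N + 2 := by ring
    rw [this]
    field_simp
    ring

lemma zeta_eq_zterm_of_gt (s : ℂ) (hs : 1 < s.re) :
    riemannZeta s = 1 + 1 / (s - 1) - ∑' n : ℕ, zterm (n+1) s := by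
  have hs1 : s ≠ 1 := by intro h; simp [h] at hs
  have h1s : (1 - s) ≠ 0 := sub_ne_zero.mpr (Ne.symm hs1)
  have h1s' : (s - 1) ≠ 0 := sub_ne_zero.mpr hs1
  have hsum := (zterm_summable s (by linarith) hs1).hasSum.tendsto_sum_nat
  have hz : Summable (fun n : ℕ => 1 / ((n:ℂ)+1) ^ s) := by
    have := (summable_nat_add_iff 1).mpr (Complex.summable_one_div_nat_cpow.mpr hs)
    simpa using this
  have hz2 : Summable (fun n : ℕ => ((n:ℂ)+2) ^ (-s)) := by
    have := (summable_nat_add_iff 1).mpr hz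
    refine this.congr (fun n => ?_)
    rw [Complex.cpow_neg]; push_cast; rw [one_div]; congr 2; ring
  have hzeta : riemannZeta s = 1 + ∑' n : ℕ, ((n:ℂ)+2) ^ (-s) := by
    rw [zeta_eq_tsum_one_div_nat_add_one_cpow hs, hz.tsum_eq_zero_add]
    congr 1
    · simp
    · congr 1; ext n; rw [Complex.cpow_neg]; push_cast; rw [one_div]; congr 2; ring
  have h0 : Filter.Tendsto (fun N : ℕ => ((N:ℂ)+1) ^ (1 - s)) Filter.atTop (nhds 0) := by
    rw [tendsto_zero_iff_norm_tendsto_zero]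
    have h1 : ∀ N : ℕ, ‖((N:ℂ)+1) ^ (1 - s)‖ = ((N+1:ℕ):ℝ) ^ (-(s.re - 1)) := by
      intro N
      have := Complex.norm_cpow_eq_rpow_re_of_pos (x := ((N+1:ℕ):ℝ)) (by positivity) (1 - s)
      push_cast at this ⊢
      rw [this]; simp
    simp_rw [h1]
    exact (tendsto_rpow_neg_atTop (by linarith)).comp
      (tendsto_natCast_atTop_atTop.comp (Filter.tendsto_add_atTop_nat 1))
  have hlim : Filter.Tendsto (fun N : ℕ => ∑ n ∈ Finset.range N, zterm (n+1) s) Filter.atTop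
      (nhds ((0 - 1) / (1 - s) - ∑' n : ℕ, ((n:ℂ)+2) ^ (-s))) := by
    simp_rw [zterm_partial s hs1]
    exact ((h0.sub_const 1).div_const _).sub hz2.hasSum.tendsto_sum_nat
  have := tendsto_nhds_unique hsum hlim
  rw [this, hzeta]
  field_simp
  ring

lemma zterm_tsum_diff : DifferentiableOn ℂ (fun s => ∑' n : ℕ, zterm (n+1) s)
    ({s : ℂ | 0 < s.re} \ {1}) := by
  have hopen : IsOpen ({s : ℂ | 0 < s.re} \ {1}) :=
    (isOpen_lt continuous_const Complex.continuous_re).sdiff isClosed_singleton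
  intro s0 hs0
  obtain ⟨hs0, hs01⟩ := hs0
  have hs0' : 0 < s0.re := hs0
  have hop : IsOpen ({s : ℂ | s0.re/2 < s.re ∧ ‖s‖ < ‖s0‖ + 1} \ {1}) := by
    apply IsOpen.sdiff _ isClosed_singleton
    exact (isOpen_lt continuous_const Complex.continuous_re).inter
      (isOpen_lt continuous_norm continuous_const)
  have key : DifferentiableOn ℂ (fun s => ∑' n : ℕ, zterm (n+1) s)
      ({s : ℂ | s0.re/2 < s.re ∧ ‖s‖ < ‖s0‖ + 1} \ {1}) := by
    apply Complex.differentiableOn_tsum_of_summable_norm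
      (u := fun n : ℕ => (‖s0‖+1) * ((n+1 : ℕ):ℝ) ^ (-(s0.re/2) - 1))
    · apply Summable.mul_left
      exact (summable_nat_add_iff 1).mpr (Real.summable_nat_rpow.mpr (by linarith))
    · intro n s hs
      have h1s : (1 - s) ≠ 0 := sub_ne_zero.mpr (Ne.symm hs.2)
      apply DifferentiableAt.differentiableWithinAt
      unfold zterm
      have hnn : ((n+1:ℕ):ℂ) ≠ 0 := by exact_mod_cast Nat.succ_ne_zero n
      have hnn' : ((n+1:ℕ):ℂ) + 1 ≠ 0 := by exact_mod_cast Nat.succ_ne_zero (n+1)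
      refine ((DifferentiableAt.sub ?_ ?_).div ?_ h1s).sub ?_
      · exact DifferentiableAt.const_cpow (by fun_prop) (Or.inl hnn')
      · exact DifferentiableAt.const_cpow (by fun_prop) (Or.inl hnn)
      · fun_prop
      · exact DifferentiableAt.const_cpow (by fun_prop) (Or.inl hnn')
    · exact hop
    · intro n s hs
      have h1 : s0.re/2 < s.re := hs.1.1
      refine (zterm_bound (n+1) (by omega) s (by linarith) hs.2).trans ?_
      have h2 : ‖s‖ < ‖s0‖ + 1 := hs.1.2
      gcongr
      exact_mod_cast Nat.succ_le_succ (Nat.zero_le n)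
  have hmem : s0 ∈ ({s : ℂ | s0.re/2 < s.re ∧ ‖s‖ < ‖s0‖ + 1} \ {1}) :=
    ⟨⟨by linarith, by linarith⟩, hs01⟩
  exact ((key s0 hmem).differentiableAt (hop.mem_nhds hmem)).differentiableWithinAt

lemma zeta_eq_zterm_aux (U : Set ℂ) (hU : IsOpen U) (hc : Convex ℝ U)
    (hsub : U ⊆ ({s : ℂ | 0 < s.re} \ {1})) (z₀ : ℂ) (hz₀ : z₀ ∈ U) (hz : 1 < z₀.re)
    (s : ℂ) (hs : s ∈ U) :
    riemannZeta s = 1 + 1 / (s - 1) - ∑' n : ℕ, zterm (n+1) s := by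
  have h1 : AnalyticOnNhd ℂ riemannZeta U := by
    apply DifferentiableOn.analyticOnNhd _ hU
    intro z hz
    exact (differentiableAt_riemannZeta (hsub hz).2).differentiableWithinAt
  have h2 : AnalyticOnNhd ℂ (fun s => 1 + 1 / (s - 1) - ∑' n : ℕ, zterm (n+1) s) U := by
    apply DifferentiableOn.analyticOnNhd _ hU
    apply DifferentiableOn.sub _ (zterm_tsum_diff.mono hsub)
    intro z hz
    have : z - 1 ≠ 0 := sub_ne_zero.mpr (hsub hz).2
    apply DifferentiableAt.differentiableWithinAt
    fun_prop (disch := assumption)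
  have h3 := h1.eqOn_of_preconnected_of_eventuallyEq h2 hc.isPreconnected (z₀ := z₀) hz₀ ?_
  · exact h3 hs
  · have : {s : ℂ | 1 < s.re} ∈ nhds z₀ :=
      (isOpen_lt continuous_const Complex.continuous_re).mem_nhds hz
    filter_upwards [this] with z hz
    exact zeta_eq_zterm_of_gt z hz

lemma zeta_eq_zterm (s : ℂ) (hs : 0 < s.re) (hs1 : s.im ≠ 0) :
    riemannZeta s = 1 + 1 / (s - 1) - ∑' n : ℕ, zterm (n+1) s := by
  rcases lt_or_gt_of_ne hs1 with h | h
  · refine zeta_eq_zterm_aux {s | 0 < s.re ∧ s.im < 0} ?_ ?_ ?_ (2 - Complex.I) ?_ ?_ s ⟨hs, h⟩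
    · exact (isOpen_lt continuous_const Complex.continuous_re).inter
        (isOpen_lt Complex.continuous_im continuous_const)
    · exact (convex_halfSpace_re_gt 0).inter (convex_halfSpace_im_lt 0)
    · intro z hz
      refine ⟨hz.1, ?_⟩
      rintro rfl
      simpa using hz.2
    · constructor <;> simp
    · simp
  · refine zeta_eq_zterm_aux {s | 0 < s.re ∧ 0 < s.im} ?_ ?_ ?_ (2 + Complex.I) ?_ ?_ s ⟨hs, h⟩
    · exact (isOpen_lt continuous_const Complex.continuous_re).inter
        (isOpen_lt continuous_const Complex.continuous_im)
    · exact (convex_halfSpace_re_gt 0).inter (convex_halfSpace_im_gt 0)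
    · intro z hz
      refine ⟨hz.1, ?_⟩
      rintro rfl
      simpa using hz.2
    · constructor <;> simp
    · simp

/-- bound for zeta slightly to the left of the line -/
lemma zeta_strip_bound (r : ℝ) (hr : 0 < r) (hr4 : r < 1/4) : ∃ C : ℝ, 0 < C ∧ ∀ s : ℂ,
    1 - r ≤ s.re → s.re ≤ 3 → 1/2 ≤ |s.im| → ‖riemannZeta s‖ ≤ C * |s.im| ^ (2*r) := by
  have hsumr : Summable (fun n : ℕ => (n:ℝ) ^ (-1 - r)) := Real.summable_nat_rpow.mpr (by linarith)
  obtain ⟨C1, hC1⟩ : ∃ C1 : ℝ, C1 = ∑' n : ℕ, (n:ℝ) ^ (-1 - r) := ⟨_, rfl⟩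
  have hC1n : 0 ≤ C1 := by rw [hC1]; exact tsum_nonneg (fun n => by positivity)
  refine ⟨(C1 + 2 + 7 * C1) * 9, by positivity, ?_⟩
  intro s hs1 hs3 him
  set t := |s.im| with ht
  have ht0 : 0 < t := by linarith
  have him0 : s.im ≠ 0 := by intro h; simp [ht, h] at him; linarith
  have hsne : s ≠ 1 := by rintro rfl; simp at him0
  have h1s : (1 - s) ≠ 0 := sub_ne_zero.mpr (Ne.symm hsne)
  have h1s' : (s - 1) ≠ 0 := sub_ne_zero.mpr hsne
  set N := ⌈t⌉₊ with hN
  have hN1 : 1 ≤ N := Nat.one_le_iff_ne_zero.mpr (by rw [hN]; exact (Nat.ceil_pos.mpr ht0).ne')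
  have hNt : t ≤ N := Nat.le_ceil t
  have hN3 : (N:ℝ) ≤ 3 * t := by
    have := (Nat.ceil_lt_add_one ht0.le).le
    rw [← hN] at this; linarith
  have hNpos : (0:ℝ) < N := by linarith
  obtain ⟨M, hM⟩ : ∃ M, N = M + 1 := ⟨N - 1, by omega⟩
  have hsum := zterm_summable s (by linarith) hsne
  have heq : riemannZeta s = 1 + ∑ n ∈ Finset.range M, ((n:ℂ)+2) ^ (-s) +
      (N:ℂ) ^ (1 - s) / (s - 1) - ∑' n : ℕ, zterm (n + N) s := by
    rw [zeta_eq_zterm s (by linarith) him0, ← hsum.sum_add_tsum_nat_add M, zterm_partial s hsne M]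
    have : ∀ n : ℕ, n + M + 1 = n + N := by intro n; omega
    simp_rw [this]
    rw [hM]; push_cast
    field_simp
    ring
  have hpow : ∀ n : ℕ, 1 ≤ n → n ≤ N → (n:ℝ) ^ (-s.re) ≤ (N:ℝ) ^ (2*r) * (n:ℝ) ^ (-1 - r) := by
    intro n hn hnN
    have hn0 : (1:ℝ) ≤ n := by exact_mod_cast hn
    calc (n:ℝ) ^ (-s.re) ≤ (n:ℝ) ^ (2 * r + (-1 - r)) :=
          Real.rpow_le_rpow_of_exponent_le hn0 (by linarith)
      _ = (n:ℝ) ^ (2*r) * (n:ℝ) ^ (-1 - r) := Real.rpow_add (by linarith) _ _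
      _ ≤ _ := by gcongr
  have hA : ‖1 + ∑ n ∈ Finset.range M, ((n:ℂ)+2) ^ (-s)‖ ≤ (N:ℝ) ^ (2*r) * C1 := by
    have : (1 : ℂ) + ∑ n ∈ Finset.range M, ((n:ℂ)+2) ^ (-s) =
        ∑ n ∈ Finset.range N, ((n+1:ℕ):ℂ) ^ (-s) := by
      rw [hM, Finset.sum_range_succ']
      push_cast
      simp only [zero_add, Complex.one_cpow]
      rw [add_comm]
      congr 1
      apply Finset.sum_congr rfl; intro n _; congr 1; ring
    rw [this, hC1, ← tsum_mul_left]
    refine (norm_sum_le _ _).trans ?_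
    have h2 : ∀ n ∈ Finset.range N, ‖((n+1:ℕ):ℂ) ^ (-s)‖ ≤
        (N:ℝ) ^ (2*r) * ((n+1:ℕ):ℝ) ^ (-1 - r) := by
      intro n hn
      rw [Finset.mem_range] at hn
      rw [Complex.norm_natCast_cpow_of_pos (by omega)]
      exact hpow (n+1) (by omega) (by omega)
    refine (Finset.sum_le_sum h2).trans ?_
    have h3 : Summable (fun n : ℕ => (N:ℝ) ^ (2*r) * (n:ℝ) ^ (-1 - r)) := hsumr.mul_left _
    have h4 := ((summable_nat_add_iff 1).mpr h3).sum_le_tsum (Finset.range N)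
      (fun n _ => by positivity)
    refine h4.trans ?_
    rw [h3.tsum_eq_zero_add]
    have : (0:ℝ) ≤ (N:ℝ) ^ (2*r) * ((0:ℕ):ℝ) ^ (-1 - r) := by positivity
    linarith
  have hB : ‖(N:ℂ) ^ (1 - s) / (s - 1)‖ ≤ (N:ℝ) ^ (2*r) * 2 := by
    rw [norm_div, Complex.norm_natCast_cpow_of_pos (by omega)]
    have h1 : 1/2 ≤ ‖s - 1‖ := by
      refine him.trans ?_
      have := Complex.abs_im_le_norm (s - 1)
      simpa using this
    rw [div_le_iff₀ (by linarith)]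
    have h2 : (N:ℝ) ^ (1 - s).re ≤ (N:ℝ) ^ (2*r) :=
      Real.rpow_le_rpow_of_exponent_le (by exact_mod_cast hN1) (by simp; linarith)
    have h3 : (0:ℝ) < (N:ℝ) ^ (2*r) := by positivity
    nlinarith
  have hC : ‖∑' n : ℕ, zterm (n + N) s‖ ≤ (N:ℝ) ^ (2*r) * (7 * C1) := by
    have hb : ∀ n : ℕ, ‖zterm (n + N) s‖ ≤ (‖s‖ * (N:ℝ) ^ (2 * r - 1)) * ((n+N:ℕ):ℝ) ^ (-1 - r) := by
      intro n
      refine (zterm_bound (n+N) (by omega) s (by linarith) hsne).trans ?_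
      have hn1 : (1:ℝ) ≤ ((n+N:ℕ):ℝ) := by exact_mod_cast (by omega : 1 ≤ n + N)
      rw [mul_assoc]
      gcongr
      calc ((n+N:ℕ):ℝ) ^ (-s.re - 1) ≤ ((n+N:ℕ):ℝ) ^ ((2*r - 1) + (-1 - r)) :=
            Real.rpow_le_rpow_of_exponent_le hn1 (by linarith)
        _ = ((n+N:ℕ):ℝ) ^ (2*r - 1) * ((n+N:ℕ):ℝ) ^ (-1 - r) := Real.rpow_add (by linarith) _ _
        _ ≤ _ := by
          gcongr ?_ * _
          exact Real.rpow_le_rpow_of_nonpos hNpos (by push_cast; linarith [(Nat.cast_nonneg n : (0:ℝ) ≤ n)]) (by linarith)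
    have hs2 : Summable (fun n : ℕ => (‖s‖ * (N:ℝ) ^ (2 * r - 1)) * ((n+N:ℕ):ℝ) ^ (-1 - r)) :=
      ((summable_nat_add_iff N).mpr hsumr).mul_left _
    refine (tsum_of_norm_bounded hs2.hasSum hb).trans ?_
    rw [tsum_mul_left]
    have h5 : ∑' n : ℕ, ((n+N:ℕ):ℝ) ^ (-1 - r) ≤ C1 := by
      rw [hC1, ← hsumr.sum_add_tsum_nat_add N]
      have : 0 ≤ ∑ i ∈ Finset.range N, (i:ℝ) ^ (-1 - r) := Finset.sum_nonneg (fun i _ => by positivity)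
      linarith
    have h6 : ‖s‖ ≤ 7 * t := by
      refine (Complex.norm_le_abs_re_add_abs_im s).trans ?_
      have : |s.re| ≤ 3 := abs_le.mpr ⟨by linarith, hs3⟩
      rw [← ht]; linarith
    have h7 : ‖s‖ * (N:ℝ) ^ (2 * r - 1) ≤ (N:ℝ) ^ (2*r) * 7 := by
      rw [Real.rpow_sub hNpos, Real.rpow_one, mul_div_assoc', div_le_iff₀ hNpos]
      have : (0:ℝ) < (N:ℝ) ^ (2*r) := by positivity
      nlinarith
    calc _ ≤ ((N:ℝ) ^ (2*r) * 7) * C1 := by gcongr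
      _ = _ := by ring
  have hN9 : (N:ℝ) ^ (2*r) ≤ 9 * t ^ (2*r) := by
    calc (N:ℝ) ^ (2*r) ≤ (3 * t) ^ (2*r) := by gcongr
      _ = 3 ^ (2*r) * t ^ (2*r) := Real.mul_rpow (by norm_num) ht0.le
      _ ≤ 9 * t ^ (2*r) := by
        gcongr
        calc (3:ℝ) ^ (2*r) ≤ 3 ^ (2:ℝ) := Real.rpow_le_rpow_of_exponent_le (by norm_num) (by linarith)
          _ = 9 := by norm_num
  rw [heq]
  calc _ ≤ (N:ℝ) ^ (2*r) * C1 + (N:ℝ) ^ (2*r) * 2 + (N:ℝ) ^ (2*r) * (7 * C1) :=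
        (norm_sub_le _ _).trans (add_le_add ((norm_add_le _ _).trans (add_le_add hA hB)) hC)
    _ = (N:ℝ) ^ (2*r) * (C1 + 2 + 7 * C1) := by ring
    _ ≤ (9 * t ^ (2*r)) * (C1 + 2 + 7 * C1) := by gcongr
    _ = _ := by ring

end RD

open Real MeasureTheory

namespace RD

lemma zeta_bound2 (r : ℝ) (hr : 0 < r) (hr4 : r < 1/8) : ∃ C : ℝ, 0 < C ∧ ∀ s : ℂ,
    1 - 2*r ≤ s.re → s.re ≤ 3 → 1/2 ≤ |s.im| → ‖riemannZeta s‖ ≤ C * (1+|s.im|) ^ (4*r) := by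
  obtain ⟨C, hC, h⟩ := zeta_strip_bound (2*r) (by linarith) (by linarith)
  refine ⟨C, hC, fun s h1 h2 h3 => (h s h1 h2 h3).trans ?_⟩
  rw [show 2*(2*r) = 4*r by ring]
  gcongr
  linarith

lemma zeta_deriv_bound2 (r : ℝ) (hr : 0 < r) (hr4 : r < 1/8) : ∃ C : ℝ, 0 < C ∧ ∀ s : ℂ,
    1 - r ≤ s.re → s.re ≤ 2 → 3/4 ≤ |s.im| → ‖deriv riemannZeta s‖ ≤ C * (1+|s.im|) ^ (4*r) := by
  obtain ⟨C, hC, h⟩ := zeta_bound2 r hr hr4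
  refine ⟨C * 2 ^ (4*r) / r, by positivity, fun s h1 h2 h3 => ?_⟩
  have key : ∀ z ∈ Metric.closedBall s r, 1 - 2*r ≤ z.re ∧ z.re ≤ 3 ∧ 1/2 ≤ |z.im| ∧ |z.im| ≤ |s.im| + 1 := by
    intro z hz
    rw [mem_closedBall_iff_norm] at hz
    have a1 := (Complex.abs_re_le_norm (z - s)).trans hz
    have a2 := (Complex.abs_im_le_norm (z - s)).trans hz
    rw [Complex.sub_re, abs_le] at a1
    rw [Complex.sub_im] at a2
    have a3 := abs_sub_abs_le_abs_sub s.im z.im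
    have a4 := abs_sub_abs_le_abs_sub z.im s.im
    rw [abs_sub_comm] at a3
    refine ⟨by linarith, by linarith, by linarith, by linarith⟩
  have := Complex.norm_deriv_le_of_forall_mem_sphere_norm_le (f := riemannZeta) (c := s) (R := r)
    (C := C * 2^(4*r) * (1+|s.im|)^(4*r)) hr ?_ ?_
  · refine this.trans (le_of_eq ?_)
    ring
  · apply DifferentiableOn.diffContOnCl
    intro z hz
    rw [closure_ball _ hr.ne'] at hz
    apply DifferentiableAt.differentiableWithinAt
    apply differentiableAt_riemannZeta
    rintro rfl
    have := (key 1 hz).2.2.1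
    norm_num at this
  · intro z hz
    have hz' := key z (Metric.sphere_subset_closedBall hz)
    refine (h z hz'.1 hz'.2.1 hz'.2.2.1).trans ?_
    rw [mul_assoc, ← Real.mul_rpow (by norm_num) (by positivity)]
    gcongr
    linarith [hz'.2.2.2, abs_nonneg s.im]

lemma zeta_real_bound : ∃ C : ℝ, 0 < C ∧ ∀ σ : ℝ, 0 < σ → σ ≤ 1 →
    ‖riemannZeta (1+σ)‖ ≤ C / σ := by
  have hc : ContinuousOn riemannZeta₁ (Metric.closedBall 1 1) :=
    differentiable_riemannZeta₁.continuous.continuousOn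
  obtain ⟨C, hC⟩ := (isCompact_closedBall (1:ℂ) 1).exists_bound_of_continuousOn hc
  refine ⟨max C 1, by positivity, fun σ h0 h1 => ?_⟩
  have hne : (1 + σ : ℂ) ≠ 1 := by
    simp [h0.ne']
  rw [riemannZeta_eq_inv_sub_mul hne, norm_mul, mul_comm, div_eq_mul_inv]
  have := hC (1+σ) (by rw [mem_closedBall_iff_norm]; simpa [abs_of_pos h0] using h1)
  have e : ‖((1:ℂ)+σ-1)⁻¹‖ = σ⁻¹ := by
    simp [abs_of_pos h0]
  rw [e]
  gcongr
  exact this.trans (le_max_left _ _)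

lemma zeta341 (σ : ℝ) (hσ : 0 < σ) (t : ℝ) :
    1 ≤ ‖riemannZeta (1+σ)‖^3 * ‖riemannZeta (1+σ+Complex.I*t)‖^4 *
      ‖riemannZeta (1+σ+2*Complex.I*t)‖ := by
  have := DirichletCharacter.norm_LFunction_product_ge_one (1 : DirichletCharacter ℂ 1) hσ t
  simpa [DirichletCharacter.LFunctionTrivChar, DirichletCharacter.LFunction_modOne_eq] using this

/-- lower bound for zeta in a region slightly left of 1. -/
lemma zeta_lower (r : ℝ) (hr : 0 < r) (hr4 : r < 1/8) : ∃ c : ℝ, 0 < c ∧ c ≤ r ∧ ∀ s : ℂ,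
    1 - c * ((1+|s.im|) ^ (4*r))⁻¹^5 ≤ s.re → s.re ≤ 2 → 3/4 ≤ |s.im| →
    c * ((1+|s.im|) ^ (4*r))⁻¹^4 ≤ ‖riemannZeta s‖ := by
  obtain ⟨C1, hC1, h1⟩ := zeta_bound2 r hr hr4
  obtain ⟨C2, hC2, h2⟩ := zeta_deriv_bound2 r hr hr4
  obtain ⟨C3, hC3, h3⟩ := zeta_real_bound
  -- c0^4 = 1/(C3^3 * C1 * 2^(4r))
  set c0 : ℝ := (1/(C3^3 * C1 * 2^(4*r)))^(1/4:ℝ) with hc0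
  have hc0p : 0 < c0 := by positivity
  have hc04 : c0^4 = 1/(C3^3 * C1 * 2^(4*r)) := by
    rw [hc0, ← Real.rpow_natCast, ← Real.rpow_mul (by positivity)]
    norm_num
  obtain ⟨b, hb0, hb1, hb2, hb3⟩ : ∃ b : ℝ, 0 < b ∧ b ≤ r ∧ b ≤ 1 ∧ 2*C2*b ≤ c0/2 := by
    refine ⟨min r (min 1 (c0/(4*C2))), by positivity, min_le_left _ _,
      (min_le_right _ _).trans (min_le_left _ _), ?_⟩
    have : min r (min 1 (c0/(4*C2))) ≤ c0/(4*C2) := (min_le_right _ _).trans (min_le_right _ _)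
    calc 2*C2*min r (min 1 (c0/(4*C2))) ≤ 2*C2*(c0/(4*C2)) := by gcongr
      _ = c0/2 := by field_simp; norm_num
  refine ⟨min (b^4) (c0/2*b^3), by positivity, ?_, ?_⟩
  · refine (min_le_left _ _).trans ?_
    calc b^4 ≤ b^1 := pow_le_pow_of_le_one hb0.le hb2 (by norm_num)
      _ ≤ r := by simpa using hb1
  intro s hs1 hs2 hs3
  set T : ℝ := ((1+|s.im|) ^ (4*r))⁻¹ with hT
  have hTp : 0 < T := by positivity
  have hT1 : T ≤ 1 := by
    apply inv_le_one_of_one_le₀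
    apply Real.one_le_rpow _ (by linarith)
    linarith [abs_nonneg s.im]
  have hb4 : b^4 ≤ r := by
    calc b^4 ≤ b^1 := pow_le_pow_of_le_one hb0.le hb2 (by norm_num)
      _ ≤ r := by simpa using hb1
  set η : ℝ := b^4*T^5 with hη
  have hηp : 0 < η := by positivity
  have hηr : η ≤ r := by
    calc η ≤ r * 1 := by
          apply mul_le_mul hb4 (pow_le_one₀ hTp.le hT1) (by positivity) hr.le
      _ = r := mul_one r
  have hs1' : 1 - η ≤ s.re := by
    have : min (b^4) (c0/2*b^3) * T^5 ≤ b^4*T^5 := by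
      gcongr
      exact min_le_left _ _
    linarith
  -- lower bound right of 1
  have low : ∀ σ : ℝ, η ≤ σ → σ ≤ 1 → c0*b^3*T^4 ≤ ‖riemannZeta (1+σ+Complex.I*s.im)‖ := by
    intro σ hσ1 hσ2
    have hσp : 0 < σ := hηp.trans_le hσ1
    have g1 := zeta341 σ hσp s.im
    have g2 := h3 σ hσp hσ2
    have g3 := h1 (1+σ+2*Complex.I*s.im) (by simp; linarith) (by simp; linarith)
      (by simp [abs_mul]; linarith)
    have g3' : ‖riemannZeta (1+σ+2*Complex.I*s.im)‖ ≤ C1 * 2^(4*r) * T⁻¹ := by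
      refine g3.trans ?_
      rw [hT, inv_inv, mul_assoc C1, ← Real.mul_rpow (by norm_num) (by positivity)]
      gcongr
      simp [abs_mul]; linarith
    set A := ‖riemannZeta (1+σ+Complex.I*s.im)‖
    have hA : 0 ≤ A := norm_nonneg _
    have g4 : 1 ≤ (C3/η)^3 * A^4 * (C1 * 2^(4*r) * T⁻¹) := by
      refine g1.trans ?_
      gcongr
      refine g2.trans ?_
      gcongr
    have g5 : (c0*b^3*T^4)^4 ≤ A^4 := by
      have e : (C3/η)^3 * A^4 * (C1 * 2^(4*r) * T⁻¹) = A^4 / (c0^4 * (η^3*T)) := by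
        rw [hc04]; field_simp
      rw [e, one_le_div (by positivity)] at g4
      refine le_trans (le_of_eq ?_) g4
      rw [hη]; ring
    exact le_of_pow_le_pow_left₀ (by norm_num) hA g5
  have hmin : min (b^4) (c0/2*b^3) * T^4 ≤ c0/2*b^3*T^4 := by
    gcongr; exact min_le_right _ _
  refine hmin.trans ?_
  have hsform : s = 1 + ((s.re - 1 : ℝ):ℂ) + Complex.I * s.im := by
    apply Complex.ext <;> simp
  by_cases hc : 1 + η ≤ s.re
  · have := low (s.re - 1) (by linarith) (by linarith)
    rw [← hsform] at this
    refine le_trans ?_ this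
    have : 0 < c0 * b^3 * T^4 := by positivity
    linarith
  · push Not at hc
    have hl := low η le_rfl (by linarith)
    set s0 : ℂ := 1+η+Complex.I*s.im with hs0
    have s0re : s0.re = 1+η := by simp [hs0]
    have s0im : s0.im = s.im := by simp [hs0]
    have hd : ‖riemannZeta s - riemannZeta s0‖ ≤ (C2 * T⁻¹) * ‖s - s0‖ := by
      apply Convex.norm_image_sub_le_of_norm_deriv_le (𝕜 := ℂ)
        (s := {z : ℂ | z.re ∈ Set.Icc (1-η) (1+η) ∧ z.im = s.im})
      · rintro z ⟨hz1, hz2⟩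
        apply differentiableAt_riemannZeta
        rintro rfl
        rw [← hz2] at hs3
        norm_num at hs3
      · rintro z ⟨hz1, hz2⟩
        have := h2 z (by linarith [hz1.1]) (by linarith [hz1.2]) (by rw [hz2]; exact hs3)
        rw [hz2] at this
        rw [hT, inv_inv]; exact this
      · exact ((convex_Icc (1-η) (1+η)).linear_preimage Complex.reLm).inter
          ((convex_singleton s.im).linear_preimage Complex.imLm)
      · exact ⟨⟨by linarith, by linarith⟩, s0im⟩
      · exact ⟨⟨by linarith, by linarith⟩, rfl⟩
    have hn : ‖s - s0‖ ≤ 2*η := by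
      have : s - s0 = ((s.re - (1+η) : ℝ) : ℂ) := by
        apply Complex.ext <;> simp [s0re, s0im]
      rw [this, Complex.norm_real, Real.norm_eq_abs, abs_le]
      constructor <;> linarith
    have h4 : ‖riemannZeta s0‖ - ‖riemannZeta s‖ ≤ ‖riemannZeta s - riemannZeta s0‖ := by
      rw [norm_sub_rev]; exact norm_sub_norm_le _ _
    have h5 : (C2 * T⁻¹) * ‖s - s0‖ ≤ (C2 * T⁻¹) * (2*η) := by gcongr
    have h6 : (C2 * T⁻¹) * (2*η) = (2*C2*b) * (b^3*T^4) := by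
      rw [hη]; field_simp
    have h7 : (2*C2*b) * (b^3*T^4) ≤ (c0/2) * (b^3*T^4) := by gcongr
    have h8 : c0 * b^3 * T^4 = c0/2*b^3*T^4 + (c0/2) * (b^3*T^4) := by ring
    linarith

end RD

open Real MeasureTheory

namespace RD

noncomputable def G (s : ℂ) : ℂ :=
  (-(deriv riemannZeta₁ s / riemannZeta₁ s) - riemannZeta₀ s) / (s * (s + 1))

lemma Z_ne_zero {s : ℂ} (h : s = 1 ∨ riemannZeta s ≠ 0) : riemannZeta₁ s ≠ 0 := by
  by_cases h1 : s = 1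
  · rw [h1, riemannZeta₁_one]; norm_num
  · have h2 := h.resolve_left h1
    rw [riemannZeta_eq_inv_sub_mul h1] at h2
    exact right_ne_zero_of_mul h2

lemma Z_ne_zero' {s : ℂ} (h : 1 ≤ s.re) : riemannZeta₁ s ≠ 0 := by
  by_cases h1 : s = 1
  · exact Z_ne_zero (Or.inl h1)
  · exact Z_ne_zero (Or.inr (riemannZeta_ne_zero_of_one_le_re h))

lemma G_eq {s : ℂ} (h1 : s ≠ 1) (h : riemannZeta s ≠ 0) :
    G s = (-(deriv riemannZeta s / riemannZeta s) - riemannZeta s) / (s * (s + 1)) := by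
  have hs : s - 1 ≠ 0 := sub_ne_zero.mpr h1
  have hZ := Z_ne_zero (Or.inr h)
  unfold G
  congr 1
  rw [deriv_riemannZeta_eq_neg_inv_sub_sq_mul_add h1]
  have e2 : riemannZeta s = (s-1)⁻¹ * riemannZeta₁ s := riemannZeta_eq_inv_sub_mul h1
  have e3 : riemannZeta₀ s = riemannZeta s - (s-1)⁻¹ := by
    rw [riemannZeta_eq_inv_sub_add h1]; ring
  rw [e3, e2]
  field_simp
  ring

lemma G_analyticAt {s : ℂ} (h : riemannZeta₁ s ≠ 0) (h0 : s ≠ 0) (h1 : s + 1 ≠ 0) :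
    AnalyticAt ℂ G s := by
  have a1 : AnalyticAt ℂ riemannZeta₁ s := differentiable_riemannZeta₁.analyticAt s
  have a2 : AnalyticAt ℂ riemannZeta₀ s := differentiable_riemannZeta₀.analyticAt s
  unfold G
  exact (((a1.deriv).div a1 h).neg.sub a2).div (analyticAt_id.mul (analyticAt_id.add analyticAt_const))
    (mul_ne_zero h0 h1)

lemma G_analyticAt' {s : ℂ} (h : 1 ≤ s.re) : AnalyticAt ℂ G s := by
  apply G_analyticAt (Z_ne_zero' h)
  · rintro rfl; norm_num at h
  · intro h2
    have := congrArg Complex.re h2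
    simp at this; linarith

lemma G_bound_small (k : ℕ) : ∃ C : ℝ, 0 < C ∧ ∀ s : ℂ, 1 ≤ s.re → s.re ≤ 3/2 → |s.im| ≤ 1 →
    ‖iteratedDeriv k G s‖ ≤ C := by
  have hK : IsCompact (Set.Icc (1:ℝ) (3/2) ×ℂ Set.Icc (-1:ℝ) 1) :=
    isCompact_Icc.reProdIm isCompact_Icc
  have hc : ContinuousOn (iteratedDeriv k G) (Set.Icc (1:ℝ) (3/2) ×ℂ Set.Icc (-1:ℝ) 1) := by
    intro s hs
    have h1 : 1 ≤ s.re := hs.1.1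
    rw [iteratedDeriv_eq_iterate]
    exact (AnalyticAt.iterated_deriv (G_analyticAt' h1) k).continuousAt.continuousWithinAt
  obtain ⟨C, hC⟩ := hK.exists_bound_of_continuousOn hc
  refine ⟨max C 1, by positivity, fun s a b c => (hC s ?_).trans (le_max_left _ _)⟩
  exact ⟨⟨a, b⟩, abs_le.mp c⟩

lemma G_bound_large (k : ℕ) : ∃ C : ℝ, 0 < C ∧ ∀ s : ℂ, 1 ≤ s.re → s.re ≤ 3/2 → 1 ≤ |s.im| →
    ‖iteratedDeriv k G s‖ ≤ C * (1+|s.im|) ^ (-(3/2) : ℝ) := by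
  obtain ⟨r, hr⟩ : ∃ r : ℝ, r = 1/(40*((k:ℝ)+1)) := ⟨_, rfl⟩
  have hr0 : 0 < r := by rw [hr]; positivity
  have hr8 : r < 1/8 := by
    rw [hr]
    apply one_div_lt_one_div_of_lt (by norm_num)
    have : (0:ℝ) ≤ k := Nat.cast_nonneg k
    linarith
  obtain ⟨C1, hC1, h1⟩ := zeta_bound2 r hr0 hr8
  obtain ⟨C2, hC2, h2⟩ := zeta_deriv_bound2 r hr0 hr8
  obtain ⟨c, hc, hcr, h3⟩ := zeta_lower r hr0 hr8
  refine ⟨k.factorial * ((C2*c⁻¹+C1)*32*16) / (c/32)^k, by positivity, fun s hs1 hs2 hs3 => ?_⟩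
  set t : ℝ := 1+|s.im| with ht
  have ht2 : 2 ≤ t := by linarith
  obtain ⟨τ, hτ⟩ : ∃ τ : ℝ, τ = t ^ (4*r) := ⟨_, rfl⟩
  have hτ1 : 1 ≤ τ := by rw [hτ]; exact Real.one_le_rpow (by linarith) (by linarith)
  have hτ0 : 0 < τ := by linarith
  set R : ℝ := c/32 * τ⁻¹^5 with hR
  have hRp : 0 < R := by positivity
  have hR1 : R ≤ 1/256 := by
    have : τ⁻¹^5 ≤ 1 := pow_le_one₀ (by positivity) (inv_le_one_of_one_le₀ hτ1)
    calc R ≤ c/32 * 1 := by rw [hR]; gcongr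
      _ ≤ 1/256 := by linarith
  have key : ∀ z ∈ Metric.closedBall s R, 1 - R ≤ z.re ∧ z.re ≤ 2 ∧ 3/4 ≤ |z.im| ∧
      |z.im| ≤ |s.im| + 1 ∧ t/4 ≤ |z.im| := by
    intro z hz
    rw [mem_closedBall_iff_norm] at hz
    have a1 := (Complex.abs_re_le_norm (z - s)).trans hz
    have a2 := (Complex.abs_im_le_norm (z - s)).trans hz
    rw [Complex.sub_re, abs_le] at a1
    rw [Complex.sub_im] at a2
    have a3 := abs_sub_abs_le_abs_sub s.im z.im
    have a4 := abs_sub_abs_le_abs_sub z.im s.im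
    rw [abs_sub_comm] at a3
    refine ⟨by linarith, by linarith, by linarith, by linarith, by linarith⟩
  have key2 : ∀ z ∈ Metric.closedBall s R, riemannZeta₁ z ≠ 0 ∧ z ≠ 0 ∧ z + 1 ≠ 0 ∧
      ‖G z‖ ≤ (C2*c⁻¹+C1)*32*16 * τ^5 * t^(-2:ℝ) := by
    intro z hz
    obtain ⟨k1, k2, k3, k4, k5⟩ := key z hz
    set τz : ℝ := (1+|z.im|)^(4*r) with hτz
    have hτz1 : 1 ≤ τz := Real.one_le_rpow (by linarith) (by linarith)
    have hτz0 : 0 < τz := by linarith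
    have hττ : τz ≤ 2*τ := by
      calc τz ≤ (2*t)^(4*r) := by
            rw [hτz]; gcongr; linarith
        _ = 2^(4*r) * τ := by rw [hτ]; exact Real.mul_rpow (by norm_num) (by linarith)
        _ ≤ 2^(1:ℝ) * τ := by
            gcongr
            · norm_num
            · linarith
        _ = 2*τ := by norm_num
    have hreg : 1 - c * τz⁻¹^5 ≤ z.re := by
      have : R ≤ c * τz⁻¹^5 := by
        have e : τ⁻¹ ≤ 2*τz⁻¹ := by
          rw [inv_le_iff_one_le_mul₀ hτ0]
          have : 1 ≤ τz⁻¹ * (2*τ) := by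
            rw [← inv_mul_cancel₀ hτz0.ne']; gcongr
          linarith
        calc R ≤ c/32 * (2*τz⁻¹)^5 := by rw [hR]; gcongr
          _ = c * τz⁻¹^5 := by ring
      linarith
    have hRr : R ≤ r := by
      have : τ⁻¹^5 ≤ 1 := pow_le_one₀ (by positivity) (inv_le_one_of_one_le₀ hτ1)
      calc R ≤ c/32 * 1 := by rw [hR]; gcongr
        _ ≤ r := by linarith
    have b1 := h1 z (by linarith) (by linarith) (by linarith)
    have b2 := h2 z (by linarith) (by linarith) (by linarith)
    have b3 := h3 z hreg (by linarith) (by linarith)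
    rw [← hτz] at b1 b2 b3
    have hp : 0 < c * τz⁻¹^4 := by positivity
    have hz0 : riemannZeta z ≠ 0 := by
      rw [← norm_pos_iff]; linarith
    have hz1 : z ≠ 1 := by
      rintro rfl; norm_num at k3
    have n1 : t/4 ≤ ‖z‖ := k5.trans (Complex.abs_im_le_norm z)
    have n2 : t/4 ≤ ‖z+1‖ := by
      have := Complex.abs_im_le_norm (z+1)
      simp at this
      linarith
    refine ⟨Z_ne_zero (Or.inr hz0), ?_, ?_, ?_⟩
    · rw [← norm_pos_iff]; linarith
    · rw [← norm_pos_iff]; linarith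
    · rw [G_eq hz1 hz0, norm_div, norm_mul]
      have m1 : ‖-(deriv riemannZeta z / riemannZeta z) - riemannZeta z‖ ≤ (C2*c⁻¹+C1)*τz^5 := by
        calc _ ≤ ‖-(deriv riemannZeta z / riemannZeta z)‖ + ‖riemannZeta z‖ := norm_sub_le _ _
          _ = ‖deriv riemannZeta z‖ / ‖riemannZeta z‖ + ‖riemannZeta z‖ := by
              rw [norm_neg, norm_div]
          _ ≤ (C2 * τz) / (c * τz⁻¹^4) + C1 * τz^5 := by
              gcongr
              refine b1.trans ?_
              gcongr
              exact le_self_pow₀ hτz1 (by norm_num)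
          _ = (C2*c⁻¹+C1)*τz^5 := by field_simp
      have m2 : t^(-2:ℝ) = 1/(t*t) := by
        rw [Real.rpow_neg (by linarith), Real.rpow_two, pow_two, one_div]
      calc _ ≤ ((C2*c⁻¹+C1)*(2*τ)^5) / (t/4 * (t/4)) := by
            gcongr
            refine m1.trans ?_
            gcongr
        _ = _ := by rw [m2]; field_simp; ring
  have := Complex.norm_iteratedDeriv_le_of_forall_mem_sphere_norm_le (f := G) (c := s) (R := R) k
    (C := (C2*c⁻¹+C1)*32*16 * τ^5 * t^(-2:ℝ)) hRp ?_ ?_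
  · refine this.trans ?_
    have e1 : k.factorial * ((C2*c⁻¹+C1)*32*16 * τ^5 * t^(-2:ℝ)) / R^k =
        k.factorial * ((C2*c⁻¹+C1)*32*16) / (c/32)^k * (τ^(5*(k+1)) * t^(-2:ℝ)) := by
      rw [hR, mul_pow, pow_mul, pow_succ (τ^5), inv_pow, inv_pow]
      field_simp
    rw [e1]
    have e2 : τ^(5*(k+1)) = t^(1/2:ℝ) := by
      rw [hτ, ← Real.rpow_natCast, ← Real.rpow_mul (by linarith)]
      congr 1
      rw [hr]; push_cast; field_simp; norm_num
    rw [e2, ← Real.rpow_add (by linarith)]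
    norm_num
  · apply DifferentiableOn.diffContOnCl
    intro z hz
    rw [closure_ball _ hRp.ne'] at hz
    obtain ⟨a, b, d, _⟩ := key2 z hz
    exact (G_analyticAt a b d).differentiableAt.differentiableWithinAt
  · intro z hz
    exact (key2 z (Metric.sphere_subset_closedBall hz)).2.2.2

lemma G_bound (k : ℕ) : ∃ C : ℝ, 0 < C ∧ ∀ s : ℂ, 1 ≤ s.re → s.re ≤ 3/2 →
    ‖iteratedDeriv k G s‖ ≤ C * (1+|s.im|) ^ (-(3/2) : ℝ) := by
  obtain ⟨C1, hC1, h1⟩ := G_bound_small k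
  obtain ⟨C2, hC2, h2⟩ := G_bound_large k
  refine ⟨C1 * 2^(3/2:ℝ) + C2, by positivity, fun s a b => ?_⟩
  have hp : 0 < (1+|s.im|) ^ (-(3/2) : ℝ) := by positivity
  rcases le_total |s.im| 1 with h | h
  · refine (h1 s a b h).trans ?_
    have : (1:ℝ) ≤ 2^(3/2:ℝ) * (1+|s.im|) ^ (-(3/2) : ℝ) := by
      rw [Real.rpow_neg (by positivity), ← div_eq_mul_inv, ← Real.div_rpow (by norm_num) (by positivity)]
      apply Real.one_le_rpow _ (by norm_num)
      rw [le_div_iff₀ (by positivity)]; linarith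
    nlinarith
  · refine (h2 s a b h).trans ?_
    gcongr
    have : 0 < C1 * 2^(3/2:ℝ) := by positivity
    linarith

end RD

open Real MeasureTheory

namespace RD

open ArithmeticFunction in
noncomputable def aa (n : ℕ) : ℝ := vonMangoldt n - 1

noncomputable def R1 (x : ℝ) : ℝ := ∑ n ∈ Finset.Icc 1 ⌊x⌋₊, aa n * (x - n)

lemma R1_eq (x : ℝ) (N : ℕ) (hN : ⌊x⌋₊ ≤ N) :
    R1 x = ∑ n ∈ Finset.Icc 1 N, aa n * max (x - n) 0 := by
  unfold R1
  have hsub : Finset.Icc 1 ⌊x⌋₊ ⊆ Finset.Icc 1 N := Finset.Icc_subset_Icc_right hN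
  rw [← Finset.sum_subset hsub]
  · apply Finset.sum_congr rfl
    intro n hn
    rw [Finset.mem_Icc] at hn
    have : (n:ℝ) ≤ x := (Nat.le_floor_iff' (by omega)).mp hn.2
    rw [max_eq_left (by linarith)]
  · intro n hn hn2
    rw [Finset.mem_Icc] at hn hn2
    have h3 : ⌊x⌋₊ < n := by
      by_contra h; exact hn2 ⟨hn.1, by omega⟩
    have : x < n := Nat.lt_of_floor_lt h3
    rw [max_eq_right (by linarith), mul_zero]

lemma R1_continuous : Continuous R1 := by
  rw [continuous_iff_continuousAt]
  intro x
  have h : R1 =ᶠ[nhds x] fun z => ∑ n ∈ Finset.Icc 1 ⌊x+1⌋₊, aa n * max (z - n) 0 := by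
    filter_upwards [Iio_mem_nhds (show x < x+1 by linarith)] with z hz
    exact R1_eq z _ (Nat.floor_le_floor (le_of_lt hz))
  refine ContinuousAt.congr ?_ h.symm
  fun_prop

lemma R1_zero {x : ℝ} (hx : x ≤ 1) : R1 x = 0 := by
  rw [R1_eq x 1 (by have := Nat.floor_le_floor hx; simpa using this)]
  simp [max_eq_right (show x - 1 ≤ 0 by linarith)]

lemma abs_aa_le (n : ℕ) : |aa n| ≤ ArithmeticFunction.vonMangoldt n + 1 := by
  unfold aa
  have := ArithmeticFunction.vonMangoldt_nonneg (n := n)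
  rw [abs_le]; constructor <;> linarith

lemma R1_bound : ∃ C : ℝ, 0 < C ∧ ∀ x : ℝ, 0 ≤ x → |R1 x| ≤ C * x^2 := by
  refine ⟨log 4 + 4 + 1, by positivity, fun x hx => ?_⟩
  unfold R1
  calc |∑ n ∈ Finset.Icc 1 ⌊x⌋₊, aa n * (x - n)| ≤ ∑ n ∈ Finset.Icc 1 ⌊x⌋₊, |aa n * (x - n)| :=
        Finset.abs_sum_le_sum_abs _ _
    _ ≤ ∑ n ∈ Finset.Icc 1 ⌊x⌋₊, (ArithmeticFunction.vonMangoldt n + 1) * x := by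
        apply Finset.sum_le_sum
        intro n hn
        rw [Finset.mem_Icc] at hn
        have : (n:ℝ) ≤ x := (Nat.le_floor_iff' (by omega)).mp hn.2
        rw [abs_mul]
        gcongr
        · exact abs_aa_le n
        · rw [abs_of_nonneg (by linarith)]
          have : (0:ℝ) ≤ n := Nat.cast_nonneg n
          linarith
    _ = (Chebyshev.psi x + ⌊x⌋₊) * x := by
        rw [← Finset.sum_mul, Finset.sum_add_distrib]
        congr 2
        · simp
    _ ≤ ((log 4 + 4) * x + x) * x := by
        gcongr
        · exact Chebyshev.psi_le_const_mul_self hx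
        · exact Nat.floor_le hx
    _ = _ := by ring

/-- the integrand pieces -/
noncomputable def gg (s : ℂ) (n : ℕ) (v : ℝ) : ℂ :=
  ((max (rexp v - (n+1)) 0 : ℝ) : ℂ) * Complex.exp (-(1+s) * v)

lemma gg_eq (s : ℂ) (n : ℕ) : gg s n = Set.indicator (Set.Ioi (log (n+1)))
    (fun v : ℝ => Complex.exp (-s * v) - ((n:ℂ)+1) * Complex.exp (-(1+s) * v)) := by
  ext v
  unfold gg
  have hn : (0:ℝ) < n + 1 := by positivity
  by_cases hv : v ∈ Set.Ioi (log (n+1))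
  · rw [Set.indicator_of_mem hv]
    have h1 : (n:ℝ)+1 < rexp v := (Real.log_lt_iff_lt_exp hn).mp hv
    rw [max_eq_left (by linarith)]
    push_cast
    rw [sub_mul, ← Complex.exp_add]
    congr 2
    ring
  · rw [Set.indicator_of_notMem hv]
    have h1 : rexp v ≤ (n:ℝ)+1 := by
      rw [← Real.le_log_iff_exp_le hn]; simpa using hv
    rw [max_eq_right (by linarith)]
    simp

lemma gg_integrable (s : ℂ) (hs : 0 < s.re) (n : ℕ) : Integrable (gg s n) := by
  rw [gg_eq, integrable_indicator_iff measurableSet_Ioi]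
  apply Integrable.sub
  · exact integrableOn_exp_mul_complex_Ioi (by simpa using hs) _
  · apply Integrable.const_mul
    exact integrableOn_exp_mul_complex_Ioi (by simp; linarith) _

lemma gg_integral (s : ℂ) (hs : 0 < s.re) (n : ℕ) :
    ∫ v, gg s n v = ((n:ℂ)+1) ^ (-s) / (s * (s+1)) := by
  have hs0 : s ≠ 0 := by rintro rfl; simp at hs
  have hs1 : s + 1 ≠ 0 := by
    intro h; have := congrArg Complex.re h; simp at this; linarith
  have hn : (n:ℂ)+1 ≠ 0 := by exact_mod_cast Nat.succ_ne_zero n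
  have hlog : ((log ((n:ℝ)+1) : ℝ):ℂ) = Complex.log ((n:ℂ)+1) := by
    rw [Complex.ofReal_log (by positivity)]; push_cast; rfl
  rw [gg_eq, integral_indicator measurableSet_Ioi, integral_sub, integral_const_mul,
    integral_exp_mul_complex_Ioi, integral_exp_mul_complex_Ioi, hlog]
  · have e1 : Complex.exp (-s * Complex.log ((n:ℂ)+1)) = ((n:ℂ)+1) ^ (-s) := by
      rw [Complex.cpow_def_of_ne_zero hn]; ring_nf
    have e2 : ((n:ℂ)+1) * Complex.exp (-(1+s) * Complex.log ((n:ℂ)+1)) = ((n:ℂ)+1) ^ (-s) := by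
      rw [show -(1+s) * Complex.log ((n:ℂ)+1) = -s * Complex.log ((n:ℂ)+1) - Complex.log ((n:ℂ)+1) by ring,
        Complex.exp_sub, Complex.exp_log hn, e1]
      field_simp
    rw [e1, mul_div_assoc', mul_neg, e2]
    have : -(1+s) ≠ 0 := by rw [neg_ne_zero, add_comm]; exact hs1
    have h3 : (1+s) ≠ 0 := by rw [add_comm]; exact hs1
    field_simp
    ring
  · simp; linarith
  · simpa using hs
  · exact integrableOn_exp_mul_complex_Ioi (by simpa using hs) _
  · apply Integrable.const_mul
    exact integrableOn_exp_mul_complex_Ioi (by simp; linarith) _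

lemma gg_norm (s : ℂ) (n : ℕ) (v : ℝ) : ((‖gg s n v‖ : ℝ) : ℂ) = gg s.re n v := by
  unfold gg
  rw [norm_mul, Complex.norm_real, Complex.norm_exp, Real.norm_of_nonneg (le_max_right _ _)]
  push_cast
  simp

lemma gg_norm_integral (s : ℂ) (hs : 0 < s.re) (n : ℕ) :
    ∫ v, ‖gg s n v‖ = ((n:ℝ)+1) ^ (-s.re) / (s.re * (s.re+1)) := by
  have h := gg_integral s.re (by simpa using hs) n
  simp_rw [← gg_norm] at h
  rw [integral_complex_ofReal] at h
  have h2 : ((n:ℂ)+1) ^ (-(s.re:ℂ)) = ((((n:ℝ)+1) ^ (-s.re) : ℝ) : ℂ) := by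
    rw [Complex.ofReal_cpow (by positivity)]; push_cast; rfl
  rw [h2] at h
  exact_mod_cast h

noncomputable def ff (s : ℂ) (v : ℝ) : ℂ := (R1 (rexp v) : ℂ) * Complex.exp (-(1+s) * v)

lemma ff_eq_tsum (s : ℂ) (v : ℝ) : ff s v = ∑' n : ℕ, (aa (n+1) : ℂ) * gg s n v := by
  rw [tsum_eq_sum (s := Finset.range ⌊rexp v⌋₊)]
  · unfold ff gg
    rw [R1_eq _ _ le_rfl, ← Finset.Ico_add_one_right_eq_Icc, Finset.sum_Ico_eq_sum_range]
    push_cast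
    rw [Finset.sum_mul]
    apply Finset.sum_congr (by simp)
    intro n _
    rw [add_comm 1 n, add_comm (1:ℝ) n]
    push_cast
    ring
  · intro n hn
    rw [Finset.mem_range, not_lt] at hn
    unfold gg
    have : rexp v < n + 1 := by
      have := Nat.lt_floor_add_one (rexp v)
      have h2 : (⌊rexp v⌋₊:ℝ) ≤ n := by exact_mod_cast hn
      linarith
    rw [max_eq_right (by linarith)]
    simp

lemma aa_summable (s : ℂ) (hs : 1 < s.re) :
    Summable fun n : ℕ => (aa (n+1) : ℂ) * ((n:ℂ)+1)^(-s) := by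
  have h1 := ArithmeticFunction.LSeriesSummable_vonMangoldt hs
  have h2 : LSeriesSummable 1 s := LSeriesSummable_one_iff.mpr hs
  have h3 := (summable_nat_add_iff 1).mpr (h1.sub h2)
  refine h3.congr fun n => ?_
  rw [LSeries.term_of_ne_zero (by omega)]
  unfold aa
  simp only [Pi.sub_apply, Pi.one_apply]
  push_cast
  rw [Complex.cpow_neg, div_eq_mul_inv]

lemma aa_tsum (s : ℂ) (hs : 1 < s.re) :
    ∑' n : ℕ, (aa (n+1) : ℂ) * ((n:ℂ)+1)^(-s) = -(deriv riemannZeta s / riemannZeta s) - riemannZeta s := by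
  have h1 := ArithmeticFunction.LSeriesSummable_vonMangoldt hs
  have h2 : LSeriesSummable 1 s := LSeriesSummable_one_iff.mpr hs
  have h3 := LSeries_sub h1 h2
  rw [ArithmeticFunction.LSeries_vonMangoldt_eq_deriv_riemannZeta_div hs, LSeries_one_eq_riemannZeta hs] at h3
  rw [← neg_div, ← h3, LSeries, Summable.tsum_eq_zero_add (h1.sub h2)]
  simp only [LSeries.term_zero, zero_add]
  apply tsum_congr
  intro n
  rw [LSeries.term_of_ne_zero (by omega)]
  unfold aa
  simp only [Pi.sub_apply, Pi.one_apply]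
  push_cast
  rw [Complex.cpow_neg, div_eq_mul_inv]

lemma ff_integral (s : ℂ) (hs : 1 < s.re) : ∫ v, ff s v = G s := by
  have hs0 : 0 < s.re := by linarith
  simp_rw [ff_eq_tsum]
  rw [← (hasSum_integral_of_summable_integral_norm (F := fun n v => (aa (n+1) : ℂ) * gg s n v)
    (fun n => (gg_integrable s hs0 n).const_mul _) ?_).tsum_eq]
  · simp_rw [integral_const_mul, gg_integral s hs0, ← mul_div_assoc]
    rw [tsum_div_const, aa_tsum s hs, G_eq]
    · rintro rfl; simp at hs
    · exact riemannZeta_ne_zero_of_one_le_re hs.le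
  · have := ((aa_summable s hs).norm).div_const (s.re*(s.re+1))
    refine this.congr fun n => ?_
    simp_rw [norm_mul]
    rw [integral_const_mul, gg_norm_integral s hs0, ← mul_div_assoc]
    congr 2
    rw [show (n:ℂ)+1 = (((n:ℝ)+1 : ℝ):ℂ) by push_cast; rfl,
      Complex.norm_cpow_eq_rpow_re_of_pos (by positivity)]
    simp

end RD

open Real MeasureTheory

namespace RD

open FourierTransform

lemma ff_continuous (s : ℂ) : Continuous (ff s) := by
  unfold ff
  have := R1_continuous
  fun_prop

lemma ff_integrable (σ : ℝ) (hσ : 1 < σ) (n : ℕ) : Integrable (fun v : ℝ => v ^ n • ff σ v) := by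
  obtain ⟨C, hC, hR⟩ := R1_bound
  have h1 : IntegrableOn (fun x : ℝ => C * (x ^ (n:ℝ) * rexp (-(σ-1) * x^(1:ℝ)))) (Set.Ioi 0) := by
    apply Integrable.const_mul
    exact integrableOn_rpow_mul_exp_neg_mul_rpow
      (by have : (0:ℝ) ≤ n := Nat.cast_nonneg n
          linarith) one_pos (by linarith)
  rw [← integrable_indicator_iff measurableSet_Ioi] at h1
  refine h1.mono' ?_ ?_
  · have := ff_continuous σ
    exact (by fun_prop : Continuous (fun v : ℝ => v ^ n • ff σ v)).aestronglyMeasurable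
  · refine Filter.Eventually.of_forall fun v => ?_
    by_cases hv : 0 < v
    · rw [Set.indicator_of_mem (show v ∈ Set.Ioi 0 from hv), Real.rpow_natCast, Real.rpow_one]
      rw [norm_smul, norm_pow, Real.norm_of_nonneg hv.le]
      unfold ff
      rw [norm_mul, Complex.norm_real, Real.norm_eq_abs, Complex.norm_exp]
      have e : (-(1 + (σ:ℂ)) * v).re = -(1+σ)*v := by simp
      rw [e]
      calc v^n * (|R1 (rexp v)| * rexp (-(1+σ)*v)) ≤ v^n * ((C * (rexp v)^2) * rexp (-(1+σ)*v)) := by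
            gcongr
            exact hR _ (by positivity)
        _ = C * (v^n * (rexp (2*v) * rexp (-(1+σ)*v))) := by
            rw [← Real.exp_nat_mul]; push_cast; ring
        _ = _ := by
            rw [← Real.exp_add]; ring_nf
    · rw [Set.indicator_of_notMem (by simpa using hv)]
      unfold ff
      rw [R1_zero (Real.exp_le_one_iff.mpr (by linarith))]
      simp

lemma ff_fourier (σ : ℝ) (hσ : 1 < σ) :
    𝓕 (ff σ) = fun w : ℝ => G (σ + 2 * π * Complex.I * w) := by
  ext w
  rw [Real.fourier_real_eq_integral_exp_smul, ← ff_integral _ (by simpa using hσ)]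
  congr 1
  ext v
  unfold ff
  rw [smul_eq_mul, mul_left_comm, ← Complex.exp_add]
  congr 2
  push_cast
  ring

lemma G_iter (σ : ℝ) (hσ : 1 < σ) (n : ℕ) :
    iteratedDeriv n (fun w : ℝ => G (σ + 2 * π * Complex.I * w)) =
    fun w : ℝ => (2 * π * Complex.I)^n * iteratedDeriv n G (σ + 2 * π * Complex.I * w) := by
  induction n with
  | zero => simp
  | succ n ih =>
    rw [iteratedDeriv_succ, ih]
    ext w
    have ha : AnalyticAt ℂ (iteratedDeriv n G) (σ + 2 * π * Complex.I * w) := by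
      rw [iteratedDeriv_eq_iterate]
      exact AnalyticAt.iterated_deriv (G_analyticAt' (by simpa using hσ.le)) n
    have h1 := ha.differentiableAt.hasDerivAt
    rw [← iteratedDeriv_succ] at h1
    have h2 : HasDerivAt (fun w : ℝ => (σ + 2 * π * Complex.I * w : ℂ)) (2 * π * Complex.I) w := by
      have := ((hasDerivAt_id (w:ℂ)).const_mul (2 * π * Complex.I)).const_add (σ:ℂ)
      simpa using this.comp_ofReal
    have h3 := (h1.comp w h2).const_mul ((2 * π * Complex.I)^n)
    have := h3.deriv
    simp only [Function.comp_def] at this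
    rw [this]
    ring

lemma R1_strong (k : ℕ) : ∃ C : ℝ, 0 < C ∧ ∀ v : ℝ, 0 ≤ v → v^k * |R1 (rexp v)| ≤ C * rexp (2*v) := by
  obtain ⟨C, hC, hG⟩ := G_bound k
  have hJ : Integrable (fun w : ℝ => (1+‖w‖)^(-(3/2):ℝ)) :=
    integrable_one_add_norm (by simp; norm_num)
  obtain ⟨M, hM⟩ : ∃ M : ℝ, M = (2*π)^k * C * ∫ w : ℝ, (1+‖w‖)^(-(3/2):ℝ) := ⟨_, rfl⟩
  have main : ∀ σ : ℝ, 1 < σ → σ ≤ 3/2 → ∀ v : ℝ, 0 ≤ v →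
      (2*π)^k * v^k * |R1 (rexp v)| * rexp (-(1+σ)*v) ≤ M := by
    intro σ h1 h2 v hv
    set h : ℝ → ℂ := fun x : ℝ ↦ (-2 * π * Complex.I * x) ^ k • ff σ x with hh
    have hcont : Continuous h := by
      have := ff_continuous σ
      fun_prop
    have hint : Integrable h := by
      have := (ff_integrable σ h1 k).const_mul ((-2*π*Complex.I)^k)
      refine this.congr (Filter.Eventually.of_forall fun x => ?_)
      simp only [hh, smul_eq_mul, Complex.real_smul]
      push_cast
      ring
    have hF : 𝓕 h = fun w : ℝ => (2 * π * Complex.I)^k * iteratedDeriv k G (σ + 2 * π * Complex.I * w) := by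
      have := Real.iteratedDeriv_fourier (f := ff σ) (N := ⊤) (n := k)
        (fun n _ => ff_integrable σ h1 n) le_top
      rw [ff_fourier σ h1, G_iter σ h1] at this
      exact this.symm
    have hb : ∀ w : ℝ, ‖𝓕 h w‖ ≤ (2*π)^k * C * (1+‖w‖)^(-(3/2):ℝ) := by
      intro w
      rw [hF]
      simp only [norm_mul, norm_pow, Complex.norm_I, Complex.norm_real, Real.norm_of_nonneg Real.pi_pos.le, mul_one, Complex.norm_ofNat]
      rw [mul_assoc ((2*π)^k) C]
      gcongr
      refine (hG (σ + 2 * π * Complex.I * w) (by simpa using h1.le) (by simpa using h2)).trans ?_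
      apply mul_le_mul_of_nonneg_left _ hC.le
      apply Real.rpow_le_rpow_of_nonpos (by positivity) _ (by norm_num)
      simp [abs_mul, abs_of_pos Real.pi_pos]
      have : 3 < π := Real.pi_gt_three
      nlinarith [abs_nonneg w]
    have hFc : Continuous (𝓕 h) := by
      rw [hF]
      refine continuous_const.mul ?_
      rw [continuous_iff_continuousAt]
      intro w
      have ha : AnalyticAt ℂ (iteratedDeriv k G) (σ + 2 * π * Complex.I * w) := by
        rw [iteratedDeriv_eq_iterate]
        exact AnalyticAt.iterated_deriv (G_analyticAt' (by simpa using h1.le)) k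
      exact ContinuousAt.comp (f := fun w : ℝ => (σ + 2 * π * Complex.I * w : ℂ)) ha.continuousAt
        (by fun_prop)
    have hJ' := hJ.const_mul ((2*π)^k * C)
    have hFint : Integrable (𝓕 h) :=
      hJ'.mono' hFc.aestronglyMeasurable (Filter.Eventually.of_forall hb)
    have hinv := congrFun (hcont.fourierInv_fourier_eq hint hFint) v
    have hle : ‖h v‖ ≤ ∫ w, ‖𝓕 h w‖ := by
      rw [← hinv, Real.fourierInv_eq']
      refine (norm_integral_le_integral_norm _).trans (le_of_eq ?_)
      congr 1
      ext w
      rw [norm_smul]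
      have : ‖Complex.exp (↑(2 * π * inner ℝ w v) * Complex.I)‖ = 1 :=
        Complex.norm_exp_ofReal_mul_I _
      rw [this, one_mul]
    have hle2 : ∫ w, ‖𝓕 h w‖ ≤ M := by
      rw [hM, ← integral_const_mul]
      exact integral_mono hFint.norm hJ' hb
    refine le_trans (le_of_eq ?_) (hle.trans hle2)
    simp only [hh, ff, norm_smul, norm_mul, norm_pow, norm_neg, Complex.norm_I, Complex.norm_real, Real.norm_of_nonneg Real.pi_pos.le, mul_one, Complex.norm_ofNat, Real.norm_eq_abs, abs_of_nonneg hv, Complex.norm_exp]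
    have e : (-(1 + (σ:ℂ)) * v).re = -(1+σ)*v := by simp
    rw [e, mul_pow]
    ring
  have lim : ∀ v : ℝ, 0 ≤ v → (2*π)^k * v^k * |R1 (rexp v)| * rexp (-(1+1)*v) ≤ M := by
    intro v hv
    have hc : Filter.Tendsto (fun σ : ℝ => (2*π)^k * v^k * |R1 (rexp v)| * rexp (-(1+σ)*v))
        (nhdsWithin 1 (Set.Ioi 1)) (nhds ((2*π)^k * v^k * |R1 (rexp v)| * rexp (-(1+1)*v))) := by
      apply Filter.Tendsto.mono_left _ nhdsWithin_le_nhds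
      exact Continuous.tendsto (by fun_prop) 1
    apply le_of_tendsto hc
    filter_upwards [Ioo_mem_nhdsGT (show (1:ℝ) < 3/2 by norm_num)] with σ hσ
    exact main σ hσ.1 hσ.2.le v hv
  have hM0 : 0 ≤ M := by
    rw [hM]
    have : 0 ≤ ∫ w : ℝ, (1+‖w‖)^(-(3/2):ℝ) := integral_nonneg fun w => by positivity
    positivity
  refine ⟨M + 1, by linarith, fun v hv => ?_⟩
  have h := lim v hv
  have hp : 1 ≤ (2*π)^k := one_le_pow₀ (by nlinarith [Real.pi_gt_three])
  have h0 : 0 ≤ v^k * |R1 (rexp v)| * rexp (-(1+1)*v) := by positivity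
  have h2 : v^k * |R1 (rexp v)| * rexp (-(1+1)*v) ≤ M + 1 := by
    have : v^k * |R1 (rexp v)| * rexp (-(1+1)*v) ≤ (2*π)^k * (v^k * |R1 (rexp v)| * rexp (-(1+1)*v)) :=
      le_mul_of_one_le_left h0 hp
    have e : (2*π)^k * (v^k * |R1 (rexp v)| * rexp (-(1+1)*v)) = (2*π)^k * v^k * |R1 (rexp v)| * rexp (-(1+1)*v) := by ring
    linarith
  have e2 : v^k * |R1 (rexp v)| = v^k * |R1 (rexp v)| * rexp (-(1+1)*v) * rexp (2*v) := by
    rw [mul_assoc _ (rexp _) (rexp _), ← Real.exp_add]; ring_nf; simp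
  rw [e2]
  gcongr

end RD

open Real MeasureTheory

namespace RD

lemma R1_bound4 : ∃ C : ℝ, 0 < C ∧ ∀ x : ℝ, 1 < x → |R1 x| ≤ C * x^2 / (log x)^4 := by
  obtain ⟨C, hC, h⟩ := R1_strong 4
  refine ⟨C, hC, fun x hx => ?_⟩
  have hl := Real.log_pos hx
  have := h (log x) hl.le
  rw [Real.exp_log (by linarith)] at this
  rw [le_div_iff₀ (by positivity)]
  have e : rexp (2 * log x) = x^2 := by
    rw [two_mul, Real.exp_add, Real.exp_log (by linarith)]; ring
  rw [e] at this
  linarith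

lemma psi_sub_floor (x : ℝ) : Chebyshev.psi x - ⌊x⌋₊ = ∑ n ∈ Finset.Icc 1 ⌊x⌋₊, aa n := by
  unfold aa
  rw [Finset.sum_sub_distrib]
  simp [Chebyshev.psi]
  rfl

lemma aa_ge (n : ℕ) : -1 ≤ aa n := by
  unfold aa
  have := ArithmeticFunction.vonMangoldt_nonneg (n := n)
  linarith

lemma card_bound (a b : ℝ) (ha : 0 ≤ a) (hab : a ≤ b) :
    (((Finset.Ioc ⌊a⌋₊ ⌊b⌋₊).card : ℕ) : ℝ) ≤ b - a + 1 := by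
  rw [Nat.card_Ioc, Nat.cast_sub (Nat.floor_le_floor hab)]
  have h1 := Nat.floor_le (ha.trans hab)
  have h2 := Nat.lt_floor_add_one a
  linarith

lemma sum_split (f : ℕ → ℝ) (a b : ℝ) (hab : a ≤ b) :
    ∑ n ∈ Finset.Icc 1 ⌊b⌋₊, f n = ∑ n ∈ Finset.Icc 1 ⌊a⌋₊, f n + ∑ n ∈ Finset.Ioc ⌊a⌋₊ ⌊b⌋₊, f n := by
  have h := Nat.floor_le_floor hab
  rw [← Finset.sum_union]
  · congr 1
    ext n; simp; omega
  · rw [Finset.disjoint_left]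
    intro n; simp; omega

lemma diff_up (x h : ℝ) (hx : 0 ≤ x) (hh : 0 ≤ h) :
    h * (Chebyshev.psi x - ⌊x⌋₊) ≤ R1 (x+h) - R1 x + h*(h+1) := by
  rw [psi_sub_floor]
  unfold R1
  rw [sum_split _ x (x+h) (by linarith)]
  have e1 : ∑ n ∈ Finset.Icc 1 ⌊x⌋₊, aa n * (x + h - n) =
      ∑ n ∈ Finset.Icc 1 ⌊x⌋₊, aa n * (x - n) + h * ∑ n ∈ Finset.Icc 1 ⌊x⌋₊, aa n := by
    rw [Finset.mul_sum, ← Finset.sum_add_distrib]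
    apply Finset.sum_congr rfl; intro n _; ring
  have e2 : -(h*(h+1)) ≤ ∑ n ∈ Finset.Ioc ⌊x⌋₊ ⌊x+h⌋₊, aa n * (x + h - n) := by
    have : ∑ n ∈ Finset.Ioc ⌊x⌋₊ ⌊x+h⌋₊, (-h) ≤ ∑ n ∈ Finset.Ioc ⌊x⌋₊ ⌊x+h⌋₊, aa n * (x + h - n) := by
      apply Finset.sum_le_sum
      intro n hn
      rw [Finset.mem_Ioc] at hn
      have h1 : x < n := Nat.lt_of_floor_lt hn.1
      have h2 : (n:ℝ) ≤ x + h := (Nat.le_floor_iff' (by omega)).mp hn.2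
      nlinarith [aa_ge n]
    refine le_trans ?_ this
    rw [Finset.sum_const, nsmul_eq_mul]
    have := card_bound x (x+h) hx (by linarith)
    nlinarith
  rw [e1]
  linarith

lemma diff_down (x h : ℝ) (hx : h ≤ x) (hh : 0 ≤ h) :
    R1 x - R1 (x-h) - h*(h+1) ≤ h * (Chebyshev.psi x - ⌊x⌋₊) := by
  rw [psi_sub_floor]
  unfold R1
  rw [sum_split _ (x-h) x (by linarith), sum_split _ (x-h) x (by linarith), mul_add]
  have e1 : ∑ n ∈ Finset.Icc 1 ⌊x-h⌋₊, aa n * (x - n) =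
      ∑ n ∈ Finset.Icc 1 ⌊x-h⌋₊, aa n * (x - h - n) + h * ∑ n ∈ Finset.Icc 1 ⌊x-h⌋₊, aa n := by
    rw [Finset.mul_sum, ← Finset.sum_add_distrib]
    apply Finset.sum_congr rfl; intro n _; ring
  have e2 : ∑ n ∈ Finset.Ioc ⌊x-h⌋₊ ⌊x⌋₊, aa n * (x - n) - h*(h+1) ≤
      h * ∑ n ∈ Finset.Ioc ⌊x-h⌋₊ ⌊x⌋₊, aa n := by
    have : ∑ n ∈ Finset.Ioc ⌊x-h⌋₊ ⌊x⌋₊, (aa n * (x - n) - h) ≤ ∑ n ∈ Finset.Ioc ⌊x-h⌋₊ ⌊x⌋₊, h * aa n := by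
      apply Finset.sum_le_sum
      intro n hn
      rw [Finset.mem_Ioc] at hn
      have h1 : x - h < n := Nat.lt_of_floor_lt hn.1
      have h2 : (n:ℝ) ≤ x := (Nat.le_floor_iff' (by omega)).mp hn.2
      nlinarith [aa_ge n]
    rw [Finset.mul_sum]
    refine le_trans ?_ this
    rw [Finset.sum_sub_distrib, Finset.sum_const, nsmul_eq_mul]
    have := card_bound (x-h) x (by linarith) (by linarith)
    nlinarith
  rw [e1]
  linarith

lemma sq_log_le {x : ℝ} (hx : 1 ≤ x) : (log x)^2 ≤ 2 * x := by
  have := Real.quadratic_le_exp_of_nonneg (Real.log_nonneg hx)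
  rw [Real.exp_log (by linarith)] at this
  nlinarith [Real.log_nonneg hx]

theorem psi_pnt : ∃ C : ℝ, 0 < C ∧ ∀ x : ℝ, 1 < x →
    |Chebyshev.psi x - x| ≤ C * x / (log x)^2 := by
  obtain ⟨C, hC, hR⟩ := R1_bound4
  refine ⟨20*C + 100, by positivity, fun x hx => ?_⟩
  have hl := Real.log_pos hx
  have hx0 : 0 < x := by linarith
  rw [le_div_iff₀ (by positivity)]
  rcases le_or_gt (log x) 2 with h2 | h2
  · have h1 : |Chebyshev.psi x - x| ≤ 7 * x := by
      have a := Chebyshev.psi_le_const_mul_self hx0.le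
      have b : 0 ≤ Chebyshev.psi x := Chebyshev.psi_nonneg x
      have c : log 4 ≤ 3 := by
        have := Real.log_le_sub_one_of_pos (show (0:ℝ) < 4 by norm_num)
        linarith
      rw [abs_le]; constructor <;> nlinarith
    calc |Chebyshev.psi x - x| * log x ^ 2 ≤ (7*x) * 2^2 := by gcongr
      _ ≤ _ := by nlinarith
  · set ℓ := log x with hℓ
    set h : ℝ := x / ℓ^2 with hh
    have hhp : 0 < h := by positivity
    have hh4 : h ≤ x/4 := by
      rw [hh]; gcongr; nlinarith
    have hhl : h * ℓ^2 = x := by rw [hh]; field_simp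
    have hx7 : 3 ≤ x := by
      have := Real.add_one_le_exp ℓ
      rw [hℓ, Real.exp_log hx0] at this
      linarith
    have hlm : ℓ/2 ≤ log (x-h) := by
      have : √x ≤ x - h := by
        rw [Real.sqrt_le_left (by linarith)]
        nlinarith
      calc ℓ/2 = log (√x) := by rw [Real.log_sqrt hx0.le]
        _ ≤ _ := Real.log_le_log (by positivity) this
    have hlp : ℓ ≤ log (x+h) := Real.log_le_log hx0 (by linarith)
    have r0 := hR x hx
    have r1 : |R1 (x+h)| ≤ C * (4 * x^2) / ℓ^4 := by
      refine (hR (x+h) (by linarith)).trans ?_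
      gcongr
      nlinarith
    have r2 : |R1 (x-h)| ≤ C * x^2 / (ℓ/2)^4 := by
      refine (hR (x-h) (by linarith)).trans ?_
      gcongr
      · linarith
      · linarith
    have r0' : |R1 x| ≤ C * h^2 := by
      rw [← hℓ] at r0; rw [hh]; refine r0.trans (le_of_eq ?_); field_simp
    have r1' : |R1 (x+h)| ≤ 4 * C * h^2 := by
      rw [hh]; refine r1.trans (le_of_eq ?_); field_simp
    have r2' : |R1 (x-h)| ≤ 16 * C * h^2 := by
      rw [hh]; refine r2.trans (le_of_eq ?_); field_simp; norm_num
    have u := diff_up x h hx0.le hhp.le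
    have d := diff_down x h (by linarith) hhp.le
    rw [abs_le] at r0' r1' r2'
    have f1 := Nat.floor_le hx0.le
    have f2 := Nat.lt_floor_add_one x
    have u' : Chebyshev.psi x - ⌊x⌋₊ ≤ 17*C*h + h + 1 := by
      have : h * (Chebyshev.psi x - ⌊x⌋₊) ≤ h * (17*C*h + h + 1) := by nlinarith
      exact le_of_mul_le_mul_left this hhp
    have d' : -(17*C*h + h + 1) ≤ Chebyshev.psi x - ⌊x⌋₊ := by
      have : h * (-(17*C*h + h + 1)) ≤ h * (Chebyshev.psi x - ⌊x⌋₊) := by nlinarith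
      exact le_of_mul_le_mul_left this hhp
    have fin : |Chebyshev.psi x - x| ≤ 17*C*h + h + 2 := by
      rw [abs_le]; constructor <;> linarith
    have sq := sq_log_le hx.le
    calc |Chebyshev.psi x - x| * ℓ ^ 2 ≤ (17*C*h + h + 2) * ℓ^2 := by gcongr
      _ = (17*C+1)*(h*ℓ^2) + 2*ℓ^2 := by ring
      _ ≤ (17*C+1)*x + 2*(2*x) := by rw [hhl]; gcongr
      _ ≤ _ := by nlinarith

end RD

open Real MeasureTheory

namespace RD

lemma integral_inv_log_sq {y z : ℝ} (hy : 1 < y) (hyz : y ≤ z) :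
    IntervalIntegrable (fun t => 1/(t*(log t)^2)) volume y z ∧
    ∫ t in y..z, 1/(t*(log t)^2) = 1/log y - 1/log z := by
  have hpos : ∀ t ∈ Set.uIcc y z, 1 < t := by
    intro t ht; rw [Set.uIcc_of_le hyz] at ht; linarith [ht.1]
  have hI : IntervalIntegrable (fun t => 1/(t*(log t)^2)) volume y z := by
    apply ContinuousOn.intervalIntegrable
    apply ContinuousOn.div continuousOn_const
    · apply continuousOn_id.mul
      apply ContinuousOn.pow
      exact ContinuousOn.log continuousOn_id (fun t ht => by have := hpos t ht; simp; linarith)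
    · intro t ht
      have h1 := hpos t ht
      have := Real.log_pos h1
      positivity
  refine ⟨hI, ?_⟩
  rw [intervalIntegral.integral_eq_sub_of_hasDerivAt (f := fun t => -(log t)⁻¹) ?_ hI]
  · simp only [one_div]; ring
  · intro t ht
    have h1 := hpos t ht
    have hl := Real.log_pos h1
    have := ((Real.hasDerivAt_log (by linarith : t ≠ 0)).inv hl.ne').neg
    have e : 1 / (t * log t ^ 2) = -(-t⁻¹ / log t ^ 2) := by field_simp
    rw [e]
    exact this

lemma abel_pnt (c : ℕ → ℝ) {y C D z : ℝ} (hy : 2 ≤ y) (hyz : y ≤ z)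
    (hc0 : ∀ n : ℕ, (n:ℝ) ≤ y → c n = 0) (hC : 0 ≤ C)
    (hA : ∀ t, y ≤ t → |∑ n ∈ Finset.Icc 0 ⌊t⌋₊, c n - (t - y)| ≤ C * t / (log t)^2)
    (f f' : ℝ → ℝ) (hf : ∀ t ∈ Set.Icc y z, HasDerivAt f (f' t) t)
    (hf' : ContinuousOn f' (Set.Icc y z)) (hD : ∀ t ∈ Set.Icc y z, |f' t| ≤ D / t^2)
    (hDz : |f z| ≤ D / z) (hD0 : 0 ≤ D) :
    |∑ n ∈ Finset.Icc 0 ⌊z⌋₊, c n * f n - ∫ t in y..z, f t| ≤ D * C * (1/(log y)^2 + 1/log y) := by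
  have hy0 : 0 < y := by linarith
  have hz0 : 0 < z := by linarith
  have hly : 0 < log y := Real.log_pos (by linarith)
  have hlyz : log y ≤ log z := Real.log_le_log hy0 hyz
  have hd : ∀ t ∈ Set.Icc y z, deriv f t = f' t := fun t ht => (hf t ht).deriv
  have hdi : IntegrableOn (deriv f) (Set.Icc y z) :=
    (hf'.integrableOn_Icc).congr_fun (fun t ht => (hd t ht).symm) measurableSet_Icc
  have key := sum_mul_eq_sub_sub_integral_mul c hy0.le hyz
    (fun t ht => (hf t ht).differentiableAt) hdi
  have hAy : ∑ n ∈ Finset.Icc 0 ⌊y⌋₊, c n = 0 := by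
    apply Finset.sum_eq_zero
    intro n hn
    rw [Finset.mem_Icc] at hn
    exact hc0 n ((Nat.le_floor_iff hy0.le).mp hn.2)
  have hsum : ∑ n ∈ Finset.Icc 0 ⌊z⌋₊, c n * f n = ∑ k ∈ Finset.Ioc ⌊y⌋₊ ⌊z⌋₊, f k * c k := by
    symm
    rw [Finset.sum_congr rfl (fun (k:ℕ) _ => mul_comm (f k) (c k))]
    apply Finset.sum_subset
    · intro n; simp
    · intro n hn hn'
      rw [hc0 n, zero_mul]
      apply (Nat.le_floor_iff hy0.le).mp
      simp at hn hn'; by_contra h; push Not at h; have := hn' h; omega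
  have hint : IntegrableOn (fun t => f' t * ∑ k ∈ Finset.Icc 0 ⌊t⌋₊, c k) (Set.Icc y z) :=
    integrableOn_mul_sum_Icc c hy0.le (hf'.integrableOn_Icc)
  have hint' : IntervalIntegrable (fun t => f' t * ∑ k ∈ Finset.Icc 0 ⌊t⌋₊, c k) volume y z := by
    rw [intervalIntegrable_iff_integrableOn_Ioc_of_le hyz]
    exact hint.mono_set Set.Ioc_subset_Icc_self
  have hi2 : ∫ t in Set.Ioc y z, deriv f t * ∑ k ∈ Finset.Icc 0 ⌊t⌋₊, c k =
      ∫ t in y..z, f' t * ∑ k ∈ Finset.Icc 0 ⌊t⌋₊, c k := by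
    rw [intervalIntegral.integral_of_le hyz]
    apply setIntegral_congr_fun measurableSet_Ioc
    intro t ht
    simp only [hd t (Set.Ioc_subset_Icc_self ht)]
  have hf'i : IntervalIntegrable f' volume y z := by
    apply ContinuousOn.intervalIntegrable; rwa [Set.uIcc_of_le hyz]
  have hibp : ∫ t in y..z, f t * 1 = f z * (z - y) - f y * (y - y) - ∫ t in y..z, f' t * (t - y) := by
    apply intervalIntegral.integral_mul_deriv_eq_deriv_mul (v := fun t => t - y) (v' := fun _ => 1)
    · rwa [Set.uIcc_of_le hyz]
    · intro t _; exact (hasDerivAt_id t).sub_const y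
    · exact hf'i
    · simp
  have hint3 : IntervalIntegrable (fun t => f' t * (t - y)) volume y z := by
    apply ContinuousOn.intervalIntegrable; rw [Set.uIcc_of_le hyz]
    exact hf'.mul (by fun_prop)
  have e : ∑ n ∈ Finset.Icc 0 ⌊z⌋₊, c n * f n - ∫ t in y..z, f t =
      f z * (∑ n ∈ Finset.Icc 0 ⌊z⌋₊, c n - (z - y)) -
      ∫ t in y..z, f' t * (∑ k ∈ Finset.Icc 0 ⌊t⌋₊, c k - (t - y)) := by
    simp only [mul_one] at hibp
    rw [hsum, key, hAy, hi2, hibp]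
    simp only [mul_sub (f' _) (∑ k ∈ _, _)]
    rw [intervalIntegral.integral_sub hint' hint3]
    ring
  rw [e]
  obtain ⟨hJ, hJ2⟩ := integral_inv_log_sq (by linarith : 1 < y) hyz
  have b1 : |f z * (∑ n ∈ Finset.Icc 0 ⌊z⌋₊, c n - (z - y))| ≤ D * C * (1/(log y)^2) := by
    rw [abs_mul]
    calc _ ≤ D / z * (C * z / (log z)^2) := by
          gcongr
          exact hA z hyz
      _ = D * C * (1/(log z)^2) := by field_simp
      _ ≤ _ := by gcongr
  have b2 : |∫ t in y..z, f' t * (∑ k ∈ Finset.Icc 0 ⌊t⌋₊, c k - (t - y))| ≤ D * C * (1/log y) := by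
    calc _ ≤ ∫ t in y..z, (D * C) * (1/(t*(log t)^2)) := by
          rw [← Real.norm_eq_abs]
          apply intervalIntegral.norm_integral_le_of_norm_le hyz _ (hJ.const_mul _)
          filter_upwards with t ht
          have ht' := Set.Ioc_subset_Icc_self ht
          have ht0 : 0 < t := by linarith [ht'.1]
          rw [norm_mul, Real.norm_eq_abs, Real.norm_eq_abs]
          calc _ ≤ D / t^2 * (C * t / (log t)^2) := by
                gcongr
                · exact hD t ht'
                · exact hA t ht'.1
            _ = _ := by field_simp
      _ ≤ _ := by
          rw [intervalIntegral.integral_const_mul, hJ2]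
          have : 0 ≤ 1/log z := by have := hly.trans_le hlyz; positivity
          gcongr
          linarith
  rw [mul_add]
  exact (abs_sub _ _).trans (add_le_add b1 b2)

/-- rough indicator -/
noncomputable def rg (y : ℝ) (n : ℕ) : ℝ :=
  if n = 1 ∨ y < (n.minFac : ℝ) then 1 else 0

lemma rg_nonneg (y : ℝ) (n : ℕ) : 0 ≤ rg y n := by unfold rg; split_ifs <;> norm_num
lemma rg_le_one (y : ℝ) (n : ℕ) : rg y n ≤ 1 := by unfold rg; split_ifs <;> norm_num
lemma rg_one (y : ℝ) : rg y 1 = 1 := by simp [rg]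
lemma rg_zero {y : ℝ} (hy : 2 ≤ y) : rg y 0 = 0 := by simp [rg, hy]
lemma rg_prime {y : ℝ} {p : ℕ} (hp : p.Prime) : rg y p = if y < p then 1 else 0 := by
  simp [rg, hp.minFac_eq, hp.ne_one]
lemma rg_small {y : ℝ} {n : ℕ} (h1 : 1 < n) (h : (n:ℝ) ≤ y) : rg y n = 0 := by
  unfold rg
  rw [if_neg]
  push Not
  refine ⟨by omega, le_trans ?_ h⟩
  exact_mod_cast Nat.minFac_le (by omega)
lemma rg_mul (y : ℝ) {m n : ℕ} (hm : m ≠ 0) (hn : n ≠ 0) : rg y (m*n) = rg y m * rg y n := by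
  have key : ∀ k : ℕ, k ≠ 0 → ((k = 1 ∨ y < (k.minFac:ℝ)) ↔ ∀ p : ℕ, p.Prime → p ∣ k → y < p) := by
    intro k hk
    constructor
    · rintro (h | h) p hp hpk
      · subst h; exact absurd (Nat.dvd_one.mp hpk) hp.ne_one
      · refine h.trans_le ?_
        exact_mod_cast Nat.minFac_le_of_dvd hp.two_le hpk
    · intro h
      by_cases h1 : k = 1
      · exact Or.inl h1
      · exact Or.inr (h _ (Nat.minFac_prime h1) (Nat.minFac_dvd k))
  classical
  unfold rg
  rw [if_congr (key m hm) rfl rfl, if_congr (key n hn) rfl rfl, if_congr (key _ (mul_ne_zero hm hn)) rfl rfl]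
  by_cases h1 : ∀ p : ℕ, p.Prime → p ∣ m → y < p
  · by_cases h2 : ∀ p : ℕ, p.Prime → p ∣ n → y < p
    · rw [if_pos h1, if_pos h2, if_pos, one_mul]
      intro p hp hd
      rcases (hp.dvd_mul).mp hd with h | h
      · exact h1 p hp h
      · exact h2 p hp h
    · rw [if_neg h2, if_neg, mul_zero]
      intro h; apply h2; intro p hp hd; exact h p hp (hd.mul_left m)
  · rw [if_neg h1, if_neg, zero_mul]
    intro h; apply h1; intro p hp hd; exact h p hp (hd.mul_right n)

end RD

open Real MeasureTheory

namespace RD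

lemma quasi_mono {y t : ℝ} (hy : 2 ≤ y) (hyt : y ≤ t) : y / (log y)^2 ≤ 18 * (t / (log t)^2) := by
  have hy0 : 0 < y := by linarith
  have ht0 : 0 < t := by linarith
  have h2 : 1/2 < log y := by
    have := Real.log_two_gt_d9
    have := Real.log_le_log (by norm_num) hy
    linarith
  have hlt : log y ≤ log t := Real.log_le_log hy0 hyt
  set r := t / y with hr
  have hr1 : 1 ≤ r := by rw [hr, le_div_iff₀ hy0]; linarith
  have ht : t = y * r := by rw [hr]; field_simp
  have hl : log t = log y + log r := by rw [ht, Real.log_mul (by positivity) (by positivity)]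
  have hlr := Real.log_nonneg hr1
  have hs := sq_log_le hr1
  have h3 : (log t)^2 ≤ 18 * r * (log y)^2 := by
    have : log t ≤ log y * (1 + 2 * log r) := by rw [hl]; nlinarith
    calc (log t)^2 ≤ (log y * (1 + 2 * log r))^2 := by gcongr; linarith
      _ = (log y)^2 * (1 + 2 * log r)^2 := by ring
      _ ≤ (log y)^2 * (18 * r) := by gcongr; nlinarith [sq_nonneg (1 - 2 * log r)]
      _ = _ := by ring
  rw [← mul_div_assoc, div_le_div_iff₀ (by positivity) (by nlinarith), ht]
  rw [ht] at h3
  nlinarith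

lemma theta_pnt' : ∃ C : ℝ, 0 < C ∧ ∀ x : ℝ, 1 < x → |Chebyshev.theta x - x| ≤ C * x / (log x)^2 ∧
    Chebyshev.psi x - Chebyshev.theta x ≤ C * x / (log x)^2 := by
  obtain ⟨C, hC, h⟩ := psi_pnt
  obtain ⟨K, hK⟩ := Chebyshev.psi_sub_theta_le_mul_sqrt
  have key : ∀ x : ℝ, 1 < x → Chebyshev.psi x - Chebyshev.theta x ≤ 8 * |K| * x / (log x)^2 := by
    intro x hx
    have hl := Real.log_pos hx
    have h1 := hK x
    have h2 : (log x)^2 ≤ 8 * √x := by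
      have := sq_log_le (x := √x) (by rw [Real.one_le_sqrt]; exact hx.le)
      rw [Real.log_sqrt (by linarith)] at this
      linarith
    have h3 : √x * √x = x := Real.mul_self_sqrt (by linarith)
    rw [le_div_iff₀ (by positivity)]
    calc _ ≤ (|K| * √x) * (8 * √x) := by
          gcongr
          exact h1.trans (by gcongr; exact le_abs_self K)
      _ = 8 * |K| * (√x * √x) := by ring
      _ = _ := by rw [h3]
  refine ⟨C + 8 * |K|, by positivity, fun x hx => ?_⟩
  have a := h x hx
  have b := key x hx
  have c := Chebyshev.theta_le_psi x
  have e : (C + 8 * |K|) * x / (log x)^2 = C * x / (log x)^2 + 8 * |K| * x / (log x)^2 := by ring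
  have d : 0 ≤ C * x / (log x)^2 := by positivity
  rw [e]
  rw [abs_le] at a ⊢
  refine ⟨⟨?_, ?_⟩, ?_⟩ <;> linarith

/-- log p on primes above y -/
noncomputable def lp (y : ℝ) (n : ℕ) : ℝ := if n.Prime ∧ y < n then log n else 0
/-- von Mangoldt on rough numbers -/
noncomputable def lr (y : ℝ) (n : ℕ) : ℝ := ArithmeticFunction.vonMangoldt n * rg y n

lemma lp_small {y : ℝ} {n : ℕ} (h : (n:ℝ) ≤ y) : lp y n = 0 := by
  unfold lp; rw [if_neg]; rintro ⟨_, h'⟩; linarith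
lemma lr_small {y : ℝ} (hy : 2 ≤ y) {n : ℕ} (h : (n:ℝ) ≤ y) : lr y n = 0 := by
  unfold lr
  rcases Nat.lt_or_ge 1 n with h1 | h1
  · rw [rg_small h1 h, mul_zero]
  · interval_cases n <;> simp
lemma lp_nonneg (y : ℝ) (n : ℕ) : 0 ≤ lp y n := by
  unfold lp; split_ifs
  · exact Real.log_natCast_nonneg n
  · exact le_rfl
lemma lr_nonneg (y : ℝ) (n : ℕ) : 0 ≤ lr y n :=
  mul_nonneg ArithmeticFunction.vonMangoldt_nonneg (rg_nonneg y n)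
lemma lp_le_lr (y : ℝ) (n : ℕ) : lp y n ≤ lr y n := by
  unfold lp; split_ifs with h
  · unfold lr; rw [rg_prime h.1, if_pos h.2, ArithmeticFunction.vonMangoldt_apply_prime h.1, mul_one]
  · exact lr_nonneg y n
lemma lr_le (y : ℝ) (n : ℕ) :
    lr y n ≤ lp y n + (if ¬ n.Prime then ArithmeticFunction.vonMangoldt n else 0) := by
  by_cases hp : n.Prime
  · simp only [hp, not_true_eq_false, if_false, add_zero]
    unfold lr lp; rw [rg_prime hp, ArithmeticFunction.vonMangoldt_apply_prime hp]
    by_cases h : y < n <;> simp [hp, h]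
  · simp only [hp, not_false_eq_true, if_true]
    have h1 := lp_nonneg y n
    have : lr y n ≤ ArithmeticFunction.vonMangoldt n := by
      unfold lr
      exact mul_le_of_le_one_right ArithmeticFunction.vonMangoldt_nonneg (rg_le_one y n)
    linarith

lemma lp_sum {y t : ℝ} (hy : 0 ≤ y) (hyt : y ≤ t) :
    ∑ n ∈ Finset.Icc 0 ⌊t⌋₊, lp y n = Chebyshev.theta t - Chebyshev.theta y := by
  rw [Chebyshev.theta_eq_sum_Icc, Chebyshev.theta_eq_sum_Icc, Finset.sum_filter, Finset.sum_filter]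
  have : Finset.Icc 0 ⌊y⌋₊ ⊆ Finset.Icc 0 ⌊t⌋₊ := Finset.Icc_subset_Icc_right (Nat.floor_le_floor hyt)
  rw [← Finset.sum_sdiff this (f := fun a : ℕ => if Nat.Prime a then log (a:ℝ) else 0), add_sub_cancel_right,
    ← Finset.sum_sdiff this]
  have h0 : ∑ n ∈ Finset.Icc 0 ⌊y⌋₊, lp y n = 0 := by
    apply Finset.sum_eq_zero; intro n hn
    exact lp_small ((Nat.le_floor_iff hy).mp (Finset.mem_Icc.mp hn).2)
  rw [h0, add_zero]
  apply Finset.sum_congr rfl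
  intro n hn
  simp at hn
  have : y < n := (Nat.floor_lt hy).mp hn.2
  simp [lp, this]

lemma lr_sum {y t : ℝ} (hy : 0 ≤ y) (hyt : y ≤ t) :
    Chebyshev.theta t - Chebyshev.theta y ≤ ∑ n ∈ Finset.Icc 0 ⌊t⌋₊, lr y n ∧
    ∑ n ∈ Finset.Icc 0 ⌊t⌋₊, lr y n ≤ Chebyshev.psi t - Chebyshev.theta y := by
  rw [← lp_sum hy hyt]
  refine ⟨Finset.sum_le_sum fun n _ => lp_le_lr y n, ?_⟩
  have h1 := lp_sum hy hyt
  have h2 := Chebyshev.psi_sub_theta_eq_sum_not_prime t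
  have h3 := Finset.sum_le_sum fun n (_ : n ∈ Finset.Icc 0 ⌊t⌋₊) => lr_le y n
  rw [Finset.sum_add_distrib, h1] at h3
  rw [Finset.sum_filter] at h2
  have h4 : ∑ n ∈ Finset.Icc 0 ⌊t⌋₊, (if ¬ n.Prime then ArithmeticFunction.vonMangoldt n else 0) =
      ∑ n ∈ Finset.Ioc 0 ⌊t⌋₊, (if ¬ n.Prime then ArithmeticFunction.vonMangoldt n else 0) := by
    symm
    apply Finset.sum_subset
    · intro n; simp
    · intro n hn hn'
      have : n = 0 := by simp at hn hn'; by_contra h; have := hn' (by omega); omega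
      subst this; simp
  rw [h4, ← h2] at h3
  linarith

lemma rough_pnt : ∃ C : ℝ, 0 < C ∧ ∀ y t : ℝ, 2 ≤ y → y ≤ t →
    |∑ n ∈ Finset.Icc 0 ⌊t⌋₊, lp y n - (t - y)| ≤ C * t / (log t)^2 ∧
    |∑ n ∈ Finset.Icc 0 ⌊t⌋₊, lr y n - (t - y)| ≤ C * t / (log t)^2 := by
  obtain ⟨C, hC, h⟩ := theta_pnt'
  refine ⟨20 * C, by positivity, fun y t hy hyt => ?_⟩
  obtain ⟨a1, a2⟩ := h t (by linarith)
  obtain ⟨b1, _⟩ := h y (by linarith)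
  have q := quasi_mono hy hyt
  have b3 : C * y / (log y)^2 ≤ 18 * (C * t / (log t)^2) := by
    calc _ = C * (y / (log y)^2) := by ring
      _ ≤ C * (18 * (t / (log t)^2)) := by gcongr
      _ = _ := by ring
  obtain ⟨c1, c2⟩ := lr_sum (by linarith : 0 ≤ y) hyt
  have e : 20 * C * t / (log t)^2 = 20 * (C * t / (log t)^2) := by ring
  have d : 0 ≤ C * t / (log t)^2 := by have : 0 < t := by linarith
                                       positivity
  rw [e, lp_sum (by linarith) hyt]
  set E := C * t / (log t)^2
  rw [abs_le] at a1 b1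
  rw [abs_le, abs_le]
  refine ⟨⟨by linarith, by linarith⟩, ⟨by linarith, by linarith⟩⟩

lemma sum_lr_div : ∃ C : ℝ, 0 < C ∧ ∀ y z : ℝ, 2 ≤ y → y ≤ z →
    |∑ n ∈ Finset.Icc 0 ⌊z⌋₊, lr y n * (1/n) - log (z/y)| ≤ C / log y ∧
    |∑ n ∈ Finset.Icc 0 ⌊z⌋₊, lp y n * (1/n) - log (z/y)| ≤ C / log y ∧
    |∑ n ∈ Finset.Icc 0 ⌊z⌋₊, lp y n * (1/(n * log n)) - log (log z/log y)| ≤ C / (log y)^2 := by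
  obtain ⟨C, hC, h⟩ := rough_pnt
  refine ⟨9 * C * 3, by positivity, fun y z hy hyz => ?_⟩
  have hy0 : 0 < y := by linarith
  have hz0 : 0 < z := by linarith
  have h2 : 1/2 < log y := by
    have := Real.log_two_gt_d9
    have := Real.log_le_log (by norm_num) hy
    linarith
  have hlyz : log y ≤ log z := Real.log_le_log hy0 hyz
  have hmem : ∀ t ∈ Set.Icc y z, 0 < t ∧ 1/2 < log t ∧ log y ≤ log t := by
    intro t ht
    have : log y ≤ log t := Real.log_le_log hy0 ht.1
    exact ⟨by linarith [ht.1], by linarith, this⟩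
  have hb : 1/(log y)^2 + 1/log y ≤ 3 / log y := by
    have : 1/(log y)^2 ≤ 2 / log y := by
      rw [div_le_div_iff₀ (by positivity) (by positivity)]; nlinarith
    calc _ ≤ 2/log y + 1/log y := by linarith
      _ = _ := by ring
  have hI1 : ∫ t in y..z, 1/t = log (z/y) := by
    rw [integral_one_div]
    rw [Set.uIcc_of_le hyz]; intro h; linarith [h.1]
  have f1 : ∀ t ∈ Set.Icc y z, HasDerivAt (fun t : ℝ => 1/t) (-(t^2)⁻¹) t := by
    intro t ht
    simpa using hasDerivAt_inv (hmem t ht).1.ne'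
  have f2 : ContinuousOn (fun t : ℝ => -(t^2)⁻¹) (Set.Icc y z) := by
    apply ContinuousOn.neg; apply ContinuousOn.inv₀ (by fun_prop)
    intro t ht; have := (hmem t ht).1; positivity
  have f3 : ∀ t ∈ Set.Icc y z, |(fun t : ℝ => -(t^2)⁻¹) t| ≤ 1 / t^2 := by
    intro t ht; simp
  have gen1 : ∀ c : ℕ → ℝ, (∀ n : ℕ, (n:ℝ) ≤ y → c n = 0) →
      (∀ t, y ≤ t → |∑ n ∈ Finset.Icc 0 ⌊t⌋₊, c n - (t - y)| ≤ C * t / (log t)^2) →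
      |∑ n ∈ Finset.Icc 0 ⌊z⌋₊, c n * (1/n) - log (z/y)| ≤ 9 * C * 3 / log y := by
    intro c hc0 hA
    have := abel_pnt c (D := 1) hy hyz hc0 hC.le hA (fun t => 1/t) _ f1 f2 f3
      (by rw [abs_of_nonneg (by positivity)]) zero_le_one
    rw [hI1] at this
    refine this.trans ?_
    rw [one_mul]
    calc _ ≤ C * (3 / log y) := by gcongr
      _ ≤ _ := by rw [← mul_div_assoc]; gcongr; linarith
  refine ⟨gen1 _ (fun n hn => lr_small hy hn) (fun t ht => (h y t hy ht).2),
    gen1 _ (fun n hn => lp_small hn) (fun t ht => (h y t hy ht).1), ?_⟩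
  have hI2 : ∫ t in y..z, 1/(t * log t) = log (log z/log y) := by
    rw [intervalIntegral.integral_eq_sub_of_hasDerivAt (f := fun t => log (log t))]
    · rw [Real.log_div (by linarith) (by linarith)]
    · intro t ht
      rw [Set.uIcc_of_le hyz] at ht
      have := hmem t ht
      have h := (Real.hasDerivAt_log this.1.ne').log (by linarith)
      have e : t⁻¹ / log t = 1/(t*log t) := by
        have := this.1; have : 0 < log t := by linarith
        field_simp
      rwa [e] at h
    · apply ContinuousOn.intervalIntegrable
      rw [Set.uIcc_of_le hyz]
      apply ContinuousOn.div continuousOn_const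
      · exact continuousOn_id.mul (ContinuousOn.log continuousOn_id (fun t ht => (hmem t ht).1.ne'))
      · intro t ht; obtain ⟨a, b, _⟩ := hmem t ht; have : 0 < log t := by linarith
        positivity
  have g1 : ∀ t ∈ Set.Icc y z, HasDerivAt (fun t : ℝ => 1/(t * log t)) (-(log t + 1)/(t * log t)^2) t := by
    intro t ht
    obtain ⟨a, b, _⟩ := hmem t ht
    have h0 : t * log t ≠ 0 := by have : 0 < log t := by linarith
                                  positivity
    have := ((hasDerivAt_id t).mul (Real.hasDerivAt_log a.ne')).inv h0
    have e : -(log t + 1)/(t * log t)^2 = -(1 * log t + id t * t⁻¹) / (t * log t)^2 := by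
      simp [a.ne']
    rw [e]
    simp only [one_div]
    exact this
  have g2 : ContinuousOn (fun t : ℝ => (-(log t + 1)/(t * log t)^2)) (Set.Icc y z) := by
    have hlog : ContinuousOn (fun t : ℝ => log t) (Set.Icc y z) :=
      ContinuousOn.log continuousOn_id (fun t ht => (hmem t ht).1.ne')
    apply ContinuousOn.div
    · exact (hlog.add continuousOn_const).neg
    · exact (continuousOn_id.mul hlog).pow 2
    · intro t ht; obtain ⟨a, b, _⟩ := hmem t ht; have : 0 < log t := by linarith
      positivity
  have g3 : ∀ t ∈ Set.Icc y z, |(fun t : ℝ => (-(log t + 1)/(t * log t)^2)) t| ≤ (3/log y) / t^2 := by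
    intro t ht
    obtain ⟨a, b, b'⟩ := hmem t ht
    simp only
    rw [abs_div, abs_neg, abs_of_pos (by linarith : 0 < log t + 1), abs_of_nonneg (by positivity), mul_pow,
      div_div, div_le_div_iff₀ (by have : 0 < log t := by linarith
                                   positivity) (by positivity)]
    have : (log t + 1) * log y ≤ 3 * (log t)^2 := by nlinarith
    nlinarith [sq_nonneg t, mul_le_mul_of_nonneg_left this (sq_nonneg t)]
  have := abel_pnt (lp y) (D := 3/log y) hy hyz (fun n hn => lp_small hn) hC.le
    (fun t ht => (h y t hy ht).1) (fun t => 1/(t * log t)) _ g1 g2 g3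
    (by
      have : 0 < log z := by linarith
      rw [abs_of_nonneg (by positivity), div_div, div_le_div_iff₀ (by positivity) (by positivity)]
      nlinarith) (by positivity)
  rw [hI2] at this
  refine this.trans ?_
  calc _ ≤ 3 / log y * C * (3 / log y) := by gcongr
    _ = 9 * C / (log y)^2 := by field_simp; norm_num
    _ ≤ _ := div_le_div_of_nonneg_right (by linarith) (by positivity)

end RD

open Real MeasureTheory

namespace RD

/-- primes up to y -/
noncomputable def Pf (y : ℝ) : Finset ℕ := (Finset.range (⌊y⌋₊ + 1)).filter Nat.Prime

lemma mem_Pf {y : ℝ} (hy : 0 ≤ y) {p : ℕ} : p ∈ Pf y ↔ p.Prime ∧ (p:ℝ) ≤ y := by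
  unfold Pf
  rw [Finset.mem_filter, Finset.mem_range, Nat.lt_succ_iff, Nat.le_floor_iff hy, and_comm]

lemma Pf_split (g : ℕ → ℝ) {y z : ℝ} (hy : 0 ≤ y) (hyz : y ≤ z) :
    ∑ p ∈ Pf z, g p = ∑ p ∈ Pf y, g p + ∑ n ∈ Finset.Icc 0 ⌊z⌋₊, if n.Prime ∧ y < n then g n else 0 := by
  have hz : 0 ≤ z := by linarith
  have hs : Pf y ⊆ Pf z := by
    intro p hp; rw [mem_Pf hy] at hp; rw [mem_Pf hz]; exact ⟨hp.1, by linarith [hp.2]⟩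
  rw [← Finset.sum_sdiff hs, add_comm]
  congr 1
  rw [← Finset.sum_filter]
  apply Finset.sum_congr _ (fun _ _ => rfl)
  ext p
  rw [Finset.mem_sdiff, mem_Pf hy, mem_Pf hz, Finset.mem_filter, Finset.mem_Icc, Nat.le_floor_iff hz]
  constructor
  · rintro ⟨⟨a, b⟩, c⟩
    refine ⟨⟨Nat.zero_le _, b⟩, a, ?_⟩
    by_contra h; exact c ⟨a, not_lt.mp h⟩
  · rintro ⟨⟨_, b⟩, a, c⟩
    exact ⟨⟨a, b⟩, fun h => by linarith [h.2]⟩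

lemma tele_sq (a b : ℕ) (ha : 1 ≤ a) (hab : a ≤ b) :
    ∑ n ∈ Finset.Ioc a b, 1/((n:ℝ)*(n-1)) = 1/(a:ℝ) - 1/b := by
  induction b, hab using Nat.le_induction with
  | base => simp
  | succ b hb ih =>
    rw [← Finset.insert_Ioc_right_eq_Ioc_add_one (by omega), Finset.sum_insert (by simp), ih]
    have : (0:ℝ) < b := by exact_mod_cast (by omega : 0 < b)
    have ha' : (0:ℝ) < a := by exact_mod_cast ha
    push_cast
    rw [add_sub_cancel_right]
    field_simp
    ring

lemma sum_sq_tail {y z : ℝ} (hy : 2 ≤ y) (hyz : y ≤ z) :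
    ∑ n ∈ Finset.Icc 0 ⌊z⌋₊, (if n.Prime ∧ y < n then 1/((n:ℝ)*(n-1)) else 0) ≤ 2 / y := by
  have hf1 : 2 ≤ ⌊y⌋₊ := Nat.le_floor (by exact_mod_cast hy)
  calc _ ≤ ∑ n ∈ Finset.Ioc ⌊y⌋₊ ⌊z⌋₊, 1/((n:ℝ)*(n-1)) := by
        rw [← Finset.sum_filter]
        apply Finset.sum_le_sum_of_subset_of_nonneg
        · intro n hn
          simp only [Finset.mem_filter, Finset.mem_Icc, Finset.mem_Ioc] at hn ⊢
          exact ⟨(Nat.floor_lt (by linarith)).mpr hn.2.2, hn.1.2⟩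
        · intro n hn _
          have : (1:ℝ) ≤ n := by exact_mod_cast (by simp at hn; omega)
          have : 0 ≤ (n:ℝ) - 1 := by linarith
          positivity
    _ = 1/(⌊y⌋₊:ℝ) - 1/(⌊z⌋₊:ℝ) := tele_sq _ _ (by omega) (Nat.floor_le_floor hyz)
    _ ≤ 1/(⌊y⌋₊:ℝ) := by simp
    _ ≤ 2 / y := by
        have := Nat.lt_floor_add_one y
        have h2 : (2:ℝ) ≤ ⌊y⌋₊ := by exact_mod_cast hf1
        rw [div_le_div_iff₀ (by linarith) (by linarith)]
        linarith

lemma neg_log_bound {p : ℕ} (hp : 2 ≤ p) : 1/(p:ℝ) ≤ -log (1 - 1/p) ∧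
    -log (1 - 1/(p:ℝ)) ≤ 1/(p:ℝ) + 1/((p:ℝ)*(p-1)) := by
  have h2 : (2:ℝ) ≤ p := by exact_mod_cast hp
  have h1 : 0 < 1 - 1/(p:ℝ) := by
    rw [sub_pos, div_lt_one (by linarith)]; linarith
  constructor
  · have := Real.log_le_sub_one_of_pos h1; linarith
  · have := Real.one_sub_inv_le_log_of_pos h1
    have e : 1/(p:ℝ) + 1/((p:ℝ)*(p-1)) = (1 - 1/(p:ℝ))⁻¹ - 1 := by
      have : (p:ℝ) - 1 ≠ 0 := by linarith
      have : (p:ℝ) ≠ 0 := by linarith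
      field_simp
      ring
    rw [e]; linarith

/-- -log V -/
noncomputable def GG (y : ℝ) : ℝ := ∑ p ∈ Pf y, -log (1 - 1/(p:ℝ))

lemma primeProd_eq {y : ℝ} (hy : 0 ≤ y) : primeProd y = rexp (- GG y) := by
  unfold primeProd GG
  rw [← Finset.sum_neg_distrib, Real.exp_sum]
  apply Finset.prod_congr rfl
  intro p hp
  have := ((mem_Pf hy).mp hp).1.two_le
  have h2 : (2:ℝ) ≤ p := by exact_mod_cast this
  rw [neg_neg, Real.exp_log]
  rw [sub_pos, div_lt_one (by linarith)]; linarith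

lemma half_lt_log {y : ℝ} (hy : 2 ≤ y) : 1/2 < log y := by
  have := Real.log_two_gt_d9
  have := Real.log_le_log (by norm_num) hy
  linarith

lemma sum_inv_p : ∃ C : ℝ, 0 < C ∧ ∀ y z : ℝ, 2 ≤ y → y ≤ z →
    |∑ p ∈ Pf z, 1/(p:ℝ) - ∑ p ∈ Pf y, 1/(p:ℝ) - log (log z / log y)| ≤ C / (log y)^2 ∧
    |GG z - GG y - log (log z / log y)| ≤ C / (log y)^2 := by
  obtain ⟨C, hC, h⟩ := sum_lr_div
  refine ⟨C + 4, by positivity, fun y z hy hyz => ?_⟩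
  have h3 := (h y z hy hyz).2.2
  have hl := half_lt_log hy
  have e : ∑ p ∈ Pf z, 1/(p:ℝ) - ∑ p ∈ Pf y, 1/(p:ℝ) =
      ∑ n ∈ Finset.Icc 0 ⌊z⌋₊, lp y n * (1/(n * log n)) := by
    rw [Pf_split _ (by linarith : 0 ≤ y) hyz, add_sub_cancel_left]
    apply Finset.sum_congr rfl
    intro n _
    unfold lp
    split_ifs with hn
    · have : 0 < log n := Real.log_pos (by exact_mod_cast hn.1.one_lt)
      field_simp
    · simp
  have h4 : C / (log y)^2 ≤ (C+4) / (log y)^2 := by gcongr; linarith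
  refine ⟨by rw [e]; exact h3.trans h4, ?_⟩
  have hdiff : GG z - GG y - (∑ p ∈ Pf z, 1/(p:ℝ) - ∑ p ∈ Pf y, 1/(p:ℝ)) =
      ∑ n ∈ Finset.Icc 0 ⌊z⌋₊, if n.Prime ∧ y < n then -log (1 - 1/(n:ℝ)) - 1/(n:ℝ) else 0 := by
    have := Pf_split (fun n => -log (1 - 1/(n:ℝ)) - 1/(n:ℝ)) (by linarith : 0 ≤ y) hyz
    simp only [Finset.sum_sub_distrib] at this
    unfold GG
    linarith
  have d1 : 0 ≤ GG z - GG y - (∑ p ∈ Pf z, 1/(p:ℝ) - ∑ p ∈ Pf y, 1/(p:ℝ)) := by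
    rw [hdiff]
    apply Finset.sum_nonneg
    intro n _
    split_ifs with hn
    · have := (neg_log_bound hn.1.two_le).1; linarith
    · exact le_rfl
  have d2 : GG z - GG y - (∑ p ∈ Pf z, 1/(p:ℝ) - ∑ p ∈ Pf y, 1/(p:ℝ)) ≤ 2 / y := by
    rw [hdiff]
    refine le_trans ?_ (sum_sq_tail hy hyz)
    apply Finset.sum_le_sum
    intro n _
    split_ifs with hn
    · have := (neg_log_bound hn.1.two_le).2; linarith
    · exact le_rfl
  have d3 : 2 / y ≤ 4 / (log y)^2 := by
    rw [div_le_div_iff₀ (by linarith) (by positivity)]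
    have := sq_log_le (by linarith : 1 ≤ y)
    linarith
  rw [e] at d1 d2
  have : (C+4) / (log y)^2 = C / (log y)^2 + 4 / (log y)^2 := by ring
  rw [this]
  rw [abs_le] at h3 ⊢
  constructor <;> linarith

lemma GG_limit : ∃ ℓ C : ℝ, 0 < C ∧ ∀ y : ℝ, 2 ≤ y → |GG y - log (log y) - ℓ| ≤ C / (log y)^2 := by
  obtain ⟨C, hC, h⟩ := sum_inv_p
  have h' : ∀ y z : ℝ, 2 ≤ y → y ≤ z →
      |(GG z - log (log z)) - (GG y - log (log y))| ≤ C / (log y)^2 := by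
    intro y z hy hyz
    have := (h y z hy hyz).2
    have a := half_lt_log hy
    have b := half_lt_log (hy.trans hyz)
    rw [Real.log_div (by linarith) (by linarith)] at this
    convert this using 2
    ring
  let s : ℕ → ℝ := fun n => GG (rexp (n+1)) - log (log (rexp (n+1)))
  have he : ∀ n : ℕ, 2 ≤ rexp (n+1) := by
    intro n; have := Real.add_one_le_exp ((n:ℝ)+1); have : (0:ℝ) ≤ n := Nat.cast_nonneg n; linarith
  have htend : Filter.Tendsto (fun n : ℕ => C / ((n:ℝ)+1)) Filter.atTop (nhds 0) := by
    have := tendsto_one_div_add_atTop_nhds_zero_nat (𝕜 := ℝ)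
    have := this.const_mul C
    simpa [div_eq_mul_inv] using this
  have hc : CauchySeq s := by
    apply cauchySeq_of_le_tendsto_0' (fun n : ℕ => C / ((n:ℝ)+1)) _ htend
    intro n m hnm
    have := h' (rexp (n+1)) (rexp (m+1)) (he n) (by gcongr)
    rw [dist_comm, Real.dist_eq]
    refine this.trans ?_
    rw [Real.log_exp]
    gcongr
    have : (0:ℝ) ≤ n := Nat.cast_nonneg n
    nlinarith
  obtain ⟨ℓ, hℓ⟩ := cauchySeq_tendsto_of_complete hc
  refine ⟨ℓ, C, hC, fun y hy => ?_⟩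
  have ht : Filter.Tendsto (fun n => |GG y - log (log y) - s n|) Filter.atTop (nhds |GG y - log (log y) - ℓ|) :=
    (tendsto_const_nhds.sub hℓ).abs
  apply le_of_tendsto ht
  filter_upwards [Filter.eventually_ge_atTop ⌈y⌉₊] with n hn
  rw [abs_sub_comm]
  apply h' _ _ hy
  have h1 := Nat.le_ceil y
  have h2 : (⌈y⌉₊:ℝ) ≤ n := by exact_mod_cast hn
  have := Real.add_one_le_exp ((n:ℝ)+1)
  linarith

lemma sum_log_p : ∃ C : ℝ, 0 < C ∧ ∀ y : ℝ, 2 ≤ y →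
    |∑ p ∈ Pf y, log p / ((p:ℝ) - 1) - log y| ≤ C ∧ ∑ p ∈ Pf y, log p / (p:ℝ) ≤ log y + C ∧
    ∑ p ∈ Pf y, 1/(p:ℝ) ≤ log (log y) + C := by
  obtain ⟨C1, hC1, h1⟩ := sum_lr_div
  obtain ⟨C2, hC2, h2⟩ := sum_inv_p
  have hs : Summable (fun n : ℕ => 4 * (1/(n:ℝ)^(3/2:ℝ))) :=
    (Real.summable_one_div_nat_rpow.mpr (by norm_num)).mul_left 4
  set K := ∑' n : ℕ, 4 * (1/(n:ℝ)^(3/2:ℝ)) with hK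
  have hK0 : 0 ≤ K := tsum_nonneg (fun n => by positivity)
  have h22 : ∑ p ∈ Pf 2, log p / (p:ℝ) ≤ 1 ∧ ∑ p ∈ Pf 2, 1 / (p:ℝ) ≤ 1 ∧ 0 ≤ ∑ p ∈ Pf 2, log p / (p:ℝ) := by
    have : Pf 2 = {2} := by unfold Pf; norm_num; decide
    rw [this]; simp
    have := Real.log_two_lt_d9
    have := Real.log_two_gt_d9
    exact ⟨by linarith, by norm_num, by linarith⟩
  have l2 := half_lt_log (le_refl (2:ℝ))
  have l2' : log 2 < 1 := by have := Real.log_two_lt_d9; linarith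
  have ll2 : -(1:ℝ) ≤ log (log 2) := by
    have := Real.one_sub_inv_le_log_of_pos (by linarith : 0 < log 2)
    have : (log 2)⁻¹ ≤ 2 := by rw [inv_le_comm₀ (by linarith) (by norm_num)]; linarith
    linarith
  refine ⟨2 * C1 + 4 * C2 + K + 4, by positivity, fun y hy => ?_⟩
  have hl := half_lt_log hy
  have a := (h1 2 y le_rfl hy).2.1
  have a' : C1 / log 2 ≤ 2 * C1 := by rw [div_le_iff₀ (by linarith)]; nlinarith
  have b := (h2 2 y le_rfl hy).1
  have b' : C2 / (log 2)^2 ≤ 4 * C2 := by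
    rw [div_le_iff₀ (by positivity)]
    have : 1 ≤ 4 * (log 2)^2 := by nlinarith
    nlinarith
  rw [Real.log_div (by linarith) (by norm_num)] at a
  rw [Real.log_div (by linarith) (by linarith)] at b
  have e : ∑ n ∈ Finset.Icc 0 ⌊y⌋₊, lp 2 n * (1/n) = ∑ p ∈ Pf y, log p / (p:ℝ) - ∑ p ∈ Pf 2, log p / (p:ℝ) := by
    rw [Pf_split _ (by norm_num : (0:ℝ) ≤ 2) hy, add_sub_cancel_left]
    apply Finset.sum_congr rfl
    intro n _
    unfold lp
    split_ifs with hn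
    · ring
    · simp
  rw [e] at a
  have ll : log (log 2) ≤ 0 := Real.log_nonpos (by linarith) (by linarith)
  have d : ∑ p ∈ Pf y, log p / ((p:ℝ) - 1) - ∑ p ∈ Pf y, log p / (p:ℝ) ≤ K := by
    rw [← Finset.sum_sub_distrib]
    refine le_trans (Finset.sum_le_sum ?_) (hs.sum_le_tsum (Pf y) (fun n _ => by positivity))
    intro p hp
    have hp2 := ((mem_Pf (by linarith)).mp hp).1.two_le
    have h2 : (2:ℝ) ≤ p := by exact_mod_cast hp2
    have hlog : log (p:ℝ) ≤ 2 * (p:ℝ)^(1/2:ℝ) := by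
      have := Real.log_le_rpow_div (by linarith : 0 ≤ (p:ℝ)) (by norm_num : (0:ℝ) < 1/2)
      linarith
    have e1 : log p / ((p:ℝ) - 1) - log p / (p:ℝ) = log p / ((p-1)*p) := by
      have : (p:ℝ) - 1 ≠ 0 := by linarith
      have : (p:ℝ) ≠ 0 := by linarith
      field_simp
      ring
    rw [e1]
    have e2 : (p:ℝ)^2 = (p:ℝ)^(1/2:ℝ) * (p:ℝ)^(3/2:ℝ) := by
      rw [← Real.rpow_add (by linarith)]; norm_num
    have hp3 : 0 < (p:ℝ)^(3/2:ℝ) := by positivity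
    rw [mul_one_div, div_le_div_iff₀ (by nlinarith) hp3]
    nlinarith [mul_le_mul_of_nonneg_right hlog hp3.le]
  have d' : 0 ≤ ∑ p ∈ Pf y, log p / ((p:ℝ) - 1) - ∑ p ∈ Pf y, log p / (p:ℝ) := by
    rw [← Finset.sum_sub_distrib]
    apply Finset.sum_nonneg
    intro p hp
    have hp2 := ((mem_Pf (by linarith)).mp hp).1.two_le
    have h2 : (2:ℝ) ≤ p := by exact_mod_cast hp2
    rw [sub_nonneg]
    have := Real.log_nonneg (by linarith : (1:ℝ) ≤ p)
    gcongr <;> linarith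
  rw [abs_le] at a b ⊢
  refine ⟨⟨by linarith, by linarith⟩, by linarith, by linarith⟩

end RD

open Real MeasureTheory

namespace RD

lemma int_log_exp : IntegrableOn (fun w : ℝ => log w * rexp (-w)) (Set.Ioi 0) ∧
    ∫ w in Set.Ioi (0:ℝ), log w * rexp (-w) = -eulerMascheroniConstant := by
  have h1 := Complex.hasDerivAt_GammaIntegral (s := 1) (by simp)
  have h2 : HasDerivAt Complex.GammaIntegral (-(eulerMascheroniConstant:ℂ)) 1 := by
    apply Complex.hasDerivAt_Gamma_one.congr_of_eventuallyEq
    have : IsOpen {s : ℂ | 0 < s.re} := Complex.continuous_re.isOpen_preimage _ isOpen_Ioi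
    filter_upwards [this.mem_nhds (by simp : (1:ℂ) ∈ {s : ℂ | 0 < s.re})] with a ha
    exact (Complex.Gamma_eq_integral ha).symm
  have h3 := h1.unique h2
  have h4 : ∫ w in Set.Ioi (0:ℝ), log w * rexp (-w) = -eulerMascheroniConstant := by
    have : ((∫ w in Set.Ioi (0:ℝ), log w * rexp (-w) : ℝ) : ℂ) = ((-eulerMascheroniConstant : ℝ) : ℂ) := by
      rw [Complex.ofReal_neg, ← h3, ← integral_complex_ofReal]
      congr 1
      ext w
      simp
    exact_mod_cast this
  refine ⟨?_, h4⟩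
  by_contra h
  have h5 := integral_undef h
  rw [h5] at h4
  have := Real.one_half_lt_eulerMascheroniConstant
  linarith

lemma int_delta {δ : ℝ} (hδ : 0 < δ) : IntegrableOn (fun s : ℝ => δ * rexp (-(δ*s))) (Set.Ioi 0) ∧
    ∫ s in Set.Ioi (0:ℝ), δ * rexp (-(δ*s)) = 1 ∧
    IntegrableOn (fun s : ℝ => δ * rexp (-(δ*s)) * log s) (Set.Ioi 0) ∧
    ∫ s in Set.Ioi (0:ℝ), δ * rexp (-(δ*s)) * log s = -eulerMascheroniConstant - log δ := by
  obtain ⟨a1, a2⟩ := int_log_exp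
  have b1 : IntegrableOn (fun s : ℝ => δ * rexp (-(δ*s))) (Set.Ioi 0) := by
    have := (integrableOn_Ioi_comp_mul_left_iff (fun w : ℝ => rexp (-w)) 0 hδ).mpr
      (by simpa using integrableOn_exp_neg_Ioi 0)
    exact this.const_mul δ
  have b2 : ∫ s in Set.Ioi (0:ℝ), δ * rexp (-(δ*s)) = 1 := by
    rw [integral_const_mul]
    have := integral_comp_mul_left_Ioi' (fun w : ℝ => rexp (-w)) 0 hδ
    rw [mul_zero, integral_exp_neg_Ioi_zero] at this
    simpa using this
  have c1 : IntegrableOn (fun s : ℝ => δ * (log (δ*s) * rexp (-(δ*s)))) (Set.Ioi 0) := by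
    have := (integrableOn_Ioi_comp_mul_left_iff (fun w : ℝ => log w * rexp (-w)) 0 hδ).mpr
      (by simpa using a1)
    exact this.const_mul δ
  have c2 : ∫ s in Set.Ioi (0:ℝ), δ * (log (δ*s) * rexp (-(δ*s))) = -eulerMascheroniConstant := by
    rw [integral_const_mul]
    have := integral_comp_mul_left_Ioi' (fun w : ℝ => log w * rexp (-w)) 0 hδ
    simpa [a2] using this
  have e : ∀ s ∈ Set.Ioi (0:ℝ), δ * (log (δ*s) * rexp (-(δ*s))) - δ * rexp (-(δ*s)) * log δ =
      δ * rexp (-(δ*s)) * log s := by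
    intro s hs
    rw [Real.log_mul hδ.ne' (ne_of_gt hs)]
    ring
  refine ⟨b1, b2, ?_, ?_⟩
  · exact (c1.sub (b1.mul_const (log δ))).congr_fun e measurableSet_Ioi
  · rw [← setIntegral_congr_fun measurableSet_Ioi e, integral_sub c1 (b1.mul_const (log δ)), c2,
      integral_mul_const, b2]
    ring

/-- -log(1-1/p) on primes -/
noncomputable def gp (n : ℕ) : ℝ := if n.Prime then -log (1 - 1/(n:ℝ)) else 0

lemma gp_bounds (n : ℕ) : 0 ≤ gp n ∧ gp n ≤ 2 * (1/(n:ℝ)) := by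
  unfold gp
  split_ifs with h
  · have h2 : (2:ℝ) ≤ n := by exact_mod_cast h.two_le
    obtain ⟨a, b⟩ := neg_log_bound h.two_le
    refine ⟨le_trans (by positivity) a, b.trans ?_⟩
    have : 1/((n:ℝ)*(n-1)) ≤ 1/n := by
      apply one_div_le_one_div_of_le (by linarith); nlinarith
    linarith
  · exact ⟨le_rfl, by positivity⟩

lemma GG_tsum (s : ℝ) : GG (rexp s) = ∑' n : ℕ, gp n * (if log n ≤ s then 1 else 0) := by
  rw [tsum_eq_sum (s := Finset.range (⌊rexp s⌋₊+1))]
  · unfold GG Pf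
    rw [Finset.sum_filter]
    apply Finset.sum_congr rfl
    intro n hn
    unfold gp
    split_ifs with h1 h2 h2
    · ring
    · exfalso; apply h2
      rw [Finset.mem_range, Nat.lt_succ_iff, Nat.le_floor_iff (Real.exp_pos s).le] at hn
      rw [Real.log_le_iff_le_exp (by exact_mod_cast h1.pos)]
      exact hn
    · ring
    · ring
  · intro n hn
    by_cases h1 : n.Prime
    · rw [if_neg, mul_zero]
      intro h2
      apply hn
      rw [Finset.mem_range, Nat.lt_succ_iff, Nat.le_floor_iff (Real.exp_pos s).le]
      rwa [Real.log_le_iff_le_exp (by exact_mod_cast h1.pos)] at h2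
    · simp [gp, h1]

lemma gp_summable {δ : ℝ} (hδ : 0 < δ) : Summable (fun n : ℕ => gp n * rexp (-(δ * log n))) := by
  have h := (Real.summable_one_div_nat_rpow.mpr (by linarith : 1 < 1 + δ)).mul_left 2
  apply Summable.of_nonneg_of_le (fun n => mul_nonneg (gp_bounds n).1 (Real.exp_pos _).le) _ h
  intro n
  by_cases hn : n.Prime
  · have h0 : (0:ℝ) < n := by exact_mod_cast hn.pos
    have : (n:ℝ)^(1+δ) = n * rexp (δ * log n) := by
      rw [Real.rpow_add h0, Real.rpow_one, Real.rpow_def_of_pos h0, mul_comm (log _)]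
    rw [this, Real.exp_neg]
    have := (gp_bounds n).2
    calc _ ≤ 2 * (1/(n:ℝ)) * (rexp (δ * log n))⁻¹ := by gcongr
      _ = _ := by field_simp
  · simp only [gp, hn, if_false, zero_mul]; positivity

lemma gp_integral {δ : ℝ} (hδ : 0 < δ) : HasSum (fun n : ℕ => gp n * rexp (-(δ * log n)))
    (∫ s in Set.Ioi (0:ℝ), δ * rexp (-(δ*s)) * GG (rexp s)) := by
  obtain ⟨b1, b2, -, -⟩ := int_delta hδ
  let F : ℕ → ℝ → ℝ := fun n s => gp n * (Set.Ici (log n)).indicator (fun s => δ * rexp (-(δ*s))) s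
  have hFi : ∀ n, IntegrableOn (F n) (Set.Ioi 0) := by
    intro n
    exact (b1.indicator measurableSet_Ici).const_mul _
  have hF : ∀ n, ∫ s in Set.Ioi (0:ℝ), F n s = gp n * rexp (-(δ * log n)) := by
    intro n
    simp only [F]
    rw [integral_const_mul]
    by_cases hn : n.Prime
    · congr 1
      rw [setIntegral_indicator measurableSet_Ici]
      have hl : 0 < log n := Real.log_pos (by exact_mod_cast hn.one_lt)
      have : Set.Ioi (0:ℝ) ∩ Set.Ici (log n) = Set.Ici (log n) := by
        ext s; simp; intro h; linarith
      rw [this, integral_Ici_eq_integral_Ioi, integral_const_mul]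
      have := integral_exp_mul_Ioi (by linarith : -δ < 0) (log n)
      simp only [neg_mul] at this
      rw [this]
      field_simp
    · simp [gp, hn]
  have hFn : ∀ n s, 0 ≤ F n s := by
    intro n s
    apply mul_nonneg (gp_bounds n).1
    apply Set.indicator_nonneg
    intro s _; positivity
  have hsum : Summable fun n => ∫ s in Set.Ioi (0:ℝ), ‖F n s‖ := by
    simp_rw [Real.norm_of_nonneg (hFn _ _), hF]
    exact gp_summable hδ
  have key := hasSum_integral_of_summable_integral_norm hFi hsum
  simp_rw [hF] at key
  have e : (∫ s in Set.Ioi (0:ℝ), δ * rexp (-(δ*s)) * GG (rexp s)) = ∫ s in Set.Ioi (0:ℝ), ∑' n, F n s := by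
   congr 1
   ext s
   rw [GG_tsum, ← tsum_mul_left]
   congr 1
   ext n
   simp only [F, Set.indicator_apply, Set.mem_Ici]
   split_ifs <;> ring
  rw [e]
  exact key

lemma gp_asymp {ℓ C : ℝ} (hC : 0 < C)
    (h : ∀ y : ℝ, 2 ≤ y → |GG y - log (log y) - ℓ| ≤ C / (log y)^2) :
    ∃ K : ℝ, ∀ δ : ℝ, 0 < δ →
    |∑' n : ℕ, gp n * rexp (-(δ * log n)) - (ℓ - eulerMascheroniConstant - log δ)| ≤ K * δ := by
  let B : ℝ → ℝ := fun s => (Set.Ioo 0 (log 2)).indicator (fun s => |log s| + |ℓ|) s +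
    (Set.Ici (log 2)).indicator (fun s => C * s^(-2:ℝ)) s
  have l2 := half_lt_log (le_refl (2:ℝ))
  have hB : Integrable B := by
    apply Integrable.add
    · rw [integrable_indicator_iff measurableSet_Ioo]
      refine IntegrableOn.mono_set ?_ Set.Ioo_subset_Ioc_self
      have : IntervalIntegrable log volume 0 (log 2) := intervalIntegral.intervalIntegrable_log'
      rw [intervalIntegrable_iff_integrableOn_Ioc_of_le (by linarith)] at this
      exact this.abs.add (by simp)
    · rw [integrable_indicator_iff measurableSet_Ici, integrableOn_Ici_iff_integrableOn_Ioi]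
      exact (integrableOn_Ioi_rpow_of_lt (by norm_num) (by linarith)).const_mul C
  have hrB : ∀ s ∈ Set.Ioi (0:ℝ), |GG (rexp s) - log s - ℓ| ≤ B s := by
    intro s hs
    have hs : 0 < s := hs
    by_cases h2 : s < log 2
    · have hG : GG (rexp s) = 0 := by
        have : ⌊rexp s⌋₊ ≤ 1 := by
          rw [← Nat.lt_succ_iff, Nat.floor_lt (Real.exp_pos s).le]
          push_cast
          norm_num
          rwa [Real.lt_log_iff_exp_lt (by norm_num)] at h2
        unfold GG
        apply Finset.sum_eq_zero
        intro p hp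
        unfold Pf at hp
        simp at hp
        have := hp.2.two_le
        omega
      simp only [B, hG]
      rw [Set.indicator_of_mem (by exact ⟨hs, h2⟩), Set.indicator_of_notMem (by simp; exact h2), add_zero]
      rw [zero_sub]
      calc _ ≤ |(-log s)| + |ℓ| := abs_sub _ _
        _ = _ := by rw [abs_neg]
    · have h2 : log 2 ≤ s := not_lt.mp h2
      have he : 2 ≤ rexp s := by
        rwa [Real.log_le_iff_le_exp (by norm_num)] at h2
      have := h _ he
      rw [Real.log_exp] at this
      simp only [B]
      rw [Set.indicator_of_notMem (by simp; intro _; exact h2), Set.indicator_of_mem (by exact h2), zero_add]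
      rw [Real.rpow_neg hs.le, ← div_eq_mul_inv]
      norm_cast at this ⊢
  refine ⟨∫ s in Set.Ioi (0:ℝ), B s, fun δ hδ => ?_⟩
  obtain ⟨b1, b2, b3, b4⟩ := int_delta hδ
  rw [(gp_integral hδ).tsum_eq]
  have hmG : Measurable (fun s => GG (rexp s)) := by
    apply Monotone.measurable
    intro s t hst
    simp only [GG]
    apply Finset.sum_le_sum_of_subset_of_nonneg
    · intro p hp
      rw [mem_Pf (Real.exp_pos _).le] at hp ⊢
      exact ⟨hp.1, hp.2.trans (Real.exp_le_exp.mpr hst)⟩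
    · intro p hp _
      have hp := ((mem_Pf (Real.exp_pos _).le).mp hp).1
      exact le_trans (by positivity) (neg_log_bound hp.two_le).1
  have hbd : ∀ s ∈ Set.Ioi (0:ℝ), ‖δ * rexp (-(δ*s)) * (GG (rexp s) - log s - ℓ)‖ ≤ δ * B s := by
    intro s hs
    have hs' : 0 < s := hs
    have h1 : rexp (-(δ*s)) ≤ 1 := by rw [Real.exp_le_one_iff]; have := mul_pos hδ hs'; linarith
    have h2 := hrB s hs
    rw [norm_mul, Real.norm_eq_abs, Real.norm_eq_abs, abs_of_pos (by positivity)]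
    have : 0 ≤ B s := (abs_nonneg _).trans h2
    calc _ ≤ δ * 1 * B s := by gcongr
      _ = _ := by ring
  have hr : IntegrableOn (fun s => δ * rexp (-(δ*s)) * (GG (rexp s) - log s - ℓ)) (Set.Ioi 0) := by
    apply Integrable.mono' (hB.integrableOn.const_mul δ)
    · apply Measurable.aestronglyMeasurable
      apply Measurable.mul (by fun_prop)
      exact (hmG.sub Real.measurable_log).sub_const ℓ
    · rw [ae_restrict_iff' measurableSet_Ioi]
      exact Filter.Eventually.of_forall hbd
  have e : ∫ s in Set.Ioi (0:ℝ), δ * rexp (-(δ*s)) * GG (rexp s) =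
      (∫ s in Set.Ioi (0:ℝ), δ * rexp (-(δ*s)) * (GG (rexp s) - log s - ℓ)) +
        (-eulerMascheroniConstant - log δ) + 1 * ℓ := by
    have hrb : IntegrableOn (fun s => δ * rexp (-(δ*s)) * (GG (rexp s) - log s - ℓ) +
      δ * rexp (-(δ*s)) * log s) (Set.Ioi 0) := hr.add b3
    rw [← b4, ← b2, ← integral_mul_const, ← integral_add hr b3, ← integral_add hrb (b1.mul_const ℓ)]
    congr 1
    ext s
    ring
  have e2 : (∫ s in Set.Ioi (0:ℝ), δ * rexp (-(δ*s)) * GG (rexp s)) - (ℓ - eulerMascheroniConstant - log δ)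
        = ∫ s in Set.Ioi (0:ℝ), δ * rexp (-(δ*s)) * (GG (rexp s) - log s - ℓ) := by
    rw [e]; ring
  have e3 : ∫ s in Set.Ioi (0:ℝ), δ * B s = (∫ s in Set.Ioi (0:ℝ), B s) * δ := by
    rw [integral_const_mul, mul_comm]
  rw [e2, ← e3, ← Real.norm_eq_abs]
  apply norm_integral_le_of_norm_le (hB.integrableOn.const_mul δ)
  rw [ae_restrict_iff' measurableSet_Ioi]
  exact Filter.Eventually.of_forall hbd

/-- Euler factor logs of zeta(1+δ) -/
noncomputable def zt (δ : ℝ) (n : ℕ) : ℝ := if n.Prime then -log (1 - 1/(n:ℝ) * rexp (-(δ * log n))) else 0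

lemma log_two_sided {t : ℝ} (h0 : 0 ≤ t) (h1 : t ≤ 1/2) : t ≤ -log (1 - t) ∧ -log (1-t) ≤ t + 2*t^2 := by
  have hp : 0 < 1 - t := by linarith
  constructor
  · have := Real.log_le_sub_one_of_pos hp; linarith
  · have := Real.one_sub_inv_le_log_of_pos hp
    have : (1-t)⁻¹ ≤ 1 + t + 2*t^2 := by
      rw [inv_le_iff_one_le_mul₀ hp]
      nlinarith [sq_nonneg t, mul_nonneg (sq_nonneg t) (by linarith : 0 ≤ 1 - 2*t)]
    linarith

lemma zt_diff {δ : ℝ} (hδ : 0 ≤ δ) (n : ℕ) : |zt δ n - gp n * rexp (-(δ * log n))| ≤ 2 * (1/(n:ℝ)^2) := by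
  unfold zt gp
  split_ifs with h
  · have h2 : (2:ℝ) ≤ n := by exact_mod_cast h.two_le
    have hw : rexp (-(δ * log n)) ≤ 1 := by
      rw [Real.exp_le_one_iff]
      have := mul_nonneg hδ (Real.log_natCast_nonneg n)
      linarith
    have hw0 := (Real.exp_pos (-(δ * log n))).le
    set w := rexp (-(δ * log n))
    set a := 1/(n:ℝ) with ha
    have ha0 : 0 ≤ a := by positivity
    have ha1 : a ≤ 1/2 := one_div_le_one_div_of_le (by norm_num) h2
    obtain ⟨p1, p2⟩ := log_two_sided ha0 ha1
    obtain ⟨q1, q2⟩ := log_two_sided (t := a * w) (by positivity) (by nlinarith)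
    have e : 1/(n:ℝ)^2 = a^2 := by rw [ha]; ring
    rw [e, abs_le]
    have r1 : (a*w)^2 ≤ a^2 := by
      rw [mul_pow]; have : w^2 ≤ 1 := by nlinarith
      nlinarith [sq_nonneg a]
    have r2 := mul_le_mul_of_nonneg_right p1 hw0
    have r3 := mul_le_mul_of_nonneg_right p2 hw0
    have r4 : 2 * a^2 * w ≤ 2 * a^2 := by nlinarith [sq_nonneg a]
    constructor <;> nlinarith
  · simp

lemma zt_summable {δ : ℝ} (hδ : 0 < δ) : Summable (zt δ) := by
  have h1 := gp_summable hδ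
  have h2 : Summable (fun n : ℕ => zt δ n - gp n * rexp (-(δ * log n))) := by
    apply Summable.of_norm_bounded (g := fun n : ℕ => 2 * (1/(n:ℝ)^2))
    · exact (Real.summable_one_div_nat_pow.mpr (by norm_num)).mul_left 2
    · intro n; exact zt_diff hδ.le n
  simpa using h2.add h1

lemma corr_limit : Filter.Tendsto (fun δ : ℝ => ∑' n, zt δ n - ∑' n : ℕ, gp n * rexp (-(δ * log n)))
    (nhdsWithin 0 (Set.Ioi 0)) (nhds 0) := by
  have key : Filter.Tendsto (fun δ : ℝ => ∑' n : ℕ, (zt δ n - gp n * rexp (-(δ * log n))))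
      (nhdsWithin 0 (Set.Ioi 0)) (nhds (∑' n : ℕ, (0:ℝ))) := by
    apply tendsto_tsum_of_dominated_convergence (bound := fun n : ℕ => 2 * (1/(n:ℝ)^2))
    · exact (Real.summable_one_div_nat_pow.mpr (by norm_num)).mul_left 2
    · intro n
      apply tendsto_nhdsWithin_of_tendsto_nhds
      have hc : ContinuousAt (fun δ : ℝ => zt δ n - gp n * rexp (-(δ * log n))) 0 := by
        apply ContinuousAt.sub
        · unfold zt
          split_ifs with h
          · have h2 : (2:ℝ) ≤ n := by exact_mod_cast h.two_le
            have : 1/(n:ℝ) ≤ 1/2 := one_div_le_one_div_of_le (by norm_num) h2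
            apply ContinuousAt.neg
            apply ContinuousAt.log (by fun_prop)
            simp only [zero_mul, neg_zero, Real.exp_zero, mul_one]
            linarith
          · exact continuousAt_const
        · fun_prop
      have := hc.tendsto
      simpa [zt, gp] using this
    · filter_upwards [self_mem_nhdsWithin] with δ hδ n
      exact zt_diff (le_of_lt hδ) n
  rw [tsum_zero] at key
  apply key.congr'
  filter_upwards [self_mem_nhdsWithin] with δ hδ
  exact (zt_summable hδ).tsum_sub (gp_summable hδ)

lemma zt_zeta {δ : ℝ} (hδ : 0 < δ) : riemannZeta ((1 + δ : ℝ) : ℂ) = ((rexp (∑' n, zt δ n) : ℝ) : ℂ) := by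
  rw [← riemannZeta_eulerProduct_exp_log (by simp [hδ]), Complex.ofReal_exp, Complex.ofReal_tsum]
  congr 1
  have : ∑' p : Nat.Primes, -Complex.log (1 - (p:ℂ) ^ (-((1 + δ : ℝ) : ℂ))) =
      ∑' p : Nat.Primes, (fun n : ℕ => ((zt δ n : ℝ) : ℂ)) p := by
    congr 1
    ext p
    have hp := p.2
    have h2 : (2:ℝ) ≤ (p:ℕ) := by exact_mod_cast hp.two_le
    have h0 : (0:ℝ) < (p:ℕ) := by linarith
    simp only [zt, hp, if_true]
    have e : ((p:ℕ):ℂ) ^ (-((1 + δ : ℝ) : ℂ)) = ((1/((p:ℕ):ℝ) * rexp (-(δ * log (p:ℕ))) : ℝ) : ℂ) := by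
      rw [← Complex.ofReal_natCast, ← Complex.ofReal_neg, ← Complex.ofReal_cpow h0.le]
      congr 1
      rw [neg_add, Real.rpow_add h0, Real.rpow_neg_one, Real.rpow_def_of_pos h0, one_div]
      congr 2; ring
    rw [e]
    have hw : rexp (-(δ * log (p:ℕ))) ≤ 1 := by
      rw [Real.exp_le_one_iff]
      have := mul_nonneg hδ.le (Real.log_natCast_nonneg (p:ℕ))
      linarith
    have ha1 : 1/((p:ℕ):ℝ) ≤ 1/2 := one_div_le_one_div_of_le (by norm_num) h2
    have ha0 : 0 ≤ 1/((p:ℕ):ℝ) := by positivity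
    rw [Complex.ofReal_neg, Complex.ofReal_log, Complex.ofReal_sub, Complex.ofReal_one]
    nlinarith
  rw [this]
  have h := tsum_subtype {p : ℕ | p.Prime} (fun n : ℕ => ((zt δ n : ℝ) : ℂ))
  refine Eq.trans h ?_
  congr 1
  ext n
  by_cases hn : n.Prime
  · rw [Set.indicator_of_mem (by exact hn)]
  · rw [Set.indicator_of_notMem (by exact hn)]; simp [zt, hn]

lemma zt_limit : Filter.Tendsto (fun δ : ℝ => ∑' n, zt δ n + log δ)
    (nhdsWithin 0 (Set.Ioi 0)) (nhds 0) := by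
  have h1 := riemannZeta_residue_one
  have h2 : Filter.Tendsto (fun δ : ℝ => ((1 + δ : ℝ) : ℂ)) (nhdsWithin 0 (Set.Ioi 0)) (nhdsWithin 1 {1}ᶜ) := by
    apply tendsto_nhdsWithin_of_tendsto_nhds_of_eventually_within
    · apply tendsto_nhdsWithin_of_tendsto_nhds
      have : Continuous (fun δ : ℝ => ((1 + δ : ℝ) : ℂ)) := by fun_prop
      simpa using this.tendsto 0
    · filter_upwards [self_mem_nhdsWithin] with δ hδ
      have : δ ≠ 0 := ne_of_gt hδ
      simp [this]
  have h3 := (Complex.continuous_re.tendsto 1).comp (h1.comp h2)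
  have h4 : Filter.Tendsto (fun δ : ℝ => δ * rexp (∑' n, zt δ n)) (nhdsWithin 0 (Set.Ioi 0)) (nhds 1) := by
    rw [Complex.one_re] at h3
    apply h3.congr'
    filter_upwards [self_mem_nhdsWithin] with δ hδ
    simp only [Function.comp]
    rw [zt_zeta hδ]
    have : (((1 + δ : ℝ) : ℂ) - 1) * ((rexp (∑' n, zt δ n) : ℝ) : ℂ) = ((δ * rexp (∑' n, zt δ n) : ℝ) : ℂ) := by
      push_cast; ring
    rw [this, Complex.ofReal_re]
  have h5 := (Real.continuousAt_log one_ne_zero).tendsto.comp h4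
  rw [Real.log_one] at h5
  apply h5.congr'
  filter_upwards [self_mem_nhdsWithin] with δ hδ
  have hδ' : (0:ℝ) < δ := hδ
  simp only [Function.comp]
  rw [Real.log_mul hδ'.ne' (Real.exp_pos _).ne', Real.log_exp, add_comm]

lemma GG_mertens : ∃ C : ℝ, 0 < C ∧ ∀ y : ℝ, 2 ≤ y →
    |GG y - log (log y) - eulerMascheroniConstant| ≤ C / (log y)^2 := by
  obtain ⟨ℓ, C, hC, h⟩ := GG_limit
  obtain ⟨K, hK⟩ := gp_asymp hC h
  have h1 := zt_limit.sub corr_limit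
  have h2 : Filter.Tendsto (fun δ : ℝ => K * δ) (nhdsWithin 0 (Set.Ioi 0)) (nhds 0) := by
    apply tendsto_nhdsWithin_of_tendsto_nhds
    have : Continuous (fun δ : ℝ => K * δ) := by fun_prop
    simpa using this.tendsto 0
  have h3 : Filter.Tendsto (fun δ : ℝ => ∑' n : ℕ, gp n * rexp (-(δ * log n)) -
      (ℓ - eulerMascheroniConstant - log δ)) (nhdsWithin 0 (Set.Ioi 0)) (nhds 0) := by
    apply squeeze_zero_norm' _ h2
    filter_upwards [self_mem_nhdsWithin] with δ hδ
    exact hK δ hδ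
  have h4 := h1.sub h3
  have h5 : Filter.Tendsto (fun _ : ℝ => ℓ - eulerMascheroniConstant) (nhdsWithin (0:ℝ) (Set.Ioi 0)) (nhds (0 - 0 - 0)) := by
    apply h4.congr
    intro δ; ring
  have h6 := tendsto_nhds_unique h5 tendsto_const_nhds
  have : ℓ = eulerMascheroniConstant := by linarith
  rw [this] at h
  exact ⟨C, hC, h⟩

/-- M3 -/
lemma V_mertens : ∃ C : ℝ, 0 < C ∧ ∀ y : ℝ, 2 ≤ y →
    |primeProd y * log y - rexp (-eulerMascheroniConstant)| ≤ C / (log y)^2 := by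
  obtain ⟨C, hC, h⟩ := GG_mertens
  refine ⟨rexp (4*C) * C, by positivity, fun y hy => ?_⟩
  have hl := half_lt_log hy
  have h1 := h y hy
  rw [primeProd_eq (by linarith)]
  have e : rexp (-GG y) * log y = rexp (-eulerMascheroniConstant) *
      rexp (-(GG y - log (log y) - eulerMascheroniConstant)) := by
    rw [← Real.exp_add]
    have : -eulerMascheroniConstant + -(GG y - log (log y) - eulerMascheroniConstant) = -GG y + log (log y) := by ring
    rw [this, Real.exp_add, Real.exp_log (by linarith)]
  set r := GG y - log (log y) - eulerMascheroniConstant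
  have hr4 : |r| ≤ 4 * C := by
    refine h1.trans ?_
    rw [div_le_iff₀ (by positivity)]
    have : 1 ≤ 4 * (log y)^2 := by nlinarith
    nlinarith
  have hg : rexp (-eulerMascheroniConstant) ≤ 1 := by
    rw [Real.exp_le_one_iff]
    have := Real.one_half_lt_eulerMascheroniConstant; linarith
  have hexp : |rexp (-r) - 1| ≤ rexp (4*C) * |r| := by
    have a1 := Real.add_one_le_exp (-r)
    have a2 := Real.add_one_le_exp r
    have a3 : rexp (-r) * rexp r = 1 := by rw [← Real.exp_add]; simp
    have a4 : rexp (-r) ≤ rexp (4*C) := Real.exp_le_exp.mpr ((neg_le_abs r).trans hr4)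
    have a5 : 1 ≤ rexp (4*C) := Real.one_le_exp (by positivity)
    have a6 := Real.exp_pos (-r)
    rw [abs_le]
    rcases le_total 0 r with hr | hr
    · rw [abs_of_nonneg hr]; constructor <;> nlinarith
    · rw [abs_of_nonpos hr]; constructor <;> nlinarith
  have e2 : rexp (-GG y) * log y - rexp (-eulerMascheroniConstant) =
      rexp (-eulerMascheroniConstant) * (rexp (-r) - 1) := by rw [e]; ring
  rw [e2, abs_mul, abs_of_pos (Real.exp_pos _)]
  calc _ ≤ 1 * (rexp (4*C) * (C/(log y)^2)) := by gcongr; exact hexp.trans (by gcongr)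
    _ = _ := by ring

end RD

open Real MeasureTheory

namespace RD

/-- divisor count as a real -/
noncomputable def tau (n : ℕ) : ℝ := (n.divisors.card : ℝ)

lemma tau_nonneg (n : ℕ) : 0 ≤ tau n := by unfold tau; positivity

lemma sum_div_hyper (N : ℕ) :
    ∑ n ∈ Finset.Icc 1 N, (n.divisors.card : ℤ) + (Nat.sqrt N : ℤ) ^ 2
      = 2 * ∑ a ∈ Finset.Icc 1 (Nat.sqrt N), ((N / a : ℕ) : ℤ) := by
  set k := Nat.sqrt N with hk
  have hk1 : k * k ≤ N := Nat.sqrt_le N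
  have hk2 : N < (k + 1) * (k + 1) := Nat.lt_succ_sqrt N
  have hkN : k ≤ N := Nat.sqrt_le_self N
  have hd : ∀ a ∈ Finset.Icc 1 N, ((N / a : ℕ) : ℤ) = ∑ b ∈ Finset.Icc 1 N, if a * b ≤ N then (1:ℤ) else 0 := by
    intro a ha
    rw [Finset.sum_boole]
    have : (Finset.Icc 1 N).filter (fun b => a * b ≤ N) = Finset.Icc 1 (N / a) := by
      ext b
      simp only [Finset.mem_filter, Finset.mem_Icc] at ha ⊢
      rw [Nat.le_div_iff_mul_le (by omega), mul_comm b a]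
      constructor
      · tauto
      · rintro ⟨h1, h2⟩
        refine ⟨⟨h1, le_trans ?_ h2⟩, h2⟩
        exact Nat.le_mul_of_pos_left b (by omega)
    rw [this]; simp
  have h1 : ∑ n ∈ Finset.Icc 1 N, (n.divisors.card : ℤ) = ∑ a ∈ Finset.Icc 1 N, ((N / a : ℕ) : ℤ) := by
    have := ArithmeticFunction.sum_Ioc_sigma0_eq_sum_div N
    simp only [ArithmeticFunction.sigma_zero_apply] at this
    rw [show Finset.Ioc 0 N = Finset.Icc 1 N from by ext; simp; omega] at this
    exact_mod_cast this
  rw [h1, Finset.sum_congr rfl hd]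
  have hsub : ∀ g : ℕ → ℤ, ∑ a ∈ Finset.Icc 1 N, (if a ≤ k then g a else 0) = ∑ a ∈ Finset.Icc 1 k, g a := by
    intro g
    rw [← Finset.sum_filter]
    congr 1
    ext a; simp; omega
  have hA : ∑ a ∈ Finset.Icc 1 N, ∑ b ∈ Finset.Icc 1 N, (if a ≤ k then (if a * b ≤ N then (1:ℤ) else 0) else 0)
      = ∑ a ∈ Finset.Icc 1 k, ((N / a : ℕ) : ℤ) := by
    rw [← hsub]
    refine Finset.sum_congr rfl fun a ha => ?_
    split_ifs
    · rw [hd a ha]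
    · simp
  have hB : ∑ a ∈ Finset.Icc 1 N, ∑ b ∈ Finset.Icc 1 N, (if b ≤ k then (if a * b ≤ N then (1:ℤ) else 0) else 0)
      = ∑ a ∈ Finset.Icc 1 k, ((N / a : ℕ) : ℤ) := by
    rw [Finset.sum_comm, ← hA]
    simp only [mul_comm]
  have hC : ∑ a ∈ Finset.Icc 1 N, ∑ b ∈ Finset.Icc 1 N, (if a ≤ k then (if b ≤ k then (1:ℤ) else 0) else 0)
      = (k:ℤ)^2 := by
    have : ∀ a : ℕ, ∑ b ∈ Finset.Icc 1 N, (if a ≤ k then (if b ≤ k then (1:ℤ) else 0) else 0) = if a ≤ k then (k:ℤ) else 0 := by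
      intro a
      split_ifs
      · rw [hsub]; simp
      · simp
    simp only [this]
    rw [hsub]; simp; ring
  rw [two_mul]
  nth_rewrite 1 [← hA]
  rw [← hB, ← hC]
  simp only [← Finset.sum_add_distrib]
  refine Finset.sum_congr rfl fun a ha => Finset.sum_congr rfl fun b hb => ?_
  by_cases h1 : a ≤ k <;> by_cases h2 : b ≤ k <;> simp [h1, h2]
  · exact (Nat.mul_le_mul h1 h2).trans hk1
  · push Not at h1 h2
    have := Nat.mul_le_mul h1 h2
    simp only [Nat.succ_eq_add_one] at this
    omega

lemma harm_bound (k : ℕ) (hk : 1 ≤ k) :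
    0 ≤ ∑ a ∈ Finset.Icc 1 k, (1 / (a:ℝ)) - log k - eulerMascheroniConstant ∧
    ∑ a ∈ Finset.Icc 1 k, (1 / (a:ℝ)) - log k - eulerMascheroniConstant ≤ 1 / k := by
  have h1 := eulerMascheroniSeq_lt_eulerMascheroniConstant k
  have h2 := eulerMascheroniConstant_lt_eulerMascheroniSeq' k
  have h3 : ((harmonic k : ℚ) : ℝ) = ∑ a ∈ Finset.Icc 1 k, (1 / (a:ℝ)) := by
    rw [harmonic_eq_sum_Icc]; push_cast; simp
  have hk0 : (0:ℝ) < k := by exact_mod_cast hk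
  rw [eulerMascheroniSeq, h3] at h1
  rw [eulerMascheroniSeq', if_neg (by omega), h3] at h2
  have h4 : log (k + 1) - log k ≤ 1 / k := by
    rw [← Real.log_div (by positivity) (by positivity)]
    have := Real.log_le_sub_one_of_pos (show (0:ℝ) < (k+1)/k by positivity)
    have e : ((k:ℝ)+1)/k - 1 = 1/k := by field_simp; ring
    linarith
  constructor <;> linarith

/-- κ -/
noncomputable def kap : ℝ := 2 * eulerMascheroniConstant - 1

lemma tau_sum : ∃ C > 0, ∀ z : ℝ, 1 ≤ z →
    |∑ n ∈ Finset.Icc 1 ⌊z⌋₊, tau n - z * (log z + kap)| ≤ C * √z := by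
  refine ⟨20, by norm_num, fun z hz => ?_⟩
  set N := ⌊z⌋₊ with hN
  have hN1 : 1 ≤ N := by rw [hN, Nat.one_le_floor_iff]; exact hz
  set k := Nat.sqrt N with hk
  have hk1 : 1 ≤ k := Nat.le_sqrt.2 (by simpa using hN1)
  have hk2 : (k:ℝ)^2 ≤ z := by
    have : ((k^2:ℕ):ℝ) ≤ N := by exact_mod_cast Nat.sqrt_le' N
    push_cast at this
    exact this.trans (Nat.floor_le (by linarith))
  have hk3 : z < ((k:ℝ)+1)^2 := by
    have h := Nat.lt_succ_sqrt' N
    have h' : ((N + 1 : ℕ):ℝ) ≤ ((k+1)^2:ℕ) := by exact_mod_cast h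
    push_cast at h'
    exact (Nat.lt_floor_add_one z).trans_le h'
  have hH := sum_div_hyper N
  have hH' : ∑ n ∈ Finset.Icc 1 N, tau n + (k:ℝ)^2 = 2 * ∑ a ∈ Finset.Icc 1 k, ((N / a : ℕ) : ℝ) := by
    unfold tau; exact_mod_cast hH
  have hk0 : (1:ℝ) ≤ k := by exact_mod_cast hk1
  set s := √z with hs
  have hss : s ^ 2 = z := Real.sq_sqrt (by linarith)
  have hs0 : 0 < s := Real.sqrt_pos.2 (by linarith)
  have hks : (k:ℝ) ≤ s := by apply Real.le_sqrt_of_sq_le; exact hk2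
  have hsk : s < k + 1 := by nlinarith
  obtain ⟨hb1, hb2⟩ := harm_bound k hk1
  set Hk := ∑ a ∈ Finset.Icc 1 k, (1 / (a:ℝ)) with hHk
  have hf1 : ∑ a ∈ Finset.Icc 1 k, ((N / a : ℕ) : ℝ) ≤ z * Hk := by
    rw [hHk, Finset.mul_sum]
    refine Finset.sum_le_sum fun a ha => ?_
    rw [hN, ← Nat.floor_div_natCast, mul_one_div]
    exact Nat.floor_le (by positivity)
  have hf2 : z * Hk - k ≤ ∑ a ∈ Finset.Icc 1 k, ((N / a : ℕ) : ℝ) := by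
    have : (k:ℝ) = ∑ a ∈ Finset.Icc 1 k, (1:ℝ) := by simp
    rw [this, hHk, Finset.mul_sum, ← Finset.sum_sub_distrib]
    refine Finset.sum_le_sum fun a ha => ?_
    rw [hN, ← Nat.floor_div_natCast, mul_one_div]
    linarith [Nat.lt_floor_add_one (z / (a:ℝ))]
  have hl : log z = 2 * log s := by rw [← hss, Real.log_pow]; norm_num
  have hl2 : log k ≤ log s := Real.log_le_log (by linarith) hks
  have hl3 : log s - log k ≤ 1 / k := by
    rw [← Real.log_div (by positivity) (by positivity)]
    have := Real.log_le_sub_one_of_pos (show (0:ℝ) < s/k by positivity)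
    have e : s/k - 1 ≤ 1/k := by rw [div_sub_one (by positivity)]; gcongr; linarith
    linarith
  have hzk : z * (1 / k) ≤ 2 * s := by
    rw [mul_one_div, div_le_iff₀ (by positivity), ← hss]
    nlinarith
  have hz0 : 0 ≤ z := by linarith
  have q1 : z * (Hk - log k - eulerMascheroniConstant) ≤ 2 * s := (mul_le_mul_of_nonneg_left hb2 hz0).trans hzk
  have q2 : z * (log s - log k) ≤ 2 * s := (mul_le_mul_of_nonneg_left hl3 hz0).trans hzk
  have q3 : 0 ≤ z * (Hk - log k - eulerMascheroniConstant) := mul_nonneg hz0 hb1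
  have q4 : 0 ≤ z * (log s - log k) := mul_nonneg hz0 (by linarith)
  rw [hl, kap, abs_le]
  constructor <;> nlinarith

/-- sieved sum -/
noncomputable def SP (P : Finset ℕ) (x : ℝ) : ℝ :=
  ∑ n ∈ Finset.Icc 1 ⌊x⌋₊, if (∀ p ∈ P, ¬ p ∣ n) then tau n else 0

lemma shift_sum (p : ℕ) (hp : 1 ≤ p) (x : ℝ) (f : ℕ → ℝ) :
    ∑ n ∈ Finset.Icc 1 ⌊x⌋₊, (if p ∣ n then f (n / p) else 0) = ∑ m ∈ Finset.Icc 1 ⌊x / p⌋₊, f m := by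
  rw [← Finset.sum_filter, Nat.floor_div_natCast]
  symm
  refine Finset.sum_nbij' (fun m => p * m) (fun n => n / p) ?_ ?_ ?_ ?_ ?_
  · intro m hm
    simp only [Finset.mem_Icc, Finset.mem_filter] at hm ⊢
    rw [Nat.le_div_iff_mul_le (by omega)] at hm
    refine ⟨⟨?_, by rw [mul_comm]; exact hm.2⟩, dvd_mul_right _ _⟩
    exact Nat.one_le_iff_ne_zero.2 (by have := hm.1; positivity)
  · intro n hn
    simp only [Finset.mem_Icc, Finset.mem_filter] at hn ⊢
    obtain ⟨⟨h1, h2⟩, c, rfl⟩ := hn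
    rw [Nat.mul_div_cancel_left _ (by omega), Nat.le_div_iff_mul_le (by omega), mul_comm]
    exact ⟨Nat.one_le_iff_ne_zero.2 (by rintro rfl; simp at h1), h2⟩
  · intro m hm
    exact Nat.mul_div_cancel_left _ (by omega)
  · intro n hn
    simp only [Finset.mem_filter] at hn
    exact Nat.mul_div_cancel' hn.2
  · intro m hm
    rw [Nat.mul_div_cancel_left _ (by omega)]

lemma tau_rec (p : ℕ) (hp : p.Prime) (n : ℕ) (hn : n ≠ 0) :
    (if ¬ p ∣ n then tau n else 0) = tau n - 2 * (if p ∣ n then tau (n / p) else 0)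
      + (if p ∣ n then (if p ∣ n / p then tau (n / p / p) else 0) else 0) := by
  obtain ⟨k, j, hj, rfl⟩ := Nat.exists_eq_pow_mul_and_not_dvd hn p hp.ne_one
  have ht : ∀ i : ℕ, tau (p ^ i * j) = (i + 1) * tau j := by
    intro i
    unfold tau
    rw [Nat.Coprime.card_divisors_mul ((Nat.Prime.coprime_iff_not_dvd hp).2 hj |>.pow_left i),
      Nat.divisors_prime_pow hp]
    simp
  have hp0 := hp.pos
  have hd : ∀ i, p ^ (i+1) * j / p = p ^ i * j := by
    intro i
    rw [pow_succ, mul_assoc, mul_comm p j, ← mul_assoc, Nat.mul_div_cancel _ hp0]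
  have hdv : ∀ i, p ∣ p ^ (i+1) * j := fun i => Dvd.dvd.mul_right (dvd_pow_self p (by omega)) j
  rcases k with _ | k
  · simp [hj]
  rcases k with _ | k
  · have h1 := hd 0
    have h2 := hdv 0
    rw [h1]
    simp only [h2, not_true, if_false, if_true, ht]
    rw [if_neg (by simpa using hj)]
    push_cast; ring
  · rw [hd, hd]
    simp only [hdv, not_true, if_false, if_true, ht]
    push_cast; ring

lemma SP_insert (P : Finset ℕ) (hP : ∀ q ∈ P, q.Prime) (p : ℕ) (hp : p.Prime) (hpP : p ∉ P) (x : ℝ) :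
    SP (insert p P) x = SP P x - 2 * SP P (x / p) + SP P (x / p / p) := by
  unfold SP
  rw [← shift_sum p hp.one_le (x / p), ← shift_sum p hp.one_le x, ← shift_sum p hp.one_le x,
    Finset.mul_sum, ← Finset.sum_sub_distrib, ← Finset.sum_add_distrib]
  refine Finset.sum_congr rfl fun n hn => ?_
  have hn0 : n ≠ 0 := by simp at hn; omega
  have hr := tau_rec p hp n hn0
  have hq : ∀ m, (∀ q ∈ P, ¬ q ∣ p * m) ↔ ∀ q ∈ P, ¬ q ∣ m := by
    intro m
    refine forall₂_congr fun q hq => not_congr ?_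
    rw [(hP q hq).dvd_mul]
    refine or_iff_right fun h => ?_
    exact hpP (((Nat.prime_dvd_prime_iff_eq (hP q hq) hp).1 h) ▸ hq)
  have hq' : ∀ n, p ∣ n → ((∀ q ∈ P, ¬ q ∣ n / p) ↔ ∀ q ∈ P, ¬ q ∣ n) := by
    rintro _ ⟨m, rfl⟩
    rw [Nat.mul_div_cancel_left _ hp.pos, hq]
  by_cases hA : ∀ q ∈ P, ¬ q ∣ n
  · simp only [Finset.forall_mem_insert, hA, and_true]
    by_cases h1 : p ∣ n
    · have h2 := (hq' n h1).2 hA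
      by_cases h3 : p ∣ n / p
      · have h4 := (hq' _ h3).2 h2
        rw [if_pos hA, if_pos h2, if_pos h4]
        simpa [h1, h3] using hr
      · rw [if_pos hA, if_pos h2]
        simpa [h1, h3] using hr
    · simp only [h1] at hr ⊢
      simpa [hA] using hr
  · have : ¬ ∀ q ∈ insert p P, ¬ q ∣ n := by
      rw [Finset.forall_mem_insert]; tauto
    rw [if_neg this, if_neg hA]
    by_cases h1 : p ∣ n
    · have h2 := mt (hq' n h1).1 hA
      rw [if_pos h1, if_neg h2, if_pos h1]
      by_cases h3 : p ∣ n / p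
      · have h4 := mt (hq' _ h3).1 h2
        rw [if_pos h3, if_neg h4]; simp
      · rw [if_neg h3]; simp
    · simp [h1]

lemma sieve_induct (σ K : ℝ) (hK : ∀ x : ℝ, 0 < x → |SP ∅ x - x * (log x + kap)| ≤ K * x ^ σ)
    (P : Finset ℕ) : (∀ q ∈ P, q.Prime) → ∀ x : ℝ, 0 < x →
    |SP P x - (∏ p ∈ P, (1 - 1/(p:ℝ)))^2 * x * (log x + kap + 2 * ∑ p ∈ P, log p / ((p:ℝ) - 1))|
      ≤ K * x ^ σ * (∏ p ∈ P, (1 + (p:ℝ)^(-σ)))^2 := by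
  induction P using Finset.induction_on with
  | empty => intro _ x hx; simpa using hK x hx
  | insert p P hpP ih =>
    intro hP x hx
    have hp : p.Prime := hP p (Finset.mem_insert_self p P)
    have hP' : ∀ q ∈ P, q.Prime := fun q hq => hP q (Finset.mem_insert_of_mem hq)
    have hp0 : (0:ℝ) < p := by exact_mod_cast hp.pos
    have hp1 : (1:ℝ) < p := by exact_mod_cast hp.one_lt
    have i1 := ih hP' x hx
    have i2 := ih hP' (x/p) (by positivity)
    have i3 := ih hP' (x/p/p) (by positivity)
    rw [SP_insert P hP' p hp hpP, Finset.prod_insert hpP, Finset.prod_insert hpP, Finset.sum_insert hpP]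
    have e1 : (x/p)^σ = x^σ * (p:ℝ)^(-σ) := by
      rw [Real.div_rpow hx.le hp0.le, Real.rpow_neg hp0.le]; rfl
    have e2 : (x/p/p)^σ = x^σ * (p:ℝ)^(-σ) * (p:ℝ)^(-σ) := by
      rw [Real.div_rpow (by positivity) hp0.le, e1, Real.rpow_neg hp0.le]; rfl
    have l1 : log (x/p) = log x - log p := Real.log_div hx.ne' hp0.ne'
    have l2 : log (x/p/p) = log x - log p - log p := by rw [Real.log_div (by positivity) hp0.ne', l1]
    rw [e1, l1] at i2
    rw [e2, l2] at i3
    set V := ∏ p ∈ P, (1 - 1/(p:ℝ))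
    set W := ∏ p ∈ P, (1 + (p:ℝ)^(-σ))
    set Lm := ∑ p ∈ P, log p / ((p:ℝ) - 1)
    set r := (p:ℝ)^(-σ)
    have key : SP P x - 2 * SP P (x/p) + SP P (x/p/p)
        - ((1 - 1/(p:ℝ)) * V)^2 * x * (log x + kap + 2 * (log p / ((p:ℝ)-1) + Lm))
       = (SP P x - V^2 * x * (log x + kap + 2 * Lm))
        - 2 * (SP P (x/p) - V^2 * (x/p) * (log x - log p + kap + 2 * Lm))
        + (SP P (x/p/p) - V^2 * (x/p/p) * (log x - log p - log p + kap + 2 * Lm)) := by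
      have : (p:ℝ) - 1 ≠ 0 := by linarith
      field_simp
      ring
    rw [key]
    calc _ ≤ K * x^σ * W^2 + 2 * (K * (x^σ * r) * W^2) + K * (x^σ * r * r) * W^2 := by
          rw [abs_le] at i1 i2 i3 ⊢
          constructor <;> linarith
      _ = _ := by ring

end RD

open Real MeasureTheory

namespace RD

lemma two_thirds_lt_log {y : ℝ} (hy : 2 ≤ y) : 2/3 < log y := by
  have := Real.log_two_gt_d9
  have := Real.log_le_log (by norm_num) hy
  linarith

lemma rough_iff (y : ℝ) (hy : 2 ≤ y) (n : ℕ) (hn : 1 ≤ n) :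
    (n = 1 ∨ y < (n.minFac : ℝ)) ↔ ∀ p ∈ Pf y, ¬ p ∣ n := by
  constructor
  · rintro (rfl | h) p hp hd
    · rw [mem_Pf (by linarith)] at hp
      exact hp.1.one_lt.ne' (Nat.dvd_one.1 hd)
    · rw [mem_Pf (by linarith)] at hp
      have : (n.minFac : ℝ) ≤ p := by exact_mod_cast Nat.minFac_le_of_dvd hp.1.two_le hd
      linarith [hp.2]
  · intro h
    by_contra! hc
    exact h n.minFac ((mem_Pf (by linarith)).2 ⟨Nat.minFac_prime hc.1, hc.2⟩) (Nat.minFac_dvd n)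

lemma S_eq_SP (x y : ℝ) (hy : 2 ≤ y) : S x y = SP (Pf y) x := by
  unfold S SP tau
  rw [Finset.sum_filter]
  refine Finset.sum_congr rfl fun n hn => ?_
  have hn1 : 1 ≤ n := (Finset.mem_Icc.1 hn).1
  simp only [rough_iff y hy n hn1]

lemma S_eq_rg (x y : ℝ) : S x y = ∑ n ∈ Finset.Icc 1 ⌊x⌋₊, tau n * rg y n := by
  unfold S tau rg
  rw [Finset.sum_filter]
  refine Finset.sum_congr rfl fun n hn => ?_
  split_ifs <;> simp

lemma sieve_base : ∃ C > 0, ∀ L : ℝ, 2/3 < L → ∀ x : ℝ, 0 < x →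
    |SP ∅ x - x * (log x + kap)| ≤ (C * L) * x ^ (1 - 1/(3*L)) := by
  obtain ⟨C, hC, h⟩ := tau_sum
  refine ⟨2 * C + 3 + 2 * |kap|, by positivity, fun L hL x hx => ?_⟩
  have hS : SP ∅ x = ∑ n ∈ Finset.Icc 1 ⌊x⌋₊, tau n := by simp [SP]
  rw [hS]
  have ha : 1/(3*L) ≤ 1/2 := by apply one_div_le_one_div_of_le <;> linarith
  have ha0 : 0 < 1/(3*L) := by positivity
  have hk := abs_nonneg kap
  rcases le_or_gt 1 x with h1 | h1
  · refine (h x h1).trans ?_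
    rw [Real.sqrt_eq_rpow]
    have : x ^ (1/2:ℝ) ≤ x ^ (1 - 1/(3*L)) := Real.rpow_le_rpow_of_exponent_le h1 (by linarith)
    apply mul_le_mul _ this (by positivity) (by positivity)
    nlinarith
  · have : ⌊x⌋₊ = 0 := Nat.floor_eq_zero.2 h1
    rw [this]
    simp only [Finset.Icc_eq_empty_of_lt zero_lt_one, Finset.sum_empty, zero_sub, abs_neg]
    have e : x = x ^ (1 - 1/(3*L)) * x ^ (1/(3*L)) := by
      rw [← Real.rpow_add hx]; simp
    have h2 := Real.abs_log_mul_self_rpow_lt x (1/(3*L)) hx h1.le ha0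
    have h3 : x ^ (1/(3*L)) ≤ 1 := Real.rpow_le_one hx.le h1.le ha0.le
    set A := x ^ (1 - 1/(3*L))
    set B := x ^ (1/(3*L))
    have hA : 0 ≤ A := by positivity
    have hB : 0 ≤ B := by positivity
    rw [one_div_one_div] at h2
    have : x * (log x + kap) = A * (log x * B + kap * B) := by
      nth_rewrite 1 [e]; ring
    rw [this, abs_mul, abs_of_nonneg hA, mul_comm]
    apply mul_le_mul_of_nonneg_right _ hA
    have h4 : |kap * B| ≤ |kap| := by
      rw [abs_mul, abs_of_nonneg hB]; nlinarith
    have := abs_add_le (log x * B) (kap * B)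
    nlinarith

lemma sieve_W : ∃ C > 0, ∀ y : ℝ, 2 ≤ y →
    ∏ p ∈ Pf y, (1 + (p:ℝ)^(-(1 - 1/(3*log y)))) ≤ C * log y := by
  obtain ⟨C, hC, h⟩ := sum_log_p
  refine ⟨rexp (C + 2/3 + C), by positivity, fun y hy => ?_⟩
  obtain ⟨-, h1, h2⟩ := h y hy
  have hL := two_thirds_lt_log hy
  set L := log y
  have h3 : ∀ p ∈ Pf y, (p:ℝ)^(-(1 - 1/(3*L))) ≤ 1/(p:ℝ) + 2/(3*L) * (log p / p) := by
    intro p hp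
    rw [mem_Pf (by linarith)] at hp
    have hp0 : (0:ℝ) < p := by exact_mod_cast hp.1.pos
    have hlp0 : 0 ≤ log p := Real.log_natCast_nonneg p
    have hlp : log p ≤ L := Real.log_le_log hp0 hp.2
    have e : (p:ℝ)^(-(1 - 1/(3*L))) = 1/(p:ℝ) * rexp (log p/(3*L)) := by
      rw [show -(1 - 1/(3*L)) = -1 + 1/(3*L) by ring, Real.rpow_add hp0, Real.rpow_neg_one,
        Real.rpow_def_of_pos hp0, mul_one_div, one_div]
    set t := log p/(3*L) with ht
    have ht0 : 0 ≤ t := by positivity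
    have ht1 : t ≤ 1/3 := by
      rw [ht, div_le_iff₀ (by positivity)]; linarith
    have he : rexp t ≤ 1 + 2 * t := by
      have h5 := Real.add_one_le_exp (-t)
      rw [Real.exp_neg] at h5
      have h6 := Real.exp_pos t
      have h7 : (1 - t) * rexp t ≤ 1 := by
        calc (1-t) * rexp t ≤ (rexp t)⁻¹ * rexp t := by gcongr; linarith
          _ = 1 := inv_mul_cancel₀ h6.ne'
      nlinarith
    rw [e]
    calc _ ≤ 1/(p:ℝ) * (1 + 2*t) := by gcongr
      _ = _ := by rw [ht]; field_simp
  calc ∏ p ∈ Pf y, (1 + (p:ℝ)^(-(1 - 1/(3*L)))) ≤ ∏ p ∈ Pf y, rexp ((p:ℝ)^(-(1 - 1/(3*L)))) := by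
        apply Finset.prod_le_prod
        · intro p _; positivity
        · intro p _; rw [add_comm]; exact Real.add_one_le_exp _
    _ = rexp (∑ p ∈ Pf y, (p:ℝ)^(-(1 - 1/(3*L)))) := (Real.exp_sum _ _).symm
    _ ≤ rexp (log L + (C + 2/3 + C)) := by
        apply Real.exp_le_exp.2
        calc _ ≤ ∑ p ∈ Pf y, (1/(p:ℝ) + 2/(3*L) * (log p / p)) := Finset.sum_le_sum h3
          _ = ∑ p ∈ Pf y, 1/(p:ℝ) + 2/(3*L) * ∑ p ∈ Pf y, (log p / p) := by
            rw [Finset.sum_add_distrib, Finset.mul_sum]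
          _ ≤ (log L + C) + 2/(3*L) * (L + C) := by gcongr
          _ ≤ _ := by
            have : 2/(3*L) * (L + C) = 2/3 + 2/(3*L) * C := by field_simp
            have h8 : 2/(3*L) ≤ 1 := by rw [div_le_one (by positivity)]; linarith
            nlinarith
    _ = _ := by rw [Real.exp_add, Real.exp_log (by linarith), mul_comm]

lemma V_le : ∃ C > 0, ∀ y : ℝ, 2 ≤ y → 0 ≤ primeProd y ∧ primeProd y ≤ C / log y := by
  obtain ⟨C, hC, h⟩ := V_mertens
  refine ⟨rexp (-eulerMascheroniConstant) + 4 * C, by positivity, fun y hy => ?_⟩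
  have hL := two_thirds_lt_log hy
  have h1 := h y hy
  refine ⟨by rw [primeProd_eq (by linarith)]; positivity, ?_⟩
  rw [le_div_iff₀ (by linarith)]
  have h2 : C / (log y)^2 ≤ 4 * C := by
    rw [div_le_iff₀ (by positivity)]; nlinarith [mul_pos hC hC, mul_pos hC (show 0 < log y by linarith), mul_pos hC (show 0 < (log y - 2/3) by linarith)]
  linarith [abs_le.1 h1]

lemma sieve_main : ∃ C > 0, ∀ x y : ℝ, 1 ≤ x → 2 ≤ y →
    |S x y - (primeProd y)^2 * x * (log x + 2 * log y)| ≤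
      C * x / (log y)^2 + C * (log y)^3 * x * rexp (-(log x / log y) / 3) := by
  obtain ⟨C1, hC1, h1⟩ := sieve_base
  obtain ⟨C2, hC2, h2⟩ := sieve_W
  obtain ⟨C3, hC3, h3⟩ := V_le
  obtain ⟨C4, hC4, h4⟩ := sum_log_p
  refine ⟨C1 * C2^2 + C3^2 * (|kap| + 2 * C4), by positivity, fun x y hx hy => ?_⟩
  have hL := two_thirds_lt_log hy
  have hP : ∀ q ∈ Pf y, q.Prime := fun q hq => ((mem_Pf (by linarith)).1 hq).1
  have hm := sieve_induct _ _ (h1 (log y) hL) (Pf y) hP x (by linarith)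
  have hw := h2 y hy
  have hw0 : 0 ≤ ∏ p ∈ Pf y, (1 + (p:ℝ)^(-(1 - 1/(3*log y)))) := Finset.prod_nonneg fun p _ => by positivity
  obtain ⟨hv0, hv⟩ := h3 y hy
  obtain ⟨hl, -, -⟩ := h4 y hy
  rw [← S_eq_SP x y hy, show (∏ p ∈ Pf y, (1 - 1/(p:ℝ))) = primeProd y from rfl] at hm
  have hx0 : 0 < x := by linarith
  have e : x ^ (1 - 1/(3*log y)) = x * rexp (-(log x / log y) / 3) := by
    rw [sub_eq_add_neg, Real.rpow_add hx0, Real.rpow_one, Real.rpow_def_of_pos hx0]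
    congr 2; field_simp
  rw [e] at hm
  set L := log y
  set W := ∏ p ∈ Pf y, (1 + (p:ℝ)^(-(1 - 1/(3*L))))
  set V := primeProd y
  set E := rexp (-(log x / L) / 3)
  set A := ∑ p ∈ Pf y, log p / ((p:ℝ) - 1)
  have hE : 0 < E := Real.exp_pos _
  have hL0 : 0 < L := by linarith
  have b1 : C1 * L * (x * E) * W^2 ≤ C1 * C2^2 * (L^3 * x * E) := by
    have : W^2 ≤ (C2 * L)^2 := by gcongr
    calc _ ≤ C1 * L * (x * E) * (C2 * L)^2 := by gcongr
      _ = _ := by ring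
  have hV2 : V^2 ≤ C3^2 / L^2 := by
    rw [← div_pow]; gcongr
  have b2 : |V^2 * x * (kap + 2 * (A - L))| ≤ C3^2 * (|kap| + 2 * C4) * (x / L^2) := by
    rw [abs_mul, abs_of_nonneg (by positivity : 0 ≤ V^2 * x)]
    have : |kap + 2 * (A - L)| ≤ |kap| + 2 * C4 := by
      have := abs_add_le kap (2 * (A-L))
      rw [abs_mul, abs_of_pos (by norm_num : (0:ℝ) < 2)] at this
      linarith
    calc _ ≤ (C3^2 / L^2 * x) * (|kap| + 2 * C4) := by gcongr
      _ = _ := by ring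
  have hfin : S x y - V^2 * x * (log x + 2 * L) =
      (S x y - V^2 * x * (log x + kap + 2 * A)) + V^2 * x * (kap + 2 * (A - L)) := by ring
  rw [hfin]
  refine (abs_add_le _ _).trans ((add_le_add (hm.trans b1) b2).trans ?_)
  have c1 : 0 ≤ L^3 * x * E := by positivity
  have c2 : 0 ≤ x / L^2 := by positivity
  have c3 : 0 ≤ C3^2 * (|kap| + 2 * C4) * (L^3 * x * E) := by positivity
  have c4 : 0 ≤ C1 * C2^2 * (x/L^2) := by positivity
  have : ∀ K, K * x / L^2 + K * L^3 * x * E = K * (x/L^2) + K * (L^3 * x * E) := by intro K; ring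
  rw [this]
  nlinarith

end RD

open Real MeasureTheory

namespace RD

/-- j -/
noncomputable def jj (ξ : ℝ → ℝ) (u : ℝ) : ℝ := 1 + ∫ t in (1:ℝ)..u, ξ t

/-- the hypothesis on `ξ` -/
def IsXi (ξ : ℝ → ℝ) : Prop := (∀ u : ℝ, u < 1 → ξ u = 0) ∧
  (∀ u : ℝ, 1 ≤ u → u * ξ u = 2 + 2 * ∫ t in (1:ℝ)..(u - 1), ξ t)

variable {ξ : ℝ → ℝ}

lemma xi_jj (h : IsXi ξ) (u : ℝ) (hu : 1 ≤ u) : u * ξ u = 2 * jj ξ (u - 1) := by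
  rw [h.2 u hu, jj]; ring

lemma xi_eq (h : IsXi ξ) (u : ℝ) (hu : 1 ≤ u) : ξ u = 2 * jj ξ (u - 1) / u := by
  rw [← xi_jj h u hu]; field_simp

lemma jj_one (h : IsXi ξ) (u : ℝ) (hu : u ≤ 1) : jj ξ u = 1 := by
  unfold jj
  rw [intervalIntegral.integral_symm, intervalIntegral.integral_of_le hu,
    MeasureTheory.integral_Ioc_eq_integral_Ioo]
  rw [MeasureTheory.setIntegral_congr_fun (g := fun _ => (0:ℝ)) measurableSet_Ioo (fun t ht => h.1 t ht.2)]
  simp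

lemma cont_of_int (N : ℝ) (hN : 1 ≤ N) (h : IntegrableOn ξ (Set.Iic N)) : ContinuousOn (jj ξ) (Set.Iic N) := by
  have hg : Integrable ((Set.Iic N).indicator ξ) := h.integrable_indicator measurableSet_Iic
  have hc := intervalIntegral.continuous_primitive (fun a b => hg.intervalIntegrable (a := a) (b := b)) 1
  have : ContinuousOn (fun u => 1 + ∫ t in (1:ℝ)..u, (Set.Iic N).indicator ξ t) (Set.Iic N) :=
    (continuous_const.add hc).continuousOn
  refine this.congr fun u hu => ?_
  unfold jj
  congr 1
  refine intervalIntegral.integral_congr fun t ht => ?_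
  have : t ∈ Set.Iic N := by
    have := ht.2
    exact this.trans (max_le hN hu)
  simp [Set.indicator_of_mem this]

lemma xi_int (h : IsXi ξ) (n : ℕ) : IntegrableOn ξ (Set.Iic ((n:ℝ)+1)) ∧
    ContinuousOn ξ (Set.Icc 1 ((n:ℝ)+1)) := by
  have hlow : IntegrableOn ξ (Set.Iio 1) := by
    have h0 : IntegrableOn (fun _ : ℝ => (0:ℝ)) (Set.Iio 1) := integrableOn_zero
    exact h0.congr_fun (fun t ht => (h.1 t ht).symm) measurableSet_Iio
  have step : ∀ N : ℝ, 1 ≤ N → ContinuousOn ξ (Set.Icc 1 N) → IntegrableOn ξ (Set.Iic N) := by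
    intro N hN hc
    have : Set.Iic N = Set.Iio 1 ∪ Set.Icc 1 N := by
      rw [Set.Iio_union_Icc_eq_Iic hN]
    rw [this]
    exact hlow.union (hc.integrableOn_Icc)
  induction n with
  | zero =>
    have : ContinuousOn ξ (Set.Icc 1 (((0:ℕ):ℝ)+1)) := by simp
    exact ⟨step _ (by simp) this, this⟩
  | succ n ih =>
    have hc := cont_of_int _ (by linarith [n.cast_nonneg (α := ℝ)]) ih.1
    have : ContinuousOn ξ (Set.Icc 1 (((n+1:ℕ):ℝ)+1)) := by
      have h1 : ContinuousOn (fun u => 2 * jj ξ (u - 1) / u) (Set.Icc 1 (((n+1:ℕ):ℝ)+1)) := by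
        apply ContinuousOn.div _ continuousOn_id
        · intro u hu; have := hu.1; simp; linarith
        · apply continuousOn_const.mul
          refine hc.comp (by fun_prop) fun u hu => ?_
          have := hu.2
          push_cast at this
          simp; linarith
      exact h1.congr fun u hu => xi_eq h u hu.1
    exact ⟨step _ (by linarith [(n+1).cast_nonneg (α := ℝ)]) this, this⟩

lemma xi_ii (h : IsXi ξ) (a b : ℝ) : IntervalIntegrable ξ volume a b := by
  obtain ⟨n, hn⟩ := exists_nat_ge (max a b)
  rw [intervalIntegrable_iff]
  refine (xi_int h n).1.mono_set ?_
  intro t ht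
  have := ht.2
  simp only [Set.mem_Iic]; linarith

lemma jj_cont (h : IsXi ξ) : Continuous (jj ξ) :=
  continuous_const.add (intervalIntegral.continuous_primitive (xi_ii h) 1)

lemma xi_contAt (h : IsXi ξ) (u : ℝ) (hu : 1 < u) : ContinuousAt ξ u := by
  obtain ⟨n, hn⟩ := exists_nat_ge u
  exact (xi_int h n).2.continuousAt (Icc_mem_nhds hu (by linarith))

lemma jj_deriv (h : IsXi ξ) (u : ℝ) (hu : 1 < u) : HasDerivAt (jj ξ) (ξ u) u := by
  have hc := xi_contAt h u hu
  have hm : StronglyMeasurableAtFilter ξ (nhds u) := by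
    apply ContinuousOn.stronglyMeasurableAtFilter (s := Set.Ioi 1) isOpen_Ioi _ u hu
    exact fun v hv => (xi_contAt h v hv).continuousWithinAt
  exact (intervalIntegral.integral_hasDerivAt_right (xi_ii h 1 u) hm hc).const_add 1

lemma jj_rec (h : IsXi ξ) (u : ℝ) (hu : 1 ≤ u) :
    u * jj ξ u = (∫ s in (0:ℝ)..u, jj ξ s) + 2 * ∫ s in (0:ℝ)..(u-1), jj ξ s := by
  have hj := jj_cont h
  have hj1 : Continuous fun s => jj ξ (s - 1) := hj.comp (by fun_prop)
  have h1 := intervalIntegral.integral_eq_sub_of_hasDerivAt_of_le (f := fun v => v * jj ξ v)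
    (f' := fun v => jj ξ v + 2 * jj ξ (v - 1)) hu (by fun_prop) (fun v hv => by
      have := (hasDerivAt_id v).mul (jj_deriv h v hv.1)
      rw [← xi_jj h v hv.1.le]
      convert! this using 1
      simp) (Continuous.intervalIntegrable (by fun_prop) _ _)
  have hj2 : Continuous fun s => 2 * jj ξ (s - 1) := by fun_prop
  rw [intervalIntegral.integral_add (hj.intervalIntegrable _ _)
    (hj2.intervalIntegrable _ _), intervalIntegral.integral_const_mul,
    intervalIntegral.integral_comp_sub_right (fun v => jj ξ v), jj_one h 1 le_rfl, sub_self] at h1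
  have h2 : ∫ s in (0:ℝ)..1, jj ξ s = 1 := by
    rw [intervalIntegral.integral_congr (g := fun _ => (1:ℝ))]
    · simp
    · intro s hs
      rw [Set.uIcc_of_le (by norm_num)] at hs
      exact jj_one h s hs.2
  have h3 := intervalIntegral.integral_add_adjacent_intervals (hj.intervalIntegrable (μ := volume) 0 1) (hj.intervalIntegrable 1 u)
  linarith

lemma jj_bound (h : IsXi ξ) (n : ℕ) : ∀ u : ℝ, u ≤ n + 1 → 1 ≤ jj ξ u ∧ jj ξ u ≤ max 1 (u^2) := by
  induction n with
  | zero =>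
    intro u hu
    rw [jj_one h u (by simpa using hu)]
    exact ⟨le_rfl, le_max_left _ _⟩
  | succ n ih =>
    intro u hu
    rcases le_or_gt u 1 with h1 | h1
    · rw [jj_one h u h1]
      exact ⟨le_rfl, le_max_left _ _⟩
    · have hx : ∀ t ∈ Set.Icc 1 u, 0 ≤ ξ t ∧ ξ t ≤ 2 * t := by
        intro t ht
        have ht1 := ht.1
        have ht2 := ht.2
        push_cast at hu
        obtain ⟨i1, i2⟩ := ih (t - 1) (by linarith)
        rw [xi_eq h t ht1]
        refine ⟨by apply div_nonneg <;> linarith, ?_⟩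
        rw [div_le_iff₀ (by linarith)]
        have : max 1 ((t-1)^2) ≤ t^2 := max_le (by nlinarith) (by nlinarith)
        nlinarith
      have e1 : 0 ≤ ∫ t in (1:ℝ)..u, ξ t :=
        intervalIntegral.integral_nonneg h1.le fun t ht => (hx t ht).1
      have e2 : ∫ t in (1:ℝ)..u, ξ t ≤ ∫ t in (1:ℝ)..u, 2 * t :=
        intervalIntegral.integral_mono_on h1.le (xi_ii h 1 u) (Continuous.intervalIntegrable (by fun_prop) _ _)
          fun t ht => (hx t ht).2
      have e3 : ∫ t in (1:ℝ)..u, 2 * t = u^2 - 1 := by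
        rw [intervalIntegral.integral_const_mul, integral_id]; ring
      unfold jj
      exact ⟨by linarith, le_max_of_le_right (by linarith)⟩

lemma jj_ge (h : IsXi ξ) (u : ℝ) : 1 ≤ jj ξ u := by
  obtain ⟨n, hn⟩ := exists_nat_ge u
  exact (jj_bound h n u (by linarith)).1

lemma jj_le (h : IsXi ξ) (u : ℝ) (hu : 0 ≤ u) : jj ξ u ≤ (1 + u)^2 := by
  obtain ⟨n, hn⟩ := exists_nat_ge u
  refine (jj_bound h n u (by linarith)).2.trans (max_le ?_ ?_) <;> nlinarith

lemma xi_nonneg (h : IsXi ξ) (u : ℝ) : 0 ≤ ξ u := by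
  rcases lt_or_ge u 1 with h1 | h1
  · rw [h.1 u h1]
  · rw [xi_eq h u h1]
    have := jj_ge h (u - 1)
    apply div_nonneg <;> linarith

lemma xi_le (h : IsXi ξ) (u : ℝ) (hu : 1 ≤ u) : ξ u ≤ 2 * u := by
  rw [xi_eq h u hu, div_le_iff₀ (by linarith)]
  have := jj_le h (u - 1) (by linarith)
  nlinarith

lemma contraction (D : ℝ → ℝ) (U ε K₀ : ℝ) (hε0 : 0 ≤ ε) (hε : ε ≤ 1/4)
    (hD : ∀ a b, IntervalIntegrable D volume a b)
    (hK : ∀ u, 0 ≤ u → u ≤ U → |D u| ≤ K₀)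
    (h0 : ∀ u, 0 ≤ u → u < 1 → D u = 0)
    (hrec : ∀ u, 1 ≤ u → u ≤ U → u * |D u| ≤ (∫ s in (0:ℝ)..u, |D s|) + 2 * (∫ s in (0:ℝ)..(u-1), |D s|)
      + ε * ((1+u)^2 + |D (u-1)|)) (u : ℝ) (hu : 0 ≤ u) (huU : u ≤ U) : |D u| ≤ 4 * ε * (1+u)^11 := by
  set A := (fun u => |D u| / (1+u)^11) '' Set.Icc 0 U with hA
  have hbd : BddAbove A := by
    refine ⟨K₀, ?_⟩
    rintro _ ⟨v, hv, rfl⟩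
    have h1 := hK v hv.1 hv.2
    have h2 : 1 ≤ (1+v)^11 := one_le_pow₀ (by linarith [hv.1])
    exact (div_le_self (abs_nonneg _) h2).trans h1
  set M := sSup A with hM
  have hle : ∀ v, 0 ≤ v → v ≤ U → |D v| ≤ M * (1+v)^11 := by
    intro v h1 h2
    rw [← div_le_iff₀ (by positivity)]
    exact le_csSup hbd ⟨v, ⟨h1, h2⟩, rfl⟩
  have hM0 : 0 ≤ M := by
    have := hle u hu huU
    have h1 := (abs_nonneg (D u)).trans this
    exact nonneg_of_mul_nonneg_left h1 (by positivity)
  have hint : ∀ v, 0 ≤ v → v ≤ U → ∫ s in (0:ℝ)..v, |D s| ≤ M * ((1+v)^12/12) := by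
    intro v h1 h2
    have e1 : ∫ s in (0:ℝ)..v, |D s| ≤ ∫ s in (0:ℝ)..v, M * (1+s)^11 := by
      apply intervalIntegral.integral_mono_on h1 (hD 0 v).abs (Continuous.intervalIntegrable (by fun_prop) _ _)
      intro s hs
      exact hle s hs.1 (hs.2.trans h2)
    have e2 : ∫ s in (0:ℝ)..v, M * (1+s)^11 = M * (((1+v)^12 - 1)/12) := by
      rw [intervalIntegral.integral_const_mul, intervalIntegral.integral_comp_add_left (fun s => s^11), integral_pow]
      norm_num
    rw [e2] at e1
    refine e1.trans ?_
    gcongr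
    linarith
  have key : M ≤ 3/4 * M + ε := by
    refine csSup_le (Set.image_nonempty.2 (Set.nonempty_Icc.2 (hu.trans huU))) ?_
    rintro _ ⟨v, ⟨hv0, hvU⟩, rfl⟩
    rcases lt_or_ge v 1 with h1 | h1
    · simp only [h0 v hv0 h1, abs_zero, zero_div]; positivity
    · have hr := hrec v h1 hvU
      have i1 := hint v hv0 hvU
      have i2 := hint (v-1) (by linarith) (by linarith)
      have i3 := hle (v-1) (by linarith) (by linarith)
      have e : 1 + (v - 1) = v := by ring
      rw [e] at i2 i3
      simp only
      rw [div_le_iff₀ (by positivity)]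
      have p1 : v^12 ≤ (1+v)^12 := by gcongr; linarith
      have p2 : v^11 ≤ (1+v)^11 := by gcongr; linarith
      have p3 : (1+v)^2 ≤ (1+v)^11 := pow_le_pow_right₀ (by linarith) (by norm_num)
      have q1 : M * (v^12/12) ≤ M * ((1+v)^12/12) := by gcongr
      have q2 : M * v^11 ≤ M * (1+v)^11 := by gcongr
      have q3 : ε * ((1+v)^2 + |D (v-1)|) ≤ ε * ((1+v)^11 + M * (1+v)^11) := by
        gcongr; linarith
      have q4 : M * ((1+v)^12/12) * 3 ≤ M * (1+v)^11 * (v/2) := by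
        have : M * (1+v)^11 * (v/2) - M * ((1+v)^12/12) * 3 = M * (1+v)^11 * ((v - 1)/4) := by ring
        have : 0 ≤ M * (1+v)^11 * ((v - 1)/4) := mul_nonneg (by positivity) (by linarith)
        linarith
      set Z := (1+v)^11
      have hZ : 0 ≤ Z := by positivity
      have q5 : v * |D v| ≤ v * ((3/4 * M + ε) * Z) := by
        have a1 : ε * (M * Z) ≤ 1/4 * (M * Z) := by gcongr
        have a2 : 0 ≤ (v - 1) * (M * Z) := mul_nonneg (by linarith) (by positivity)
        have a3 : 0 ≤ (v - 1) * (ε * Z) := mul_nonneg (by linarith) (by positivity)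
        nlinarith
      exact le_of_mul_le_mul_left q5 (by linarith)
  calc |D u| ≤ M * (1+u)^11 := hle u hu huU
    _ ≤ 4 * ε * (1+u)^11 := by gcongr; linarith

end RD

open Real MeasureTheory

namespace RD

/-- summatory function in exponential variable -/
noncomputable def cs (c : ℕ → ℝ) (L s : ℝ) : ℝ := ∑ n ∈ Finset.Icc 1 ⌊rexp (s * L)⌋₊, c n

lemma cs_mono {c : ℕ → ℝ} (hc : ∀ n, 0 ≤ c n) {L : ℝ} (hL : 0 < L) : Monotone (cs c L) := by
  intro a b hab
  apply Finset.sum_le_sum_of_subset_of_nonneg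
  · apply Finset.Icc_subset_Icc_right
    gcongr
  · intro n _ _; exact hc n

lemma log_int (c : ℕ → ℝ) {L u : ℝ} (hL : 0 < L) :
    ∑ n ∈ Finset.Icc 1 ⌊rexp (u * L)⌋₊, c n * (u * L - log n) = L * ∫ s in (0:ℝ)..u, cs c L s := by
  rcases lt_or_ge u 0 with hu | hu
  · have h0 : ∀ s, s < 0 → ⌊rexp (s * L)⌋₊ = 0 := by
      intro s hs
      rw [Nat.floor_eq_zero, Real.exp_lt_one_iff]
      exact mul_neg_of_neg_of_pos hs hL
    rw [h0 u hu, intervalIntegral.integral_symm, intervalIntegral.integral_of_le hu.le,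
      MeasureTheory.integral_Ioc_eq_integral_Ioo,
      MeasureTheory.setIntegral_congr_fun (g := fun _ => (0:ℝ)) measurableSet_Ioo (fun t ht => by simp [cs, h0 t ht.2])]
    simp
  have hmem : ∀ n : ℕ, 1 ≤ n → ∀ s : ℝ, n ≤ ⌊rexp (s * L)⌋₊ ↔ log n / L ≤ s := by
    intro n hn s
    rw [Nat.le_floor_iff (by positivity), div_le_iff₀ hL, Real.log_le_iff_le_exp (by exact_mod_cast hn)]
  have e1 : ∀ s ∈ Set.uIcc 0 u, cs c L s = ∑ n ∈ Finset.Icc 1 ⌊rexp (u * L)⌋₊, (Set.Ici (log n / L)).indicator (fun _ => c n) s := by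
    intro s hs
    rw [Set.uIcc_of_le hu] at hs
    unfold cs
    refine Eq.trans ?_ (Finset.sum_subset (s₁ := Finset.Icc 1 ⌊rexp (s * L)⌋₊) ?_ ?_)
    · refine Finset.sum_congr rfl fun n hn => ?_
      rw [Finset.mem_Icc] at hn
      rw [Set.indicator_of_mem]
      exact (hmem n hn.1 s).1 hn.2
    · apply Finset.Icc_subset_Icc_right
      have := hs.2
      gcongr
    · intro n hn hn2
      rw [Finset.mem_Icc] at hn hn2
      rw [Set.indicator_of_notMem]
      intro h
      exact hn2 ⟨hn.1, (hmem n hn.1 s).2 h⟩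
  rw [intervalIntegral.integral_congr e1, intervalIntegral.integral_finsetSum, Finset.mul_sum]
  · refine Finset.sum_congr rfl fun n hn => ?_
    rw [Finset.mem_Icc] at hn
    have h1 := (hmem n hn.1 u).1 hn.2
    have h2 : 0 ≤ log n / L := div_nonneg (Real.log_natCast_nonneg n) hL.le
    rw [intervalIntegral.integral_of_le hu, MeasureTheory.setIntegral_indicator measurableSet_Ici,
      MeasureTheory.setIntegral_const]
    have hv : volume.real (Set.Ioc 0 u ∩ Set.Ici (log n / L)) = u - log n / L := by
      rcases h2.eq_or_lt with h3 | h3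
      · rw [← h3, Set.inter_eq_left.2 (fun s hs => hs.1.le), Real.volume_real_Ioc_of_le hu]
      · have : Set.Ioc 0 u ∩ Set.Ici (log n / L) = Set.Icc (log n / L) u := by
          ext s; simp only [Set.mem_inter_iff, Set.mem_Ioc, Set.mem_Ici, Set.mem_Icc]
          constructor
          · rintro ⟨⟨_, a⟩, b⟩; exact ⟨b, a⟩
          · rintro ⟨a, b⟩; exact ⟨⟨by linarith, b⟩, a⟩
        rw [this, Real.volume_real_Icc_of_le h1]
    rw [hv, smul_eq_mul]
    field_simp
  · intro n _
    rw [intervalIntegrable_iff]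
    apply IntegrableOn.indicator _ measurableSet_Ici
    exact integrableOn_const (by simp)

lemma tau_log (n : ℕ) : tau n * log n =
    2 * ∑ x ∈ n.divisorsAntidiagonal, ArithmeticFunction.vonMangoldt x.1 * tau x.2 := by
  have h1 : (ArithmeticFunction.log * (ArithmeticFunction.zeta : ArithmeticFunction ℝ)) n
      = ∑ x ∈ n.divisorsAntidiagonal, ArithmeticFunction.vonMangoldt x.1 * tau x.2 := by
    rw [← ArithmeticFunction.vonMangoldt_mul_zeta, mul_assoc, ArithmeticFunction.mul_apply]
    refine Finset.sum_congr rfl fun x _ => ?_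
    congr 1
    rw [ArithmeticFunction.coe_mul_zeta_apply, tau]
    rw [Finset.sum_congr rfl (g := fun _ => (1:ℝ))]
    · simp
    · intro d hd
      have : d ≠ 0 := (Nat.pos_of_mem_divisors hd).ne'
      simp [this]
  rw [← h1, ArithmeticFunction.coe_mul_zeta_apply, two_mul]
  nth_rewrite 1 [← Nat.sum_div_divisors]
  rw [← Finset.sum_add_distrib, tau, ← nsmul_eq_mul, ← Finset.sum_const]
  refine Finset.sum_congr rfl fun d hd => ?_
  have hd0 : d ≠ 0 := (Nat.pos_of_mem_divisors hd).ne'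
  obtain ⟨⟨k, rfl⟩, hn⟩ := Nat.mem_divisors.1 hd
  have hk : k ≠ 0 := by rintro rfl; simp at hn
  rw [Nat.mul_div_cancel_left _ (Nat.pos_of_ne_zero hd0)]
  simp only [ArithmeticFunction.log_apply]
  push_cast
  rw [Real.log_mul (by exact_mod_cast hd0) (by exact_mod_cast hk)]; ring

lemma conv_id (y : ℝ) (h : ℕ → ℝ) (hh : ∀ m n, m ≠ 0 → n ≠ 0 → h (m * n) = h m * h n) (N : ℕ) :
    ∑ n ∈ Finset.Icc 1 N, tau n * rg y n * h n * log n =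
    2 * ∑ m ∈ Finset.Icc 1 N, tau m * rg y m * h m * ∑ k ∈ Finset.Icc 1 (N / m), lr y k * h k := by
  let F : ArithmeticFunction ℝ := ⟨fun n => lr y n * h n, by simp [lr]⟩
  let G : ArithmeticFunction ℝ := ⟨fun n => tau n * rg y n * h n, by simp [tau]⟩
  have e := ArithmeticFunction.sum_Ioc_mul_eq_sum_sum G F N
  have hI : ∀ M : ℕ, Finset.Ioc 0 M = Finset.Icc 1 M := by intro M; ext; simp; omega
  simp only [hI] at e
  have e2 : ∀ n ∈ Finset.Icc 1 N, tau n * rg y n * h n * log n = 2 * (G * F) n := by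
    intro n _
    rw [mul_comm G F, ArithmeticFunction.mul_apply]
    calc _ = (tau n * log n) * (rg y n * h n) := by ring
      _ = _ := by
        rw [tau_log, mul_assoc, Finset.sum_mul]
        congr 1
        refine Finset.sum_congr rfl fun x hx => ?_
        obtain ⟨rfl, hn⟩ := Nat.mem_divisorsAntidiagonal.1 hx
        have h1 : x.1 ≠ 0 := left_ne_zero_of_mul hn
        have h2 : x.2 ≠ 0 := right_ne_zero_of_mul hn
        rw [rg_mul y h1 h2, hh _ _ h1 h2]
        change _ = (lr y x.1 * h x.1) * (tau x.2 * rg y x.2 * h x.2)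
        unfold lr; ring
  rw [Finset.sum_congr rfl e2, ← Finset.mul_sum, e]
  rfl

end RD

open Real MeasureTheory

namespace RD

lemma conv_split {y : ℝ} (hy : 2 ≤ y) (h : ℕ → ℝ) (hh : ∀ m n, m ≠ 0 → n ≠ 0 → h (m * n) = h m * h n) {u : ℝ}
    (_hu : 1 ≤ u) :
    ∑ n ∈ Finset.Icc 1 ⌊rexp (u * log y)⌋₊, tau n * rg y n * h n * log n =
    2 * ∑ m ∈ Finset.Icc 1 ⌊rexp ((u-1) * log y)⌋₊, tau m * rg y m * h m *
      ∑ k ∈ Finset.Icc 0 ⌊rexp (u * log y) / m⌋₊, lr y k * h k := by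
  rw [conv_id y h hh]
  congr 1
  have hL := two_thirds_lt_log hy
  have hy' : rexp (log y) = y := Real.exp_log (by linarith)
  have e0 : ∀ M : ℕ, ∑ k ∈ Finset.Icc 1 M, lr y k * h k = ∑ k ∈ Finset.Icc 0 M, lr y k * h k := by
    intro M
    refine Finset.sum_subset (Finset.Icc_subset_Icc_left (by norm_num)) fun k hk hk2 => ?_
    have : k = 0 := by simp at hk hk2; omega
    rw [this]; simp [lr]
  symm
  have hx : rexp (u * log y) = rexp ((u-1) * log y) * y := by
    nth_rewrite 3 [← hy']; rw [← Real.exp_add]; congr 1; ring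
  rw [Finset.sum_subset (s₂ := Finset.Icc 1 ⌊rexp (u * log y)⌋₊)]
  · refine Finset.sum_congr rfl fun m hm => ?_
    rw [e0, Nat.floor_div_natCast]
  · apply Finset.Icc_subset_Icc_right
    gcongr
    linarith
  · intro m hm hm2
    rw [Finset.mem_Icc] at hm hm2
    have hm3 : ⌊rexp ((u-1) * log y)⌋₊ < m := by omega
    rw [Nat.floor_lt (by positivity)] at hm3
    have hm0 : (0:ℝ) < m := by exact_mod_cast hm.1
    rw [Finset.sum_eq_zero, mul_zero]
    intro k hk
    rw [Finset.mem_Icc, Nat.le_floor_iff (by positivity), le_div_iff₀ hm0, hx] at hk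
    rw [lr_small hy, zero_mul]
    by_contra! hc
    have : y * rexp ((u-1) * log y) < k * m := by gcongr
    linarith [hk.2]

/-- weighted -/
noncomputable def aw (y : ℝ) (n : ℕ) : ℝ := tau n * rg y n * (1 / (n:ℝ))

lemma aw_nonneg (y : ℝ) (n : ℕ) : 0 ≤ aw y n :=
  mul_nonneg (mul_nonneg (tau_nonneg n) (rg_nonneg y n)) (by positivity)

lemma t_rec : ∃ C > 0, ∀ y u : ℝ, 2 ≤ y → 1 ≤ u →
    |u * cs (aw y) (log y) u - (∫ s in (0:ℝ)..u, cs (aw y) (log y) s) - 2 * ∫ s in (0:ℝ)..(u-1), cs (aw y) (log y) s|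
      ≤ C / (log y)^2 * cs (aw y) (log y) (u-1) := by
  obtain ⟨C, hC, hB⟩ := sum_lr_div
  refine ⟨2 * C, by positivity, fun y u hy hu => ?_⟩
  have hL : 0 < log y := by linarith [two_thirds_lt_log hy]
  have hy' : rexp (log y) = y := Real.exp_log (by linarith)
  have hy0 : 0 < y := by linarith
  have h1 := conv_split hy (fun n => 1 / (n:ℝ)) (fun m n _ _ => by push_cast; rw [one_div_mul_one_div]) hu
  have h2 := log_int (aw y) (u := u) hL
  have h3 := log_int (aw y) (u := u - 1) hL
  have h4 : ∑ n ∈ Finset.Icc 1 ⌊rexp (u * log y)⌋₊, aw y n * (u * log y - log n)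
      = u * log y * cs (aw y) (log y) u - ∑ n ∈ Finset.Icc 1 ⌊rexp (u * log y)⌋₊, aw y n * log n := by
    rw [cs, Finset.mul_sum, ← Finset.sum_sub_distrib]
    exact Finset.sum_congr rfl fun n _ => by ring
  change ∑ n ∈ Finset.Icc 1 ⌊rexp (u * log y)⌋₊, aw y n * log n = 2 * ∑ m ∈ Finset.Icc 1 ⌊rexp ((u-1) * log y)⌋₊, aw y m * _ at h1
  set L := log y with hLdef
  have hx : rexp (u * L) = rexp ((u-1) * L) * y := by
    nth_rewrite 1 [← hy']; rw [← Real.exp_add]; congr 1; ring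
  have key : |∑ m ∈ Finset.Icc 1 ⌊rexp ((u-1) * L)⌋₊, aw y m *
      (∑ k ∈ Finset.Icc 0 ⌊rexp (u * L) / m⌋₊, lr y k * (1 / (k:ℝ))) - ∑ n ∈ Finset.Icc 1 ⌊rexp ((u-1) * L)⌋₊, aw y n * ((u-1) * L - log n)|
      ≤ C / L * cs (aw y) L (u-1) := by
    rw [← Finset.sum_sub_distrib, cs, Finset.mul_sum]
    refine (Finset.abs_sum_le_sum_abs _ _).trans (Finset.sum_le_sum fun m hm => ?_)
    rw [Finset.mem_Icc, Nat.le_floor_iff (by positivity)] at hm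
    have hm0 : (0:ℝ) < m := by exact_mod_cast hm.1
    have hz : y ≤ rexp (u * L) / m := by
      rw [le_div_iff₀ hm0, hx, mul_comm]
      gcongr
      exact hm.2
    have := (hB y _ hy hz).1
    rw [Real.log_div (by positivity) hy0.ne', Real.log_div (by positivity) hm0.ne', Real.log_exp, ← hLdef] at this
    rw [← mul_sub, abs_mul, abs_of_nonneg (aw_nonneg y m), mul_comm]
    apply mul_le_mul_of_nonneg_right _ (aw_nonneg y m)
    rw [show (u-1) * L - log m = u * L - log m - L by ring]
    exact this
  set A := ∑ m ∈ Finset.Icc 1 ⌊rexp ((u-1) * L)⌋₊, aw y m *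
      (∑ k ∈ Finset.Icc 0 ⌊rexp (u * L) / m⌋₊, lr y k * (1 / (k:ℝ))) with hA
  rw [h3] at key
  rw [h4, h1] at h2
  set I1 := ∫ s in (0:ℝ)..u, cs (aw y) L s
  set I2 := ∫ s in (0:ℝ)..(u-1), cs (aw y) L s
  have e : u * cs (aw y) L u - I1 - 2 * I2 = (2 / L) * (A - L * I2) := by
    field_simp
    linarith
  rw [e, abs_mul, abs_of_pos (by positivity)]
  calc 2 / L * |A - L * I2| ≤ 2 / L * (C / L * cs (aw y) L (u-1)) := by gcongr
    _ = _ := by field_simp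

lemma cs_small {y : ℝ} (hy : 2 ≤ y) (c : ℕ → ℝ) {u : ℝ} (hu : 0 ≤ u) (hu1 : u < 1) :
    cs (fun n => tau n * rg y n * c n) (log y) u = c 1 := by
  have hL := two_thirds_lt_log hy
  have hy' : rexp (log y) = y := Real.exp_log (by linarith)
  unfold cs
  have h1 : 1 ≤ ⌊rexp (u * log y)⌋₊ := by
    rw [Nat.one_le_floor_iff]
    apply Real.one_le_exp; positivity
  rw [Finset.sum_eq_single_of_mem 1 (by simp [h1])]
  · simp [tau, rg_one]
  · intro n hn hn1
    rw [Finset.mem_Icc, Nat.le_floor_iff (by positivity)] at hn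
    rw [rg_small (by omega)]
    · simp
    · refine hn.2.trans ?_
      nth_rewrite 2 [← hy']
      gcongr
      nlinarith

lemma t_main : ∃ C > 0, ∀ (ξ : ℝ → ℝ), IsXi ξ → ∀ y u : ℝ, 2 ≤ y → C ≤ (log y)^2 → 0 ≤ u →
    |cs (aw y) (log y) u - jj ξ u| ≤ C / (log y)^2 * (1+u)^11 := by
  obtain ⟨C, hC, hr⟩ := t_rec
  refine ⟨4 * C, by positivity, fun ξ hξ y U hy hLC hU => ?_⟩
  have hL := two_thirds_lt_log hy
  have hL0 : 0 < log y := by linarith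
  set L := log y
  set t := cs (aw y) L
  have htm : Monotone t := cs_mono (aw_nonneg y) hL0
  have ht0 : ∀ s, 0 ≤ t s := fun s => Finset.sum_nonneg fun n _ => aw_nonneg y n
  have hti : ∀ a b, IntervalIntegrable t volume a b := fun a b => htm.intervalIntegrable
  have hj := jj_cont hξ
  have hji : ∀ a b, IntervalIntegrable (jj ξ) volume a b := fun a b => hj.intervalIntegrable a b
  have hDi : ∀ a b, IntervalIntegrable (fun s => t s - jj ξ s) volume a b := fun a b => (hti a b).sub (hji a b)
  have hε : C / L^2 ≤ 1/4 := by rw [div_le_iff₀ (by positivity)]; linarith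
  have := contraction (fun s => t s - jj ξ s) U (C / L^2) (t U + (1+U)^2) (by positivity) hε hDi ?_ ?_ ?_ U hU le_rfl
  · calc _ ≤ _ := this
      _ = _ := by ring
  · intro u hu huU
    have h1 := htm huU
    have h2 := ht0 u
    have h3 := jj_ge hξ u
    have h4 := jj_le hξ u hu
    have h5 : (1+u)^2 ≤ (1+U)^2 := by gcongr
    rw [abs_le]; constructor <;> linarith [ht0 U]
  · intro u hu hu1
    have := cs_small hy (fun n => 1/(n:ℝ)) hu hu1
    simp only [jj_one hξ u hu1.le]
    change t u - 1 = 0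
    change t u = _ at this
    rw [this]; simp
  · intro u hu huU
    have h1 := hr y u hy hu
    have h2 := jj_rec hξ u hu
    change |u * t u - (∫ s in (0:ℝ)..u, t s) - 2 * ∫ s in (0:ℝ)..(u-1), t s| ≤ C / L^2 * t (u-1) at h1
    have i1 : |∫ s in (0:ℝ)..u, (t s - jj ξ s)| ≤ ∫ s in (0:ℝ)..u, |t s - jj ξ s| :=
      intervalIntegral.abs_integral_le_integral_abs (by linarith)
    have i2 : |∫ s in (0:ℝ)..(u-1), (t s - jj ξ s)| ≤ ∫ s in (0:ℝ)..(u-1), |t s - jj ξ s| :=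
      intervalIntegral.abs_integral_le_integral_abs (by linarith)
    rw [intervalIntegral.integral_sub (hti _ _) (hji _ _)] at i1 i2
    have h6 : t (u-1) ≤ (1+u)^2 + |t (u-1) - jj ξ (u-1)| := by
      have := jj_le hξ (u-1) (by linarith)
      have := le_abs_self (t (u-1) - jj ξ (u-1))
      nlinarith
    have h7 : C / L^2 * t (u-1) ≤ C / L^2 * ((1+u)^2 + |t (u-1) - jj ξ (u-1)|) := by gcongr
    have h8 : u * |t u - jj ξ u| = |u * (t u - jj ξ u)| := by
      rw [abs_mul, abs_of_nonneg (by linarith : 0 ≤ u)]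
    rw [h8]
    have e : u * (t u - jj ξ u) = (u * t u - (∫ s in (0:ℝ)..u, t s) - 2 * ∫ s in (0:ℝ)..(u-1), t s)
      + ((∫ s in (0:ℝ)..u, t s) - ∫ s in (0:ℝ)..u, jj ξ s)
      + 2 * ((∫ s in (0:ℝ)..(u-1), t s) - ∫ s in (0:ℝ)..(u-1), jj ξ s) := by
      rw [mul_sub, h2]; ring
    rw [e]
    refine (abs_add_le _ _).trans ?_
    have a1 := abs_add_le (u * t u - (∫ s in (0:ℝ)..u, t s) - 2 * ∫ s in (0:ℝ)..(u-1), t s) ((∫ s in (0:ℝ)..u, t s) - ∫ s in (0:ℝ)..u, jj ξ s)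
    rw [abs_mul, abs_of_pos (by norm_num : (0:ℝ) < 2)]
    linarith

end RD

open Real MeasureTheory

namespace RD

lemma choose_L (K : ℝ) : ∃ L₀ ≥ 1, ∀ L ≥ L₀, K * (1 + 18 * log L)^11 ≤ L ∧ 1 + 18 * log L ≤ L ∧ K ≤ L^2 := by
  have h1 : ∀ᶠ L in Filter.atTop, (|K| + 1) * (1 + 18 * log L)^11 ≤ L := by
    have h := (isLittleO_pow_log_id_atTop (n := 11)).bound
      (show 0 < 1 / ((|K| + 1) * 19^11) by positivity)
    filter_upwards [h, Filter.eventually_ge_atTop (rexp 1)] with L hL hL1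
    have hl : 1 ≤ log L := by
      rw [Real.le_log_iff_exp_le (lt_of_lt_of_le (Real.exp_pos 1) hL1)]; exact hL1
    have hL0 : 0 < L := lt_of_lt_of_le (Real.exp_pos 1) hL1
    rw [Real.norm_of_nonneg (by positivity), id, Real.norm_of_nonneg hL0.le, div_mul_eq_mul_div, one_mul,
      le_div_iff₀ (by positivity)] at hL
    calc (|K| + 1) * (1 + 18 * log L)^11 ≤ (|K| + 1) * (19 * log L)^11 := by gcongr; linarith
      _ = log L ^ 11 * ((|K| + 1) * 19^11) := by ring
      _ ≤ L := hL
  obtain ⟨L₁, h⟩ := Filter.eventually_atTop.1 h1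
  refine ⟨max L₁ (1 + |K|), le_max_of_le_right (by linarith [abs_nonneg K]), fun L hL => ?_⟩
  have hL1 := h L ((le_max_left _ _).trans hL)
  have hL2 := (le_max_right _ _).trans hL
  have hK := abs_nonneg K
  have hK2 := le_abs_self K
  have hl : 0 ≤ log L := Real.log_nonneg (by linarith)
  have hp : 1 ≤ (1 + 18 * log L)^11 := one_le_pow₀ (by linarith)
  have hp2 : (1 + 18 * log L) ≤ (1 + 18 * log L)^11 := le_self_pow₀ (by linarith) (by norm_num)
  refine ⟨?_, ?_, ?_⟩
  · nlinarith
  · nlinarith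
  · nlinarith

/-- unweighted -/
noncomputable def bw (y : ℝ) (n : ℕ) : ℝ := tau n * rg y n * 1

lemma bw_nonneg (y : ℝ) (n : ℕ) : 0 ≤ bw y n := by
  unfold bw; have := tau_nonneg n; have := rg_nonneg y n; positivity

lemma S_eq_cs (y L u : ℝ) : S (rexp (u * L)) y = cs (bw y) L u := by
  rw [S_eq_rg]; simp [cs, bw]

lemma s_id : ∃ C > 0, ∀ y u : ℝ, 2 ≤ y → 1 ≤ u →
    |u * log y * cs (bw y) (log y) u - (∑ n ∈ Finset.Icc 1 ⌊rexp (u * log y)⌋₊, bw y n * (u * log y - log n))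
      - 2 * (rexp (u * log y) * cs (aw y) (log y) (u-1) - y * cs (bw y) (log y) (u-1))|
      ≤ C * (rexp (u * log y)) / (log y)^2 * cs (aw y) (log y) (u-1) := by
  obtain ⟨C, hC, hB⟩ := rough_pnt
  refine ⟨2 * C, by positivity, fun y u hy hu => ?_⟩
  have hL : 0 < log y := by linarith [two_thirds_lt_log hy]
  have hy' : rexp (log y) = y := Real.exp_log (by linarith)
  have hy0 : 0 < y := by linarith
  have h1 := conv_split hy (fun n => 1) (fun m n _ _ => by norm_num) hu
  have h4 : ∑ n ∈ Finset.Icc 1 ⌊rexp (u * log y)⌋₊, bw y n * (u * log y - log n)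
      = u * log y * cs (bw y) (log y) u - ∑ n ∈ Finset.Icc 1 ⌊rexp (u * log y)⌋₊, bw y n * log n := by
    rw [cs, Finset.mul_sum, ← Finset.sum_sub_distrib]
    exact Finset.sum_congr rfl fun n _ => by ring
  change ∑ n ∈ Finset.Icc 1 ⌊rexp (u * log y)⌋₊, bw y n * log n = 2 * ∑ m ∈ Finset.Icc 1 ⌊rexp ((u-1) * log y)⌋₊, bw y m * _ at h1
  set L := log y with hLdef
  have hx : rexp (u * L) = rexp ((u-1) * L) * y := by
    nth_rewrite 1 [← hy']; rw [← Real.exp_add]; congr 1; ring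
  set x := rexp (u * L) with hxdef
  have hx0 : 0 < x := Real.exp_pos _
  have key : |∑ m ∈ Finset.Icc 1 ⌊rexp ((u-1) * L)⌋₊, bw y m *
      (∑ k ∈ Finset.Icc 0 ⌊x / m⌋₊, lr y k * 1) - (x * cs (aw y) L (u-1) - y * cs (bw y) L (u-1))|
      ≤ C * x / L^2 * cs (aw y) L (u-1) := by
    rw [cs, cs, Finset.mul_sum, Finset.mul_sum, ← Finset.sum_sub_distrib, ← Finset.sum_sub_distrib, Finset.mul_sum]
    refine (Finset.abs_sum_le_sum_abs _ _).trans (Finset.sum_le_sum fun m hm => ?_)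
    rw [Finset.mem_Icc, Nat.le_floor_iff (by positivity)] at hm
    have hm0 : (0:ℝ) < m := by exact_mod_cast hm.1
    have hz : y ≤ x / m := by
      rw [le_div_iff₀ hm0, hx, mul_comm]
      gcongr
      exact hm.2
    have h5 := (hB y _ hy hz).2
    have hlz : L ≤ log (x / m) := Real.log_le_log hy0 hz
    have h6 : C * (x / m) / (log (x/m))^2 ≤ C * (x / m) / L^2 := by gcongr
    have e : bw y m * (∑ k ∈ Finset.Icc 0 ⌊x / m⌋₊, lr y k * 1) - (x * aw y m - y * bw y m)
       = bw y m * (∑ k ∈ Finset.Icc 0 ⌊x / m⌋₊, lr y k - (x / m - y)) := by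
      simp only [mul_one, aw, bw]; ring
    rw [e, abs_mul, abs_of_nonneg (bw_nonneg y m)]
    calc _ ≤ bw y m * (C * (x / m) / L^2) := mul_le_mul_of_nonneg_left (h5.trans h6) (bw_nonneg y m)
      _ = _ := by simp only [aw, bw]; ring
  rw [h4, h1]
  set A := ∑ m ∈ Finset.Icc 1 ⌊rexp ((u-1) * L)⌋₊, bw y m * (∑ k ∈ Finset.Icc 0 ⌊x / m⌋₊, lr y k * 1)
  set R := (x * cs (aw y) L (u-1) - y * cs (bw y) L (u-1))
  have : u * L * cs (bw y) L u - (u * L * cs (bw y) L u - 2 * A) - 2 * R = 2 * (A - R) := by ring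
  rw [this, abs_mul, abs_of_pos (by norm_num : (0:ℝ) < 2)]
  calc _ ≤ 2 * (C * x / L^2 * cs (aw y) L (u-1)) := by gcongr
    _ = _ := by ring

lemma w_bound (y u : ℝ) (hu : 0 ≤ u) (hy : 2 ≤ y) :
    ∑ n ∈ Finset.Icc 1 ⌊rexp (u * log y)⌋₊, bw y n * (u * log y - log n) ≤
      u * log y + rexp (u * log y) * cs (aw y) (log y) u := by
  have hL : 0 < log y := by linarith [two_thirds_lt_log hy]
  set L := log y
  have h1 : 1 ≤ ⌊rexp (u * L)⌋₊ := by
    rw [Nat.one_le_floor_iff]; apply Real.one_le_exp; positivity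
  have e : u * L = ∑ n ∈ Finset.Icc 1 ⌊rexp (u * L)⌋₊, if n = 1 then u * L else 0 := by
    rw [Finset.sum_ite_eq']; simp [h1]
  nth_rewrite 3 [e]
  rw [cs, Finset.mul_sum, ← Finset.sum_add_distrib]
  refine Finset.sum_le_sum fun n hn => ?_
  have ha := aw_nonneg y n
  have hx := Real.exp_pos (u * L)
  split_ifs with h
  · subst h
    simp only [bw, tau, rg_one]
    simp; positivity
  · rw [Finset.mem_Icc] at hn
    have hn0 : (0:ℝ) < n := by exact_mod_cast hn.1
    have : u * L - log n ≤ rexp (u * L) / n := by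
      have := Real.log_le_sub_one_of_pos (show 0 < rexp (u * L) / n by positivity)
      rw [Real.log_div hx.ne' hn0.ne', Real.log_exp] at this
      linarith
    calc bw y n * (u * L - log n) ≤ bw y n * (rexp (u * L) / n) := mul_le_mul_of_nonneg_left this (bw_nonneg y n)
      _ = _ := by simp only [aw, bw]; ring

set_option maxHeartbeats 1000000 in
lemma mid : ∃ C > 0, ∃ L₀ ≥ 1, ∀ ξ : ℝ → ℝ, IsXi ξ → ∀ y u : ℝ, 2 ≤ y → L₀ ≤ log y → 1 ≤ u → u ≤ 18 * log (log y) →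
    |S (rexp (u * log y)) y - 1 - rexp (u * log y) / log y * ξ u + 2 * y / log y| ≤ C * rexp (u * log y) / (log y)^2 := by
  obtain ⟨Ct, hCt, ht⟩ := t_main
  obtain ⟨Cs, hCs, hs⟩ := s_id
  obtain ⟨L₀, hL₀, hch⟩ := choose_L Ct
  set K : ℝ := 2 * (2 + 4 + 2 * Cs) with hK
  refine ⟨2 * K + 2 * Cs + 2 * K + 2 + 2, by positivity, L₀, hL₀, fun ξ hξ y U hy hL hU1 hU => ?_⟩
  have hL1 : 1 ≤ log y := hL₀.trans hL
  obtain ⟨c1, c2, c3⟩ := hch (log y) hL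
  have hy0 : 0 < y := by linarith
  have hy' : rexp (log y) = y := Real.exp_log hy0
  have htm : Monotone (cs (aw y) (log y)) := cs_mono (aw_nonneg y) (by linarith)
  have hsm : Monotone (cs (bw y) (log y)) := cs_mono (bw_nonneg y) (by linarith)
  have ht' := ht ξ hξ y
  have hs' := hs y
  have hwb := w_bound y
  have hli := log_int (bw y) (L := log y) (u := U) (by linarith)
  rw [S_eq_cs]
  have hsmall : ∀ v, 0 ≤ v → v < 1 → cs (bw y) (log y) v = 1 := fun v h1 h2 => cs_small hy (fun _ => 1) h1 h2
  set L := log y with hLdef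
  have hL0 : 0 < L := by linarith
  set t := cs (aw y) L
  set s := cs (bw y) L
  -- bounds on t
  have t1 : ∀ v, 0 ≤ v → v ≤ 18 * log L → |t v - jj ξ v| ≤ 1 / L := by
    intro v h1 h2
    refine (ht' v hy c3 h1).trans ?_
    have : Ct * (1+v)^11 ≤ L := by
      refine le_trans ?_ c1
      gcongr
    calc Ct / L^2 * (1+v)^11 = (Ct * (1+v)^11) / L^2 := by ring
      _ ≤ L / L^2 := by gcongr
      _ = 1 / L := by field_simp
  have hL1' : 1 / L ≤ 1 := by rw [div_le_one hL0]; exact hL1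
  have t2 : ∀ v, 0 ≤ v → v ≤ 18 * log L → t v ≤ 2 * (1+v)^2 := by
    intro v h1 h2
    have a := abs_le.1 (t1 v h1 h2)
    have b := jj_le hξ v h1
    nlinarith
  have t0 : ∀ v, 0 ≤ t v := fun s => Finset.sum_nonneg fun n _ => aw_nonneg y n
  have s1 : ∀ v, 0 ≤ v → 1 ≤ s v := by
    intro v hv
    rw [← hsmall 0 le_rfl (by norm_num)]
    exact hsm hv
  -- a priori
  have s2 : ∀ v, 0 ≤ v → v ≤ 18 * log L → s v - 1 ≤ K * (1+v) / L * rexp (v * L) := by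
    intro v h1 h2
    rcases lt_or_ge v 1 with h3 | h3
    · rw [hsmall v h1 h3, sub_self]; positivity
    · have e1 := (abs_le.1 (hs' v hy h3)).2
      have e2 := hwb v h1 hy
      change _ ≤ v * L + rexp (v * L) * t v at e2
      set x := rexp (v * L)
      have hx0 : 0 < x := Real.exp_pos _
      have e3 := s1 (v-1) (by linarith)
      have e4 := t2 v h1 h2
      have e5 := t2 (v-1) (by linarith) (by linarith)
      rw [show 1 + (v - 1) = v by ring] at e5
      have e6 : Cs * x / L^2 * t (v-1) ≤ Cs * x * t (v-1) := by
        gcongr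
        · exact t0 _
        · apply div_le_self (by positivity); exact one_le_pow₀ hL1
      have e7 : v * L * (s v - 1) ≤ x * t v + 2 * x * t (v-1) + Cs * x * t (v-1) := by
        have : 0 ≤ y * s (v-1) := mul_nonneg hy0.le (by linarith)
        linarith
      have e8 : x * t v + 2 * x * t (v-1) + Cs * x * t (v-1) ≤ x * (2 + 4 + 2 * Cs) * (1+v)^2 := by
        have a1 : x * t v ≤ x * (2 * (1+v)^2) := by gcongr
        have a2 : t (v-1) ≤ 2 * (1+v)^2 := by nlinarith
        have a3 : 2 * x * t (v-1) ≤ 2 * x * (2 * (1+v)^2) := by gcongr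
        have a4 : Cs * x * t (v-1) ≤ Cs * x * (2 * (1+v)^2) := by gcongr
        linarith
      have e9 : x * (2 + 4 + 2 * Cs) * (1+v)^2 ≤ v * L * (K * (1+v) / L * x) := by
        have : v * L * (K * (1+v) / L * x) = (2 * v) * (x * (2 + 4 + 2 * Cs) * (1+v)) := by
          rw [hK]; field_simp
        rw [this]
        have : 0 ≤ x * (2 + 4 + 2 * Cs) * (1+v) := by positivity
        nlinarith
      exact le_of_mul_le_mul_left (e7.trans (e8.trans e9)) (by positivity)
  -- integral
  set x := rexp (U * L) with hxdef
  have hx0 : 0 < x := Real.exp_pos _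
  have hU0 : 0 ≤ U := by linarith
  have hUL : U ≤ L := by linarith
  have hsi : ∀ a b, IntervalIntegrable s volume a b := fun a b => hsm.intervalIntegrable
  have i1 : 0 ≤ L * (∫ v in (0:ℝ)..U, s v) - U * L ∧ L * (∫ v in (0:ℝ)..U, s v) - U * L ≤ K * (1+U) / L * x := by
    have e1 : (∫ v in (0:ℝ)..U, s v) - U = ∫ v in (0:ℝ)..U, (s v - 1) := by
      rw [intervalIntegral.integral_sub (hsi _ _) (by simp)]; simp
    have e2 : 0 ≤ ∫ v in (0:ℝ)..U, (s v - 1) :=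
      intervalIntegral.integral_nonneg hU0 fun v hv => by linarith [s1 v hv.1]
    have e3 : ∫ v in (0:ℝ)..U, (s v - 1) ≤ ∫ v in (0:ℝ)..U, K * (1+U) / L * rexp (v * L) := by
      apply intervalIntegral.integral_mono_on hU0 ((hsi _ _).sub (by simp)) (Continuous.intervalIntegrable (by fun_prop) _ _)
      intro v hv
      refine (s2 v hv.1 (hv.2.trans hU)).trans ?_
      have := hv.2
      gcongr
    have e4 : ∫ v in (0:ℝ)..U, rexp (v * L) = L⁻¹ * (x - 1) := by
      rw [intervalIntegral.integral_comp_mul_right (fun v => rexp v) hL0.ne', integral_exp]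
      simp [hxdef]
    rw [intervalIntegral.integral_const_mul, e4] at e3
    have e5 : L * (∫ v in (0:ℝ)..U, s v) - U * L = L * ∫ v in (0:ℝ)..U, (s v - 1) := by rw [← e1]; ring
    rw [e5]
    refine ⟨by positivity, ?_⟩
    calc _ ≤ L * (K * (1+U) / L * (L⁻¹ * (x-1))) := by gcongr
      _ = K * (1+U) / L * (x - 1) := by field_simp
      _ ≤ _ := by gcongr; linarith
  have hm := hs' U hy hU1
  rw [hli] at hm
  change |U * L * s U - L * (∫ v in (0:ℝ)..U, s v) - 2 * (x * t (U-1) - y * s (U-1))| ≤ Cs * x / L^2 * t (U-1) at hm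
  have f1 := t1 (U-1) (by linarith) (by linarith)
  have f2 := t2 (U-1) (by linarith) (by linarith)
  have f3 := s2 (U-1) (by linarith) (by linarith)
  have f4 := s1 (U-1) (by linarith)
  rw [show 1 + (U - 1) = U by ring] at f2 f3
  have hxy : y * rexp ((U-1) * L) = x := by
    nth_rewrite 1 [← hy']; rw [← Real.exp_add, hxdef]; congr 1; ring
  have g1 : y * (s (U-1) - 1) ≤ K * (U * x / L) := by
    calc _ ≤ y * (K * U / L * rexp ((U-1) * L)) := by gcongr
      _ = K * (U * (y * rexp ((U-1) * L)) / L) := by ring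
      _ = _ := by rw [hxy]
  have g1' : 0 ≤ y * (s (U-1) - 1) := mul_nonneg hy0.le (by linarith)
  have g2 : Cs * x / L^2 * t (U-1) ≤ 2 * Cs * (U * x / L) := by
    calc _ ≤ Cs * x / L^2 * (2 * U^2) := by gcongr
      _ = 2 * Cs * (U * x / L) * (U / L) := by field_simp
      _ ≤ 2 * Cs * (U * x / L) * 1 := by gcongr; rw [div_le_one hL0]; exact hUL
      _ = _ := by ring
  have g3 : K * (1+U) / L * x ≤ 2 * K * (U * x / L) := by
    calc _ ≤ K * (2 * U) / L * x := by gcongr; linarith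
      _ = _ := by ring
  have g4 : |x * t (U-1) - x * jj ξ (U-1)| ≤ U * x / L := by
    rw [← mul_sub, abs_mul, abs_of_pos hx0]
    calc _ ≤ x * (1 / L) := by gcongr
      _ = 1 * x / L := by ring
      _ ≤ _ := by gcongr
  have g5 := xi_jj hξ U hU1
  have g6 : |2 * y * (U - 1)| ≤ 2 * (U * x / L) := by
    rw [abs_of_nonneg (by have : 0 ≤ U - 1 := by linarith
                          positivity)]
    have : (U-1) * L + 1 ≤ rexp ((U-1) * L) := Real.add_one_le_exp _
    have h7 : y * ((U-1) * L) ≤ x := by rw [← hxy]; gcongr; linarith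
    calc 2 * y * (U-1) = 2 * (y * ((U-1) * L)) / L := by field_simp
      _ ≤ 2 * x / L := by gcongr
      _ ≤ 2 * (U * x / L) := by rw [mul_div_assoc]; gcongr; exact le_mul_of_one_le_left hx0.le hU1
  have fin : U * L * |s U - 1 - x / L * ξ U + 2 * y / L| ≤ U * L * ((2 * K + 2 * Cs + 2 * K + 2 + 2) * x / L^2) := by
    have a1 : U * L * |s U - 1 - x / L * ξ U + 2 * y / L| = |U * L * (s U - 1 - x / L * ξ U + 2 * y / L)| := by
      rw [abs_mul, abs_of_pos (by positivity : 0 < U * L)]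
    have a2 : U * L * (s U - 1 - x / L * ξ U + 2 * y / L) = U * L * s U - U * L - x * (2 * jj ξ (U-1)) + 2 * y + 2 * y * (U - 1) := by
      rw [← g5]; field_simp; ring
    have a3 : U * L * ((2 * K + 2 * Cs + 2 * K + 2 + 2) * x / L^2) = (2 * K + 2 * Cs + 2 * K + 2 + 2) * (U * x / L) := by
      field_simp
    rw [a1, a2, a3]
    rw [abs_le] at hm g4 g6 ⊢
    constructor <;> linarith [i1.1, i1.2, hm.1, hm.2, g4.1, g4.2, g6.1, g6.2]
  exact le_of_mul_le_mul_left fin (by positivity)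

end RD

open Real MeasureTheory

namespace RD

/-- e^{-2γ} -/
noncomputable def eg2 : ℝ := rexp (-2 * eulerMascheroniConstant)

lemma eg2_pos : 0 < eg2 := Real.exp_pos _
lemma eg2_le : eg2 ≤ 1 := by
  unfold eg2
  rw [Real.exp_le_one_iff]
  linarith [one_half_lt_eulerMascheroniConstant]

lemma V_sq : ∃ C > 0, ∀ y : ℝ, 2 ≤ y → |(primeProd y)^2 - eg2 / (log y)^2| ≤ C / (log y)^4 := by
  obtain ⟨C, hC, h⟩ := V_mertens
  obtain ⟨C3, hC3, h3⟩ := V_le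
  refine ⟨C * (C3 + 1), by positivity, fun y hy => ?_⟩
  have hL : 0 < log y := by linarith [two_thirds_lt_log hy]
  obtain ⟨v0, v1⟩ := h3 y hy
  have h1 := h y hy
  set L := log y
  set V := primeProd y
  set e := rexp (-eulerMascheroniConstant)
  have he0 : 0 < e := Real.exp_pos _
  have he1 : e ≤ 1 := by
    rw [Real.exp_le_one_iff]; linarith [one_half_lt_eulerMascheroniConstant]
  have hg : eg2 = e^2 := by
    unfold eg2; rw [← Real.exp_nat_mul]; congr 1; push_cast; ring
  rw [le_div_iff₀ hL] at v1
  have e1 : V^2 - eg2 / L^2 = (V * L - e) * (V * L + e) / L^2 := by rw [hg]; field_simp; ring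
  rw [e1, abs_div, abs_mul, abs_of_pos (by positivity : 0 < L^2), abs_of_nonneg (by positivity : 0 ≤ V * L + e)]
  calc _ ≤ C / L^2 * (C3 + 1) / L^2 := by gcongr
    _ = _ := by field_simp

lemma V_sq' : ∃ C > 0, ∀ y x u : ℝ, 2 ≤ y → 0 ≤ x → 0 ≤ u →
    |(primeProd y)^2 * x * (u * log y) - x / log y * (u * eg2)| ≤ C * (x * u / (log y)^3) := by
  obtain ⟨C, hC, h⟩ := V_sq
  refine ⟨C, hC, fun y x u hy hx hu => ?_⟩
  have hL : 0 < log y := by linarith [two_thirds_lt_log hy]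
  have h1 := h y hy
  have e : (primeProd y)^2 * x * (u * log y) - x / log y * (u * eg2) =
    (x * u * log y) * ((primeProd y)^2 - eg2 / (log y)^2) := by field_simp
  rw [e, abs_mul, abs_of_nonneg (by positivity)]
  calc _ ≤ (x * u * log y) * (C / (log y)^4) := by gcongr
    _ = _ := by field_simp

lemma xi_asym {ξ : ℝ → ℝ} (hξ : IsXi ξ) : ∃ C > 0, ∀ u : ℝ, 1 ≤ u → |ξ u - eg2 * (u + 2)| ≤ C * rexp (-u/18) := by
  obtain ⟨C1, hC1, L₀, hL₀, h1⟩ := mid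
  obtain ⟨C2, hC2, h2⟩ := sieve_main
  obtain ⟨C3, hC3, h3⟩ := V_sq'
  set u1 : ℝ := max 2 (18 * log L₀) with hu1
  have hu12 : 2 ≤ u1 := le_max_left _ _
  refine ⟨C1 + 2 * C2 + 20 * C3 + 3 + (3 * u1 + 2) * rexp (u1/18), by positivity, fun u hu => ?_⟩
  rcases lt_or_ge u u1 with hc | hc
  · have a1 := xi_nonneg hξ u
    have a2 := xi_le hξ u hu
    have a3 := eg2_pos
    have a4 := eg2_le
    have a5 : |ξ u - eg2 * (u + 2)| ≤ 3 * u1 + 2 := by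
      have : 0 ≤ eg2 * (u+2) := by positivity
      have : eg2 * (u+2) ≤ 1 * (u+2) := by gcongr
      rw [abs_le]; constructor <;> linarith
    refine a5.trans ?_
    have a6 : 1 ≤ rexp (u1/18) * rexp (-u/18) := by
      rw [← Real.exp_add]; apply Real.one_le_exp; linarith
    have a7 : 0 < rexp (-u/18) := Real.exp_pos _
    calc 3 * u1 + 2 = (3 * u1 + 2) * 1 := by ring
      _ ≤ (3 * u1 + 2) * (rexp (u1/18) * rexp (-u/18)) := by gcongr
      _ = ((3 * u1 + 2) * rexp (u1/18)) * rexp (-u/18) := by ring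
      _ ≤ _ := by gcongr; linarith
  · have hu2 : 2 ≤ u := hu12.trans hc
    have hu3 : 18 * log L₀ ≤ u := (le_max_right _ _).trans hc
    set L := rexp (u/18) with hL
    have hlogL : log L = u / 18 := by rw [hL, Real.log_exp]
    have hLL0 : L₀ ≤ L := by
      rw [hL, ← Real.log_le_iff_le_exp (by linarith)]; linarith
    have hL1 : 1 ≤ L := hL₀.trans hLL0
    have hL0 : 0 < L := by linarith
    set y := rexp L with hy
    have hlogy : log y = L := by rw [hy, Real.log_exp]
    have hyL : L + 1 ≤ y := Real.add_one_le_exp L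
    have hy2 : 2 ≤ y := by linarith
    have m := h1 ξ hξ y u hy2 (by rw [hlogy]; exact hLL0) hu (by rw [hlogy, hlogL]; linarith)
    rw [hlogy] at m
    set x := rexp (u * L) with hx
    have hlogx : log x = u * L := by rw [hx, Real.log_exp]
    have hx1 : 1 ≤ x := Real.one_le_exp (by positivity)
    have sv := h2 x y hx1 hy2
    have v := h3 y x (u+2) hy2 (by linarith) (by linarith)
    rw [hlogy] at sv v
    rw [hlogx, mul_div_cancel_right₀ u hL0.ne'] at sv
    have hE : L^3 * rexp (-u/3) ≤ 1 / L^2 := by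
      have e : L^5 * rexp (-u/3) ≤ 1 := by
        rw [hL, ← Real.exp_nat_mul, ← Real.exp_add, Real.exp_le_one_iff]
        push_cast; linarith
      rw [le_div_iff₀ (by positivity)]
      calc _ = L^5 * rexp (-u/3) := by ring
        _ ≤ 1 := e
    have hul : u + 2 ≤ 20 * L := by
      have := Real.add_one_le_exp (u/18)
      linarith
    have hxy : y * L ≤ x := by
      have : y * y ≤ x := by
        rw [hy, hx, ← Real.exp_add]
        apply Real.exp_le_exp.2; nlinarith
      nlinarith
    have hx2 : L^2 ≤ x := by nlinarith
    have b1 : y / L ≤ x / L^2 := by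
      rw [div_le_div_iff₀ hL0 (by positivity)]
      nlinarith
    have b2 : 1 ≤ x / L^2 := by rw [le_div_iff₀ (by positivity)]; linarith
    have b3 : x * (u+2) / L^3 ≤ 20 * (x / L^2) := by
      calc _ ≤ x * (20 * L) / L^3 := by gcongr
        _ = _ := by field_simp
    have b4 : C2 * L^3 * x * rexp (-u/3) ≤ C2 * (x / L^2) := by
      calc _ = C2 * x * (L^3 * rexp (-u/3)) := by ring
        _ ≤ C2 * x * (1 / L^2) := by gcongr
        _ = _ := by ring
    have b5 : C3 * (x * (u+2) / L^3) ≤ C3 * (20 * (x / L^2)) := by gcongr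
    have key : |x / L * (ξ u - eg2 * (u+2))| ≤ (C1 + 2 * C2 + 20 * C3 + 3) * (x / L^2) := by
      have e1 : x / L * (ξ u - eg2 * (u+2)) = x / L * ξ u - x / L * ((u+2) * eg2) := by ring
      have e2 : primeProd y ^ 2 * x * (u * L + 2 * L) = primeProd y ^ 2 * x * ((u+2) * L) := by ring
      rw [e1]
      rw [e2] at sv
      have e3 : C1 * x / L^2 = C1 * (x / L^2) := by ring
      have e4 : C2 * x / L^2 = C2 * (x / L^2) := by ring
      rw [e3] at m
      rw [e4] at sv
      have e5 : 2 * y / L = 2 * (y / L) := by ring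
      rw [e5] at m
      have b6 : 0 < y / L := by positivity
      rw [abs_le] at m sv v ⊢
      constructor <;> linarith [m.1, m.2, sv.1, sv.2, v.1, v.2]
    rw [abs_mul, abs_of_pos (by positivity : 0 < x / L)] at key
    have hLi : rexp (-u/18) = 1 / L := by
      rw [hL, one_div, ← Real.exp_neg]; congr 1; ring
    rw [hLi]
    have key2 : x / L * |ξ u - eg2 * (u+2)| ≤ x / L * ((C1 + 2 * C2 + 20 * C3 + 3) * (1 / L)) := by
      calc _ ≤ _ := key
        _ = _ := by field_simp
    have key3 := le_of_mul_le_mul_left key2 (by positivity)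
    refine key3.trans ?_
    refine mul_le_mul_of_nonneg_right ?_ (by positivity)
    have : 0 ≤ (3 * u1 + 2) * rexp (u1/18) := by positivity
    linarith

/-- the quantity -/
noncomputable def QQ (ξ : ℝ → ℝ) (x y : ℝ) : ℝ :=
  S x y - 1 - x * Real.log x * (primeProd y) ^ 2 -
        x / Real.log y *
          (ξ (Real.log x / Real.log y) -
            (Real.log x / Real.log y) * Real.exp (-2 * Real.eulerMascheroniConstant) -
            (if y ≤ x then 2 * y / x else 0))

lemma fin_sieve {ξ : ℝ → ℝ} (hξ : IsXi ξ) (K : ℝ) (hK : 0 < K) : ∃ C > 0, ∀ x y : ℝ, 2 ≤ y → y ≤ x →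
    (log y)^3 * rexp (-(log x / log y)/3) ≤ K / (log y)^2 → rexp (-(log x / log y)/18) ≤ K / log y →
    y ≤ K * (x / log y) → |QQ ξ x y| ≤ C * (x / (log y)^2) := by
  obtain ⟨C1, hC1, h1⟩ := xi_asym hξ
  obtain ⟨C2, hC2, h2⟩ := sieve_main
  obtain ⟨C3, hC3, h3⟩ := V_sq'
  refine ⟨C2 + C2 * K + 2 * (C3 * 2) + 2 + C1 * K + 2 * K, by positivity, fun x y hy hyx f1 f2 f3 => ?_⟩
  have hL := two_thirds_lt_log hy
  have hx0 : 0 < x := by linarith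
  have hLx : log y ≤ log x := Real.log_le_log (by linarith) hyx
  have sv := h2 x y (by linarith) hy
  have v := h3 y x 2 hy hx0.le (by norm_num)
  have xa := h1 (log x / log y) (by rw [le_div_iff₀ (by linarith)]; linarith)
  have sl := sq_log_le (x := x) (by linarith)
  unfold QQ
  rw [if_pos hyx]
  change |_ - x / log y * (_ - _ * eg2 - _)| ≤ _
  set L := log y
  set u := log x / L with hu
  set V := primeProd y
  have hL0 : 0 < L := by linarith
  have hlx : log x = u * L := by rw [hu]; field_simp
  rw [hlx] at sv sl hLx ⊢
  have b1 : C2 * L^3 * x * rexp (-u/3) ≤ C2 * K * (x / L^2) := by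
    calc _ = C2 * x * (L^3 * rexp (-u/3)) := by ring
      _ ≤ C2 * x * (K / L^2) := by gcongr
      _ = _ := by ring
  have b2 : C3 * (x * 2 / L^3) ≤ (2 * (C3 * 2)) * (x / L^2) := by
    have : C3 * (x * 2 / L^3) = (2 * C3) * (x / L^2) * (1 / L) := by field_simp
    rw [this]
    have h5 : 1 / L ≤ 2 := by rw [div_le_iff₀ hL0]; linarith
    calc _ ≤ (2 * C3) * (x / L^2) * 2 := by gcongr
      _ = _ := by ring
  have b3 : 1 ≤ 2 * (x / L^2) := by
    have : L^2 ≤ (u * L)^2 := by gcongr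
    rw [← mul_div_assoc, le_div_iff₀ (by positivity)]; linarith
  have b4 : |x / L * (ξ u - eg2 * (u+2))| ≤ C1 * K * (x / L^2) := by
    rw [abs_mul, abs_of_pos (by positivity)]
    calc _ ≤ x / L * (C1 * (K / L)) := by gcongr; exact xa.trans (by gcongr)
      _ = _ := by field_simp
  have b5 : 2 * y / L ≤ 2 * K * (x / L^2) := by
    calc _ ≤ 2 * (K * (x / L)) / L := by gcongr
      _ = _ := by field_simp
  have b5' : 0 ≤ 2 * y / L := by positivity
  have e : S x y - 1 - x * (u * L) * V^2 - x / L * (ξ u - u * eg2 - 2 * y / x)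
    = (S x y - V^2 * x * (u * L + 2 * L)) + (V^2 * x * (2 * L) - x / L * (2 * eg2)) - 1
      - x / L * (ξ u - eg2 * (u + 2)) + 2 * y / L := by
    field_simp; ring
  rw [e]
  have e4 : C2 * x / L^2 = C2 * (x / L^2) := by ring
  rw [e4] at sv
  have hxL : 0 ≤ x / L^2 := by positivity
  rw [abs_le] at sv v b4 ⊢
  constructor <;> linarith [sv.1, sv.2, v.1, v.2, b4.1, b4.2]

lemma fin_all {ξ : ℝ → ℝ} (hξ : IsXi ξ) : ∃ C > 0, ∀ x y : ℝ, 1 ≤ x → 2 ≤ y → |QQ ξ x y| ≤ C * (x / (log y)^2) := by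
  obtain ⟨C1, hC1, L₀, hL₀, h1⟩ := mid
  obtain ⟨C3, hC3, h3⟩ := V_sq'
  obtain ⟨C4, hC4, h4⟩ := fin_sieve hξ (2 + L₀^5) (by positivity)
  refine ⟨C1 + 20 * C3 + C4, by positivity, fun x y hx hy => ?_⟩
  have hL := two_thirds_lt_log hy
  have hL0 : 0 < log y := by linarith
  have hx0 : 0 < x := by linarith
  have hy0 : 0 < y := by linarith
  have hxL : 0 ≤ x / (log y)^2 := by positivity
  have hu0 : 0 ≤ log x / log y := div_nonneg (Real.log_nonneg hx) hL0.le
  have hul : log x / log y * log y = log x := by field_simp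
  have hex : rexp (log x / log y * log y) = x := by rw [hul, Real.exp_log hx0]
  have hv := h3 y x (log x / log y) hy hx0.le hu0
  rcases lt_or_ge x y with hxy | hxy
  · -- small
    have hu1 : log x / log y < 1 := by
      rw [div_lt_one hL0]; exact Real.log_lt_log hx0 hxy
    have hS : S x y = 1 := by
      rw [← hex, S_eq_cs]; exact cs_small hy (fun _ => 1) hu0 hu1
    unfold QQ
    rw [if_neg (by linarith), hS, hξ.1 _ hu1]
    change |_ - x / log y * (_ - _ * eg2 - _)| ≤ _
    rw [hul] at hv
    set L := log y
    set u := log x / L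
    have e : 1 - 1 - x * log x * primeProd y^2 - x / L * (0 - u * eg2 - 0) =
      -(primeProd y^2 * x * log x - x / L * (u * eg2)) := by ring
    rw [e, abs_neg]
    refine hv.trans ?_
    have h5 : u / L ≤ 20 := by rw [div_le_iff₀ hL0]; linarith
    calc C3 * (x * u / L^3) = C3 * (x / L^2) * (u / L) := by field_simp
      _ ≤ C3 * (x / L^2) * 20 := by gcongr
      _ = 20 * C3 * (x / L^2) := by ring
      _ ≤ _ := by gcongr; linarith
  have hu1 : 1 ≤ log x / log y := by
    rw [le_div_iff₀ hL0, one_mul]; exact Real.log_le_log hy0 hxy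
  by_cases hbig : log y < L₀ ∨ 18 * log (log y) ≤ log x / log y
  · have hgoal := h4 x y hy hxy
    set L := log y with hLd
    set u := log x / L with hud
    have : |QQ ξ x y| ≤ C4 * (x / L^2) := by
      have hL05 : 1 ≤ L₀^5 := one_le_pow₀ hL₀
      rcases le_or_gt L₀ L with hc | hc
      · have hb : 18 * log L ≤ u := by
          rcases hbig with h | h
          · linarith
          · exact h
        have hL1 : 1 ≤ L := hL₀.trans hc
        have hLe : L ≤ rexp (u/18) := by
          rw [← Real.log_le_iff_le_exp hL0]; linarith
        apply hgoal
        · have e1 : L^5 ≤ rexp (u/3) := by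
            calc L^5 ≤ (rexp (u/18))^5 := by gcongr
              _ = rexp (5 * (u/18)) := by rw [← Real.exp_nat_mul]; norm_num
              _ ≤ _ := by apply Real.exp_le_exp.2; linarith
          rw [le_div_iff₀ (by positivity), neg_div, Real.exp_neg]
          calc L^3 * (rexp (u/3))⁻¹ * L^2 = L^5 * (rexp (u/3))⁻¹ := by ring
            _ ≤ rexp (u/3) * (rexp (u/3))⁻¹ := by gcongr
            _ = 1 := mul_inv_cancel₀ (Real.exp_pos _).ne'
            _ ≤ _ := by linarith
        · rw [le_div_iff₀ hL0, neg_div, Real.exp_neg]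
          calc (rexp (u/18))⁻¹ * L ≤ (rexp (u/18))⁻¹ * rexp (u/18) := by gcongr
            _ = 1 := inv_mul_cancel₀ (Real.exp_pos _).ne'
            _ ≤ _ := by linarith
        · rcases le_or_gt 2 u with h2u | h2u
          · have hyL : L + 1 ≤ y := by
              have := Real.add_one_le_exp L
              rwa [hLd, Real.exp_log hy0] at this
            have hyy : y * y ≤ x := by
              rw [← hex]
              nth_rewrite 1 2 [← Real.exp_log hy0]
              rw [← Real.exp_add]
              apply Real.exp_le_exp.2
              change L + L ≤ u * L
              nlinarith
            have : y ≤ 1 * (x / L) := by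
              rw [one_mul, le_div_iff₀ hL0]; nlinarith
            refine this.trans ?_
            gcongr
            linarith
          · have : L ≤ 2 := by
              have h9 : log L ≤ 1/9 := by linarith
              rw [Real.log_le_iff_le_exp hL0] at h9
              have h10 : rexp (1/9) ≤ 2 := by
                have := Real.exp_one_lt_d9
                have h11 := Real.add_one_le_exp (-(1/9:ℝ))
                rw [Real.exp_neg] at h11
                have h12 := Real.exp_pos (1/9)
                have h13 : (1 - 1/9) * rexp (1/9) ≤ 1 := by
                  calc (1 - 1/9) * rexp (1/9) ≤ (rexp (1/9))⁻¹ * rexp (1/9) := by gcongr; linarith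
                    _ = 1 := inv_mul_cancel₀ h12.ne'
                linarith
              linarith
            have : y ≤ 2 * (x / L) := by
              rw [← mul_div_assoc, le_div_iff₀ hL0]; nlinarith
            refine this.trans ?_
            gcongr
            linarith
      · have p5 : L^5 ≤ L₀^5 := by gcongr
        have p1 : L ≤ L₀^5 := hc.le.trans (le_self_pow₀ hL₀ (by norm_num))
        apply hgoal
        · have : rexp (-u/3) ≤ 1 := by rw [Real.exp_le_one_iff]; linarith
          rw [le_div_iff₀ (by positivity)]
          calc L^3 * rexp (-u/3) * L^2 = L^5 * rexp (-u/3) := by ring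
            _ ≤ L₀^5 * 1 := by gcongr
            _ ≤ _ := by linarith
        · have : rexp (-u/18) ≤ 1 := by rw [Real.exp_le_one_iff]; linarith
          rw [le_div_iff₀ hL0]
          calc rexp (-u/18) * L ≤ 1 * L₀^5 := by gcongr
            _ ≤ _ := by linarith
        · rw [← mul_div_assoc, le_div_iff₀ hL0]
          calc y * L ≤ x * L₀^5 := by gcongr
            _ ≤ _ := by nlinarith
    refine this.trans ?_
    gcongr
    have : 0 < C1 + 20 * C3 := by positivity
    linarith
  · push Not at hbig
    obtain ⟨g1, g2⟩ := hbig
    have m := h1 ξ hξ y _ hy g1 hu1 g2.le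
    rw [hex] at m
    rw [hul] at hv
    unfold QQ
    rw [if_pos hxy]
    change |_ - x / log y * (_ - _ * eg2 - _)| ≤ _
    set L := log y
    set u := log x / L
    have e : S x y - 1 - x * log x * primeProd y^2 - x / L * (ξ u - u * eg2 - 2 * y / x) =
      (S x y - 1 - x / L * ξ u + 2 * y / L) - (primeProd y^2 * x * log x - x / L * (u * eg2)) := by
      field_simp; ring
    rw [e]
    have h5 : u / L ≤ 20 := by
      rw [div_le_iff₀ hL0]
      have := Real.log_le_sub_one_of_pos hL0
      linarith
    have h6 : C3 * (x * u / L^3) ≤ 20 * C3 * (x / L^2) := by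
      calc C3 * (x * u / L^3) = C3 * (x / L^2) * (u / L) := by field_simp
        _ ≤ C3 * (x / L^2) * 20 := by gcongr
        _ = 20 * C3 * (x / L^2) := by ring
    have h7 : 0 ≤ C4 * (x / L^2) := by positivity
    have e4 : C1 * x / L^2 = C1 * (x / L^2) := by ring
    rw [e4] at m
    refine (abs_sub _ _).trans ?_
    linarith

end RD

theorem thm1_rough_divisor_mean (ξ : ℝ → ℝ)
    (hξ0 : ∀ u : ℝ, u < 1 → ξ u = 0)
    (hξ : ∀ u : ℝ, 1 ≤ u → u * ξ u = 2 + 2 * ∫ t in (1:ℝ)..(u - 1), ξ t) :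
    ∃ C : ℝ, ∀ x y : ℝ, 1 ≤ x → 2 ≤ y →
      |S x y - 1 - x * Real.log x * (primeProd y) ^ 2 -
        x / Real.log y *
          (ξ (Real.log x / Real.log y) -
            (Real.log x / Real.log y) * Real.exp (-2 * Real.eulerMascheroniConstant) -
            (if y ≤ x then 2 * y / x else 0))| ≤ C * x / (Real.log y) ^ 2 := by
  obtain ⟨C, _, h⟩ := RD.fin_all (ξ := ξ) ⟨hξ0, hξ⟩
  refine ⟨C, fun x y hx hy => ?_⟩
  exact (h x y hx hy).trans_eq (by ring)
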